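/- arXiv:1408.2882 — 10 statements merged into one kernel-verified Lean document; each statement's English description precedes it below -/
import Mathlib

section
/- Let α = (α_1,…,α_M) and μ = (μ_1,…,μ_N) be nonnegative nonincreasing sequences of real numbers. A nonnegative nonincreasing sequence λ = (λ_1,…,λ_M) is an (α,μ)-completion if and only if λ_m ≥ α_m for all m = 1,…,M and the following conditions hold: Σ_{m=1}^{M} (λ_m − α_m) = Σ_{n=1}^{N} μ_n, and for every j = 1,…,M, Σ_{m=j}^{M} (λ_m − α_{m−j+1})^+ ≤ Σ_{n=j}^{N} μ_n (empty sums are 0). -/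
open Finset

/-- `a 1, …, a M` is a nonnegative nonincreasing sequence. -/
def NonnegNonincrOn (M : ℕ) (a : ℕ → ℝ) : Prop :=
  (∀ m, 1 ≤ m → m ≤ M → 0 ≤ a m) ∧ ∀ m, 1 ≤ m → m < M → a (m + 1) ≤ a m

/-- `lam` is an `(α,μ)`-completion: it is nonnegative nonincreasing, and it is the spectrum
(with multiplicity) of `A + ∑ₙ φₙ φₙ*` for some self-adjoint `A` with spectrum `α` and
vectors `φₙ ∈ ℂ^M` with `‖φₙ‖² = μₙ`. -/
def IsCompletion (M N : ℕ) (α μ lam : ℕ → ℝ) : Prop :=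
  NonnegNonincrOn M lam ∧
  ∃ (A : Matrix (Fin M) (Fin M) ℂ) (hA : A.IsHermitian)
    (φ : Fin N → Fin M → ℂ)
    (hB : (A + ∑ n : Fin N, Matrix.vecMulVec (φ n) (star (φ n))).IsHermitian)
    (σ τ : Equiv.Perm (Fin M)),
      (∀ i : Fin M, hA.eigenvalues i = α ((σ i : ℕ) + 1)) ∧
      (∀ n : Fin N, ∑ i, ‖φ n i‖ ^ 2 = μ ((n : ℕ) + 1)) ∧
      (∀ i : Fin M, hB.eigenvalues i = lam ((τ i : ℕ) + 1))

section Weyl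

open scoped InnerProductSpace

variable {E : Type*} [NormedAddCommGroup E] [InnerProductSpace ℂ E] {M : ℕ}

theorem re_inner_apply_eq_sum (b : OrthonormalBasis (Fin M) ℂ E) (T : E →ₗ[ℂ] E) (t : Fin M → ℝ)
    (hT : ∀ i, T (b i) = (t i : ℂ) • b i) (x : E) :
    (⟪x, T x⟫_ℂ).re = ∑ i, t i * ‖⟪b i, x⟫_ℂ‖ ^ 2 := by
  have hTx : T x = ∑ i, (⟪b i, x⟫_ℂ * t i) • b i := by
    conv_lhs => rw [← b.sum_repr' x]
    simp only [map_sum, map_smul, hT, smul_smul]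
  rw [hTx, inner_sum, Complex.re_sum]
  refine sum_congr rfl fun i _ => ?_
  rw [inner_smul_right, ← inner_conj_symm x (b i), mul_right_comm, Complex.mul_conj,
    Complex.normSq_eq_norm_sq, ← Complex.ofReal_mul, Complex.ofReal_re, mul_comm]

/-- **Weyl's inequality** for two operators whose quadratic forms are comparable on the orthogonal
complement of finitely many vectors. -/
theorem eigenvalue_le_of_re_inner_le (S T : E →ₗ[ℂ] E) (b c : OrthonormalBasis (Fin M) ℂ E)
    (s t : Fin M → ℝ) (hs : Antitone s) (ht : Antitone t)
    (hS : ∀ i, S (b i) = (s i : ℂ) • b i) (hT : ∀ i, T (c i) = (t i : ℂ) • c i)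
    {κ : Type*} [Fintype κ] (v : κ → E)
    (h : ∀ x, (∀ k, ⟪v k, x⟫_ℂ = 0) → (⟪x, T x⟫_ℂ).re ≤ (⟪x, S x⟫_ℂ).re)
    (i j : Fin M) (hij : (i : ℕ) + Fintype.card κ ≤ j) : t j ≤ s i := by
  have : FiniteDimensional ℂ E := b.toBasis.finiteDimensional_of_finite
  let L : E →ₗ[ℂ] ({k : Fin M // k < i} → ℂ) × ({k : Fin M // j < k} → ℂ) × (κ → ℂ) :=
    (LinearMap.pi fun k : {k : Fin M // k < i} => (innerSL ℂ (b k)).toLinearMap).prod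
      ((LinearMap.pi fun k : {k : Fin M // j < k} => (innerSL ℂ (c k)).toLinearMap).prod
        (LinearMap.pi fun k => (innerSL ℂ (v k)).toLinearMap))
  have hlt : Module.finrank ℂ (({k : Fin M // k < i} → ℂ) × ({k : Fin M // j < k} → ℂ) × (κ → ℂ))
      < Module.finrank ℂ E := by
    rw [Module.finrank_eq_card_basis b.toBasis]
    simp only [Module.finrank_prod, Module.finrank_fintype_fun_eq_card, Fintype.card_fin,
      Fintype.card_subtype]
    have h1 : #{k : Fin M | k < i} = i := by
      rw [Finset.filter_gt_eq_Iio, Fin.card_Iio]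
    have h2 : #{k : Fin M | j < k} = M - 1 - j := by
      rw [Finset.filter_lt_eq_Ioi, Fin.card_Ioi]
    have := j.isLt
    omega
  obtain ⟨x, hx, hx0⟩ := (Submodule.ne_bot_iff _).1
    (LinearMap.ker_ne_bot_of_finrank_lt (f := L) hlt)
  rw [LinearMap.mem_ker] at hx
  have hb : ∀ k, k < i → ⟪b k, x⟫_ℂ = 0 := fun k hk => congrFun (congrArg Prod.fst hx) ⟨k, hk⟩
  have hc : ∀ k, j < k → ⟪c k, x⟫_ℂ = 0 := fun k hk =>
    congrFun (congrArg (fun p => p.2.1) hx) ⟨k, hk⟩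
  have hv : ∀ k, ⟪v k, x⟫_ℂ = 0 := fun k => congrFun (congrArg (fun p => p.2.2) hx) k
  have hle := h x hv
  rw [re_inner_apply_eq_sum b S s hS, re_inner_apply_eq_sum c T t hT] at hle
  have hsx : ∑ k, s k * ‖⟪b k, x⟫_ℂ‖ ^ 2 ≤ s i * ‖x‖ ^ 2 := by
    rw [← b.sum_sq_norm_inner_right x, mul_sum]
    refine sum_le_sum fun k _ => ?_
    rcases lt_or_ge k i with hk | hk
    · simp [hb k hk]
    · exact mul_le_mul_of_nonneg_right (hs hk) (by positivity)
  have htx : t j * ‖x‖ ^ 2 ≤ ∑ k, t k * ‖⟪c k, x⟫_ℂ‖ ^ 2 := by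
    rw [← c.sum_sq_norm_inner_right x, mul_sum]
    refine sum_le_sum fun k _ => ?_
    rcases lt_or_ge j k with hk | hk
    · simp [hc k hk]
    · exact mul_le_mul_of_nonneg_right (ht hk) (by positivity)
  exact le_of_mul_le_mul_right (htx.trans (hle.trans hsx)) (by positivity)

end Weyl

section Spectrum

open Matrix Polynomial

variable {M : ℕ}

theorem exists_perm_of_prod_X_sub_C_eq {ι : Type*} [Fintype ι] (a c : ι → ℝ)
    (h : ∏ i, (X - C (a i : ℂ)) = ∏ i, (X - C (c i : ℂ))) :
    ∃ σ : Equiv.Perm ι, ∀ i, a i = c (σ i) := by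
  classical
  have hroots : ∀ f : ι → ℝ, (∏ i, (X - C (f i : ℂ))).roots = (univ.val.map f).map (↑) := by
    intro f
    rw [← roots_multiset_prod_X_sub_C (Multiset.map _ (univ.val.map f))]
    simp only [Multiset.map_map]
    rfl
  have hmap : univ.val.map a = univ.val.map c := by
    rw [← Multiset.map_eq_map Complex.ofReal_injective, ← hroots, ← hroots, h]
  have hcard : ∀ r : ℝ, Fintype.card {i // a i = r} = Fintype.card {i // c i = r} := by
    intro r
    have := congrArg (Multiset.count r) hmap
    rw [Multiset.count_map, Multiset.count_map] at this
    simp only [Fintype.card_subtype, Finset.card_def, Finset.filter_val, eq_comm (b := r)]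
    exact this
  exact ⟨Equiv.ofFiberEquiv fun r => Fintype.equivOfCardEq (hcard r),
    fun i => (Equiv.ofFiberEquiv_map _ i).symm⟩

theorem isHermitian_vecMulVec_star (v : Fin M → ℂ) : (vecMulVec v (star v)).IsHermitian := by
  simp [IsHermitian, conjTranspose_vecMulVec]

theorem trace_vecMulVec_star (v : Fin M → ℂ) :
    (vecMulVec v (star v)).trace = ((∑ i, ‖v i‖ ^ 2 : ℝ) : ℂ) := by
  simp [trace_vecMulVec, dotProduct, Complex.mul_conj, Complex.normSq_eq_norm_sq]

theorem inner_toEuclideanLin_vecMulVec_star (v : Fin M → ℂ) (x : EuclideanSpace ℂ (Fin M)) :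
    inner ℂ x (toEuclideanLin (vecMulVec v (star v)) x) =
      ((‖inner ℂ (WithLp.toLp 2 v) x‖ ^ 2 : ℝ) : ℂ) := by
  have : toEuclideanLin (vecMulVec v (star v)) x =
      inner ℂ (WithLp.toLp 2 v) x • WithLp.toLp 2 v := by
    ext i
    simp [toLpLin_apply, vecMulVec_mulVec, EuclideanSpace.inner_eq_star_dotProduct, dotProduct_comm]
  rw [this, inner_smul_right, ← inner_conj_symm x, Complex.mul_conj, Complex.normSq_eq_norm_sq]

theorem eval_charpoly_diagonal_add_vecMulVec (d w : Fin M → ℝ) (x : ℝ) (hx : ∀ i, x ≠ d i) :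
    (diagonal (fun i => (d i : ℂ)) + vecMulVec (fun i => (w i : ℂ))
        (star fun i => (w i : ℂ))).charpoly.eval (x : ℂ) =
      ((∏ i, (x - d i) - ∑ i, w i ^ 2 * ∏ k ∈ univ.erase i, (x - d k) : ℝ) : ℂ) := by
  have hne : ∀ i, ((x : ℂ) - d i) ≠ 0 := fun i => by
    rw [← Complex.ofReal_sub, Complex.ofReal_ne_zero]
    exact sub_ne_zero.2 (hx i)
  have hdet : (diagonal fun i => ((x : ℂ) - d i)).det = ∏ i, ((x : ℂ) - d i) := det_diagonal
  have hunit : IsUnit (diagonal fun i => ((x : ℂ) - d i)).det := by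
    rw [hdet]
    exact (prod_ne_zero_iff.2 fun i _ => hne i).isUnit
  have hinv : (diagonal fun i => ((x : ℂ) - d i))⁻¹ = diagonal fun i => ((x : ℂ) - d i)⁻¹ := by
    refine inv_eq_left_inv ?_
    rw [diagonal_mul_diagonal, ← diagonal_one]
    congr 1
    funext i
    exact inv_mul_cancel₀ (hne i)
  have hmat : scalar (Fin M) (x : ℂ) - (diagonal (fun i => (d i : ℂ)) +
      vecMulVec (fun i => (w i : ℂ)) (star fun i => (w i : ℂ))) =
      (diagonal fun i => ((x : ℂ) - d i)) +
        replicateCol Unit (fun i => -(w i : ℂ)) * replicateRow Unit (fun i => (w i : ℂ)) := by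
    rw [← vecMulVec_eq]
    ext i j
    by_cases hij : i = j
    · subst hij
      simp [vecMulVec_apply]
      ring
    · simp [vecMulVec_apply, hij]
  rw [eval_charpoly, hmat, det_add_replicateCol_mul_replicateRow hunit, hinv, hdet, det_unique]
  rw [Matrix.add_apply, one_apply_eq, mul_apply]
  simp only [mul_diagonal, replicateRow_apply, replicateCol_apply]
  push_cast
  rw [mul_add, mul_one, mul_sum, sub_eq_add_neg, ← sum_neg_distrib]
  congr 1
  refine sum_congr rfl fun i _ => ?_
  rw [← mul_prod_erase univ _ (mem_univ i)]
  field_simp [hne i]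

theorem exists_weights_of_strictAnti (d l : Fin M → ℝ) (hd : StrictAnti d) (hdl : ∀ i, d i ≤ l i)
    (hld : ∀ i j, i < j → l j ≤ d i) :
    ∃ c : Fin M → ℝ, (∀ i, 0 ≤ c i) ∧ ∀ x : ℝ,
      ∏ i, (x - l i) = ∏ i, (x - d i) - ∑ i, c i * ∏ k ∈ univ.erase i, (x - d k) := by
  have hne : ∀ i, ∏ k ∈ univ.erase i, (d i - d k) ≠ 0 := fun i =>
    prod_ne_zero_iff.2 fun k hk => sub_ne_zero.2 fun h => (mem_erase.1 hk).1 (hd.injective h).symm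
  refine ⟨fun i => (l i - d i) * ∏ k ∈ univ.erase i, (d i - l k) / (d i - d k),
    fun i => mul_nonneg (sub_nonneg.2 (hdl i)) (prod_nonneg fun k hk => ?_), ?_⟩
  · rcases lt_or_gt_of_ne (mem_erase.1 hk).1 with hki | hik
    · exact div_nonneg_of_nonpos (sub_nonpos.2 ((hd hki).le.trans (hdl k)))
        (sub_nonpos.2 (hd hki).le)
    · exact div_nonneg (sub_nonneg.2 (hld i k hik)) (sub_nonneg.2 (hd hik).le)
  set c : Fin M → ℝ := fun i => (l i - d i) * ∏ k ∈ univ.erase i, (d i - l k) / (d i - d k) with hc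
  set P : ℝ[X] := ∏ i, (X - C (l i)) with hP
  set Q : ℝ[X] := ∏ i, (X - C (d i)) with hQ
  set R : ℝ[X] := ∑ i, C (c i) * ∏ k ∈ univ.erase i, (X - C (d k)) with hR
  have hdegP : P.degree = M := by simp [hP, degree_prod]
  have hdegQ : Q.degree = M := by simp [hQ, degree_prod]
  have hPQ : (P - Q).degree < M := by
    rw [← hdegP]
    refine degree_sub_lt_left (hdegP.trans hdegQ.symm) ?_ ?_
    · exact (monic_prod_of_monic _ _ fun i _ => monic_X_sub_C _).ne_zero
    · rw [(monic_prod_of_monic _ _ fun i _ => monic_X_sub_C (l i)).leadingCoeff,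
        (monic_prod_of_monic _ _ fun i _ => monic_X_sub_C (d i)).leadingCoeff]
  have hdegR : (-R).degree < M := by
    rw [degree_neg]
    refine (degree_sum_le _ _).trans_lt ((Finset.sup_lt_iff (WithBot.bot_lt_coe M)).2 fun i _ => ?_)
    refine (degree_mul_le _ _).trans_lt ((add_le_add_left degree_C_le _).trans_lt ?_)
    rw [zero_add, degree_prod]
    simp only [degree_X_sub_C, sum_const, card_erase_of_mem (mem_univ i), card_univ,
      Fintype.card_fin, nsmul_eq_mul, mul_one]
    have := i.pos
    exact WithBot.coe_lt_coe.2 (Nat.sub_lt this one_pos)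
  have hcard : ((univ.image d).card : WithBot ℕ) = M := by
    rw [card_image_of_injective _ hd.injective, card_univ, Fintype.card_fin]
  have key : P - Q = -R := by
    refine eq_of_degrees_lt_of_eval_finset_eq (univ.image d) (hcard ▸ hPQ) (hcard ▸ hdegR) ?_
    intro y hy
    obtain ⟨i, -, rfl⟩ := mem_image.1 hy
    have hQ0 : Q.eval (d i) = 0 := by
      rw [hQ, eval_prod]
      exact prod_eq_zero (mem_univ i) (by simp)
    have hRi : R.eval (d i) = c i * ∏ k ∈ univ.erase i, (d i - d k) := by
      rw [hR, eval_finsetSum, sum_eq_single i]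
      · simp [eval_prod]
      · intro j _ hji
        rw [eval_mul, eval_prod, prod_eq_zero (mem_erase.2 ⟨hji.symm, mem_univ i⟩) (by simp),
          mul_zero]
      · simp
    rw [eval_sub, hQ0, eval_neg, hRi, hP, eval_prod, ← mul_prod_erase univ _ (mem_univ i), hc]
    simp only [eval_sub, eval_X, eval_C, prod_div_distrib]
    field_simp [hne i]
    ring
  intro x
  have := congrArg (eval x) key
  simp only [hP, hQ, hR, eval_sub, eval_neg, eval_prod, eval_finsetSum, eval_mul, eval_X,
    eval_C] at this
  linarith

/-- If `l` and `d` interlace, then `∏ (x - l i)` is obtained from `∏ (x - d i)` by a nonnegative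
combination of the products omitting one factor. -/
theorem exists_weights_of_interlacing (d l : Fin M → ℝ) (hd : Antitone d) (hdl : ∀ i, d i ≤ l i)
    (hld : ∀ i j, i < j → l j ≤ d i) :
    ∃ c : Fin M → ℝ, (∀ i, 0 ≤ c i) ∧ ∀ x : ℝ,
      ∏ i, (x - l i) = ∏ i, (x - d i) - ∑ i, c i * ∏ k ∈ univ.erase i, (x - d k) := by
  let ε : ℕ → ℝ := fun n => 1 / ((n : ℝ) + 1)
  have hε : ∀ n, 0 < ε n := fun n => Nat.one_div_pos_of_nat
  have hε0 : Filter.Tendsto ε Filter.atTop (nhds 0) := tendsto_one_div_add_atTop_nhds_zero_nat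
  let D : ℕ → Fin M → ℝ := fun n i => d i - ε n * ((i : ℕ) + 1)
  let Λ : ℕ → Fin M → ℝ := fun n i => l i - ε n * (i : ℕ)
  have hD : ∀ i, Filter.Tendsto (fun n => D n i) Filter.atTop (nhds (d i)) := fun i => by
    simpa using (hε0.mul_const (((i : ℕ) : ℝ) + 1)).const_sub (d i)
  have hΛ : ∀ i, Filter.Tendsto (fun n => Λ n i) Filter.atTop (nhds (l i)) := fun i => by
    simpa using (hε0.mul_const ((i : ℕ) : ℝ)).const_sub (l i)
  have hex : ∀ n, ∃ c : Fin M → ℝ, (∀ i, 0 ≤ c i) ∧ ∀ x : ℝ,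
      ∏ i, (x - Λ n i) = ∏ i, (x - D n i) - ∑ i, c i * ∏ k ∈ univ.erase i, (x - D n k) := by
    intro n
    refine exists_weights_of_strictAnti (D n) (Λ n) ?_ ?_ ?_
    · intro i j hij
      have h1 := hd hij.le
      have h2 : ((i : ℕ) : ℝ) < (j : ℕ) := by exact_mod_cast hij
      have := mul_lt_mul_of_pos_left h2 (hε n)
      simp only [D]
      linarith
    · intro i
      have := hdl i
      have := hε n
      simp only [D, Λ]
      linarith
    · intro i j hij
      have h1 := hld i j hij
      have h2 : ((i : ℕ) : ℝ) + 1 ≤ (j : ℕ) := by exact_mod_cast hij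
      have := mul_le_mul_of_nonneg_left h2 (hε n).le
      simp only [D, Λ]
      linarith
  choose c hc0 hc using hex
  obtain ⟨b, hb⟩ : ∃ b, ∀ i, d i ≤ b := by
    obtain ⟨b, hb⟩ := (Set.finite_range d).bddAbove
    exact ⟨b, fun i => hb ⟨i, rfl⟩⟩
  have hDb : ∀ n i, 1 ≤ b + 1 - D n i := by
    intro n i
    have := hb i
    have : 0 ≤ ε n * (((i : ℕ) : ℝ) + 1) := mul_nonneg (hε n).le (by positivity)
    simp only [D]
    linarith
  have hprod : Filter.Tendsto (fun n => ∏ i, (b + 1 - D n i) - ∏ i, (b + 1 - Λ n i)) Filter.atTop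
      (nhds (∏ i, (b + 1 - d i) - ∏ i, (b + 1 - l i))) :=
    (tendsto_finsetProd _ fun i _ => (hD i).const_sub _).sub
      (tendsto_finsetProd _ fun i _ => (hΛ i).const_sub _)
  obtain ⟨K, hK⟩ := hprod.bddAbove_range
  have hcK : ∀ n, c n ∈ Set.Icc (0 : Fin M → ℝ) (fun _ => K) := by
    refine fun n => ⟨hc0 n, fun i => ?_⟩
    have hone : ∀ j, 1 ≤ ∏ k ∈ univ.erase j, (b + 1 - D n k) := fun j =>

      (prod_const_one (s := univ.erase j)).symm.trans_le
        (prod_le_prod (fun _ _ => zero_le_one) fun k _ => hDb n k)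
    calc c n i ≤ c n i * ∏ k ∈ univ.erase i, (b + 1 - D n k) :=
          le_mul_of_one_le_right (hc0 n i) (hone i)
      _ ≤ ∑ j, c n j * ∏ k ∈ univ.erase j, (b + 1 - D n k) :=
          single_le_sum (f := fun j => c n j * ∏ k ∈ univ.erase j, (b + 1 - D n k))
            (fun j _ => mul_nonneg (hc0 n j) (zero_le_one.trans (hone j))) (mem_univ i)
      _ = ∏ i, (b + 1 - D n i) - ∏ i, (b + 1 - Λ n i) := by rw [hc n]; ring
      _ ≤ K := hK ⟨n, rfl⟩
  obtain ⟨e, he, ψ, hψ, hlim⟩ := isCompact_Icc.tendsto_subseq hcK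
  refine ⟨e, he.1, fun x => ?_⟩
  have hsub := hψ.tendsto_atTop
  refine tendsto_nhds_unique (tendsto_finsetProd univ fun i _ =>
    ((hΛ i).comp hsub).const_sub x) ?_
  have hrhs := (tendsto_finsetProd univ fun i _ => ((hD i).comp hsub).const_sub x).sub
    (tendsto_finsetSum univ fun i _ => ((tendsto_pi_nhds.1 hlim i).mul
      (tendsto_finsetProd (univ.erase i) fun k _ => ((hD k).comp hsub).const_sub x)))
  refine hrhs.congr fun n => ?_
  exact (hc (ψ n) x).symm

/-- A Hermitian matrix with spectrum `d` has a rank-one positive perturbation with any prescribed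
spectrum `l` interlacing `d`. -/
theorem exists_charpoly_add_vecMulVec (B : Matrix (Fin M) (Fin M) ℂ) (hB : B.IsHermitian)
    (d l : Fin M → ℝ) (hBd : B.charpoly = ∏ i, (X - C (d i : ℂ)))
    (hd : Antitone d) (hdl : ∀ i, d i ≤ l i) (hld : ∀ i j, i < j → l j ≤ d i) :
    ∃ v : Fin M → ℂ, (B + vecMulVec v (star v)).charpoly = ∏ i, (X - C (l i : ℂ)) := by
  obtain ⟨c, hc0, hc⟩ := exists_weights_of_interlacing d l hd hdl hld
  obtain ⟨σ, hσ⟩ := exists_perm_of_prod_X_sub_C_eq hB.eigenvalues d (hB.charpoly_eq.symm.trans hBd)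
  let w : Fin M → ℝ := fun i => √(c (σ i))
  let u : Fin M → ℂ := fun i => (w i : ℂ)
  let U : Matrix (Fin M) (Fin M) ℂ := hB.eigenvectorUnitary
  have hU : star U * U = 1 := Unitary.coe_star_mul_self _
  have hUB : B = U * diagonal (fun i => (hB.eigenvalues i : ℂ)) * star U := by
    conv_lhs => rw [hB.spectral_theorem, Unitary.conjStarAlgAut_apply]
    rfl
  refine ⟨U *ᵥ u, ?_⟩
  have hadd : B + vecMulVec (U *ᵥ u) (star (U *ᵥ u)) =
      U * (diagonal (fun i => (hB.eigenvalues i : ℂ)) + vecMulVec u (star u)) * star U := by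
    rw [mul_add, add_mul, ← hUB, mul_vecMulVec, vecMulVec_mul, star_mulVec, star_eq_conjTranspose]
  rw [hadd, charpoly_mul_comm, ← mul_assoc, hU, one_mul]
  refine eq_of_infinite_eval_eq _ _ ?_
  have hinf : (Set.range hB.eigenvalues)ᶜ.Infinite := (Set.finite_range _).infinite_compl
  refine (hinf.image Complex.ofReal_injective.injOn).mono ?_
  rintro _ ⟨x, hx, rfl⟩
  have hx' : ∀ i, x ≠ hB.eigenvalues i := fun i h => hx ⟨i, h.symm⟩
  simp only [Set.mem_ofPred_eq, u]
  rw [eval_charpoly_diagonal_add_vecMulVec _ w x hx']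
  have hw : ∀ i, w i ^ 2 = c (σ i) := fun i => Real.sq_sqrt (hc0 _)
  have hprod : ∏ i, (x - hB.eigenvalues i) = ∏ i, (x - d i) := by
    simp only [hσ]
    exact Equiv.prod_comp σ fun i => x - d i
  have hsum : ∑ i, w i ^ 2 * ∏ k ∈ univ.erase i, (x - hB.eigenvalues k) =
      ∑ i, c i * ∏ k ∈ univ.erase i, (x - d k) := by
    rw [← Equiv.sum_comp σ fun i => c i * ∏ k ∈ univ.erase i, (x - d k)]
    refine sum_congr rfl fun i _ => ?_
    rw [hw]
    congr 1
    refine prod_equiv σ (by simp) fun k _ => by rw [hσ]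
  rw [hprod, hsum, ← hc x, eval_prod]
  simp

end Spectrum

section Combinatorics

/-- The sequence obtained from `l` by lowering each term as far towards `l (m + 1)` as is possible
while only removing levels at which `l` exceeds the sequence `a` at least `k + 1` times. -/
noncomputable def truncation (a l : ℕ → ℝ) (k m : ℕ) : ℝ :=
  if m < k then l m else min (l m) (max (l (m + 1)) (a (m - k)))

variable {a l : ℕ → ℝ}

theorem truncation_le (k m : ℕ) : truncation a l k m ≤ l m := by
  unfold truncation
  split_ifs
  · exact le_rfl
  · exact min_le_left _ _

theorem le_truncation (hl : Antitone l) (k m : ℕ) : l (m + 1) ≤ truncation a l k m := by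
  unfold truncation
  split_ifs
  · exact hl m.le_succ
  · exact le_min (hl m.le_succ) (le_max_left _ _)

theorem truncation_mono (ha : Antitone a) {k k' : ℕ} (h : k ≤ k') (m : ℕ) :
    truncation a l k m ≤ truncation a l k' m := by
  by_cases hm : m < k'
  · exact (truncation_le k m).trans_eq (by simp [truncation, hm])
  · have hm' : ¬ m < k := fun h' => hm (h'.trans_le h)
    simp only [truncation, hm, hm', if_false]
    exact min_le_min le_rfl (max_le_max le_rfl (ha (Nat.sub_le_sub_left h m)))

theorem exists_interlacing_of_majorization {M N : ℕ} {μ : ℕ → ℝ} (ha : Antitone a)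
    (hl : Antitone l) (hlM : ∀ i, M ≤ i → l i = 0)
    (hμ : ∀ n < N, μ (n + 1) ≤ μ n) (hμN : 0 ≤ μ N) (hal : ∀ i < M, a i ≤ l i)
    (htot : ∑ i ∈ range M, (l i - a i) = ∑ n ∈ range (N + 1), μ n)
    (hmaj : ∀ j, ∑ i ∈ range M, max (l (i + j) - a i) 0 ≤ ∑ n ∈ Ico j (N + 1), μ n) :
    ∃ b : ℕ → ℝ, Antitone b ∧ (∀ i, M ≤ i → b i = 0) ∧ (∀ i, b i ≤ l i) ∧
      (∀ i, l (i + 1) ≤ b i) ∧ (∀ i < M, a i ≤ b i) ∧ ∑ i ∈ range M, (l i - b i) = μ N ∧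
      ∀ j, ∑ i ∈ range M, max (b (i + j) - a i) 0 ≤ ∑ n ∈ Ico j N, μ n := by
  let D : ℕ → ℝ := fun k => ∑ m ∈ range M, (l m - truncation a l k m)
  have hμ0 : ∀ n ≤ N, μ N ≤ μ n := fun n hn => by
    induction hn using Nat.decreasingInduction with
    | self => exact le_rfl
    | of_succ n hn ih => exact ih.trans (hμ n hn)
  have hD0 : μ N ≤ D 0 := by
    have h1 : ∑ m ∈ range M, ((l m - a m) - max (l (m + 1) - a m) 0) ≤ D 0 := by
      refine sum_le_sum fun m _ => ?_
      have : truncation a l 0 m ≤ max (l (m + 1)) (a m) := min_le_right _ _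
      have : max (l (m + 1) - a m) 0 = max (l (m + 1)) (a m) - a m := by
        rw [← max_sub_sub_right, sub_self]
      linarith
    rw [sum_sub_distrib, htot] at h1
    have h2 := hmaj 1
    have h3 := sum_range_succ' μ N
    rw [sum_Ico_eq_sum_range] at h2
    simp only [add_tsub_cancel_right, add_comm 1] at h2
    have := hμ0 0 N.zero_le
    linarith
  have hDM : D M ≤ μ N := by
    refine (sum_nonpos fun m hm => ?_).trans hμN
    simp [truncation, mem_range.1 hm]
  obtain ⟨k, hk1, hk2⟩ : ∃ k, D (k + 1) ≤ μ N ∧ μ N ≤ D k := by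
    by_contra! hcon
    have : ∀ k, μ N ≤ D k := fun k => by
      induction k with
      | zero => exact hD0
      | succ k ih => exact le_of_not_gt fun h => (hcon k h.le).not_ge ih
    have h1 : D (M + 1) ≤ D M :=
      sum_le_sum fun m _ => sub_le_sub_left (truncation_mono ha M.le_succ m) _
    exact (hcon M (h1.trans hDM)).not_ge (this M)
  have hseg : μ N ∈ segment ℝ (D (k + 1)) (D k) := by
    rw [segment_eq_Icc (hk1.trans hk2)]
    exact ⟨hk1, hk2⟩
  obtain ⟨s, t, hs, ht, hst, hsum⟩ := hseg
  let b : ℕ → ℝ := fun m => s * truncation a l (k + 1) m + t * truncation a l k m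
  have hb1 : ∀ m, b m ≤ truncation a l (k + 1) m := fun m => by
    have := mul_le_mul_of_nonneg_left (truncation_mono (l := l) ha k.le_succ m) ht
    calc b m ≤ s * truncation a l (k + 1) m + t * truncation a l (k + 1) m := by
          simp only [b]; linarith
      _ = _ := by rw [← add_mul, hst, one_mul]
  have hb2 : ∀ m, truncation a l k m ≤ b m := fun m => by
    have := mul_le_mul_of_nonneg_left (truncation_mono (l := l) ha k.le_succ m) hs
    calc truncation a l k m = s * truncation a l k m + t * truncation a l k m := by
          rw [← add_mul, hst, one_mul]
      _ ≤ b m := by simp only [b]; linarith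
  have hbl : ∀ m, b m ≤ l m := fun m => (hb1 m).trans (truncation_le _ _)
  have hlb : ∀ m, l (m + 1) ≤ b m := fun m => (le_truncation hl k m).trans (hb2 m)
  have hbM : ∀ m, M ≤ m → b m = 0 := fun m hm =>
    le_antisymm ((hbl m).trans_eq (hlM m hm)) ((hlM (m + 1) (by omega)).symm.trans_le (hlb m))
  have hbsum : ∑ i ∈ range M, (l i - b i) = μ N := by
    rw [← hsum]
    simp only [D, b, smul_eq_mul, mul_sum, ← sum_add_distrib]
    refine sum_congr rfl fun m _ => ?_
    linear_combination (l m) * hst.symm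
  have hlow : ∀ m, m < k → b m = l m := fun m hm =>
    le_antisymm (hbl m) (le_trans (by simp [truncation, hm]) (hb2 m))
  refine ⟨b, antitone_nat_of_succ_le fun m => (hbl _).trans (hlb m), hbM, hbl, hlb, ?_, hbsum, ?_⟩
  · intro i hi
    refine le_trans ?_ ((truncation_mono ha k.zero_le i).trans (hb2 i))
    exact le_min (hal i hi) (le_max_right _ _)
  intro j
  rcases le_or_gt j k with hjk | hjk
  · rcases le_or_gt j N with hjN | hjN
    · have hterm : ∀ i, max (b (i + j) - a i) 0 =
          max (l (i + j) - a i) 0 - (l (i + j) - b (i + j)) := by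
        intro i
        rcases (hbl (i + j)).lt_or_eq with hlt | heq
        · have hge : a i ≤ b (i + j) := by
            have hkij : ¬ i + j < k := fun h => hlt.ne (hlow _ h)
            have h1 : min (l (i + j)) (a (i + j - k)) ≤ truncation a l k (i + j) := by
              simp only [truncation, hkij, if_false]
              exact min_le_min le_rfl (le_max_right _ _)
            rcases min_le_iff.1 (h1.trans (hb2 _)) with h2 | h2
            · exact absurd hlt h2.not_gt
            · exact (ha (by omega)).trans h2
          rw [max_eq_left (sub_nonneg.2 hge), max_eq_left (sub_nonneg.2 (hge.trans hlt.le))]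
          ring
        · rw [heq, sub_self, sub_zero]
      have hshift : ∑ i ∈ range M, (l (i + j) - b (i + j)) = μ N := by
        rw [← hbsum, range_eq_Ico, sum_Ico_add' (fun m => l m - b m), zero_add]
        have h1 := sum_Ico_consecutive (fun m => l m - b m) j.zero_le (Nat.le_add_left j M)
        have h2 := sum_Ico_consecutive (fun m => l m - b m) M.zero_le (Nat.le_add_right M j)
        have h3 : ∑ m ∈ Ico 0 j, (l m - b m) = 0 := sum_eq_zero fun m hm => by
          rw [hlow m (by have := mem_Ico.1 hm; omega), sub_self]
        have h4 : ∑ m ∈ Ico M (M + j), (l m - b m) = 0 := sum_eq_zero fun m hm => by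
          rw [hlM m (mem_Ico.1 hm).1, hbM m (mem_Ico.1 hm).1, sub_self]
        linarith
      simp only [hterm]
      rw [sum_sub_distrib, hshift]
      have := hmaj j
      rw [sum_Ico_succ_top hjN] at this
      linarith
    · have h1 := hmaj j
      rw [Ico_eq_empty (by omega), sum_empty] at h1
      rw [Ico_eq_empty (by omega), sum_empty]
      refine le_trans (sum_le_sum fun i _ => ?_) h1
      exact max_le_max (sub_le_sub_right (hbl _) _) le_rfl
  · calc ∑ i ∈ range M, max (b (i + j) - a i) 0
        ≤ ∑ i ∈ range M, max (l (i + (j + 1)) - a i) 0 := by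
          refine sum_le_sum fun i _ => max_le ?_ (le_max_right _ _)
          have h1 : b (i + j) ≤ max (l (i + j + 1)) (a i) := by
            refine (hb1 _).trans ((truncation_mono ha hjk _).trans ?_)
            simp only [truncation, add_lt_iff_neg_right, not_lt_zero, if_false,
              Nat.add_sub_cancel]
            exact min_le_right _ _
          rw [← add_assoc, ← sub_self (a i), max_sub_sub_right]
          exact sub_le_sub_right h1 _
      _ ≤ ∑ n ∈ Ico (j + 1) (N + 1), μ n := hmaj (j + 1)
      _ = ∑ n ∈ Ico j N, μ (n + 1) := (sum_Ico_add' μ j N 1).symm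
      _ ≤ ∑ n ∈ Ico j N, μ n := sum_le_sum fun n hn => hμ n (mem_Ico.1 hn).2

end Combinatorics

section Completion

open Matrix Polynomial

variable {M : ℕ}

theorem trace_eq_sum_of_charpoly_eq (A : Matrix (Fin M) (Fin M) ℂ) (a : Fin M → ℝ)
    (h : A.charpoly = ∏ i, (X - C (a i : ℂ))) : A.trace = ((∑ i, a i : ℝ) : ℂ) := by
  have hm : (∏ i, (X - C (a i : ℂ))) =
      ((univ.val.map fun i => (a i : ℂ)).map fun r => X - C r).prod := by
    rw [Multiset.map_map]
    rfl
  rw [trace_eq_sum_roots_charpoly, h, hm, roots_multiset_prod_X_sub_C, Complex.ofReal_sum]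
  rfl

theorem isHermitian_sum_vecMulVec_star {ι : Type*} (s : Finset ι) (φ : ι → Fin M → ℂ) :
    (∑ n ∈ s, vecMulVec (φ n) (star (φ n))).IsHermitian := by
  classical
  induction s using Finset.induction_on with
  | empty => simp
  | insert n s hn ih =>
    rw [sum_insert hn]
    exact (isHermitian_vecMulVec_star _).add ih

theorem exists_vectors_of_majorization {a : ℕ → ℝ} (ha : Antitone a)
    {μ : ℕ → ℝ} (N : ℕ) (hμ : ∀ n, n + 1 < N → μ (n + 1) ≤ μ n) (hμ0 : ∀ n < N, 0 ≤ μ n)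
    (l : ℕ → ℝ) (hl : Antitone l) (hlM : ∀ i, M ≤ i → l i = 0) (hal : ∀ i < M, a i ≤ l i)
    (htot : ∑ i ∈ range M, (l i - a i) = ∑ n ∈ range N, μ n)
    (hmaj : ∀ j, ∑ i ∈ range M, max (l (i + j) - a i) 0 ≤ ∑ n ∈ Ico j N, μ n) :
    ∃ φ : Fin N → Fin M → ℂ, (∀ n, ∑ i, ‖φ n i‖ ^ 2 = μ n) ∧
      (diagonal (fun i : Fin M => (a i : ℂ)) +
        ∑ n, vecMulVec (φ n) (star (φ n))).charpoly = ∏ i : Fin M, (X - C (l i : ℂ)) := by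
  induction N generalizing l with
  | zero =>
    refine ⟨Fin.elim0, fun n => n.elim0, ?_⟩
    have hz : ∀ i ∈ range M, l i - a i = 0 :=
      (sum_eq_zero_iff_of_nonneg fun i hi => sub_nonneg.2 (hal i (mem_range.1 hi))).1
        (by simpa using htot)
    simp only [univ_eq_empty, sum_empty, add_zero, charpoly_diagonal]
    refine prod_congr rfl fun i _ => ?_
    rw [sub_eq_zero.1 (hz i (mem_range.2 i.2))]
  | succ N ih =>
    obtain ⟨b, hb, hbM, hbl, hlb, hab, hbsum, hbmaj⟩ :=
      exists_interlacing_of_majorization ha hl hlM (fun n hn => hμ n (by omega))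
        (hμ0 N N.lt_succ_self) hal htot hmaj
    have hbtot : ∑ i ∈ range M, (b i - a i) = ∑ n ∈ range N, μ n := by
      rw [sum_range_succ, ← hbsum] at htot
      have : ∑ i ∈ range M, (l i - a i) =
          ∑ i ∈ range M, (b i - a i) + ∑ i ∈ range M, (l i - b i) := by
        rw [← sum_add_distrib]
        exact sum_congr rfl fun i _ => by ring
      linarith
    obtain ⟨φ, hφ, hchar⟩ := ih (fun n hn => hμ n (by omega)) (fun n hn => hμ0 n (by omega))
      b hb hbM hab hbtot hbmaj
    set B := diagonal (fun i : Fin M => (a i : ℂ)) + ∑ n, vecMulVec (φ n) (star (φ n)) with hBdef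
    have hB : B.IsHermitian := by
      refine IsHermitian.add ?_ (isHermitian_sum_vecMulVec_star _ _)
      rw [isHermitian_diagonal_iff]
      exact fun i => Complex.conj_ofReal _
    obtain ⟨v, hv⟩ := exists_charpoly_add_vecMulVec B hB (fun i => b i) (fun i => l i) hchar
      (fun i j hij => hb hij) (fun i => hbl i) (fun i j hij => (hl hij).trans (hlb i))
    have hnorm : ∑ i, ‖v i‖ ^ 2 = μ N := by
      have h1 := trace_eq_sum_of_charpoly_eq _ _ hv
      rw [trace_add, trace_eq_sum_of_charpoly_eq _ _ hchar, trace_vecMulVec_star,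
        ← Complex.ofReal_add, Complex.ofReal_inj] at h1
      rw [← hbsum, sum_sub_distrib, ← Fin.sum_univ_eq_sum_range, ← Fin.sum_univ_eq_sum_range]
      linarith
    refine ⟨Fin.snoc φ v, fun n => ?_, ?_⟩
    · refine Fin.lastCases ?_ (fun n => ?_) n
      · simpa using hnorm
      · simpa using hφ n
    · rw [Fin.sum_univ_castSucc]
      simp only [Fin.snoc_castSucc, Fin.snoc_last]
      rw [← add_assoc, ← hBdef]
      exact hv

theorem exists_eigenbasis {A : Matrix (Fin M) (Fin M) ℂ} (hA : A.IsHermitian) (a : Fin M → ℝ)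
    (σ : Equiv.Perm (Fin M)) (h : ∀ i, hA.eigenvalues i = a (σ i)) :
    ∃ b : OrthonormalBasis (Fin M) ℂ (EuclideanSpace ℂ (Fin M)),
      ∀ i, toEuclideanLin A (b i) = (a i : ℂ) • b i := by
  refine ⟨hA.eigenvectorBasis.reindex σ, fun i => ?_⟩
  have h1 := hA.mulVec_eigenvectorBasis (σ.symm i)
  rw [h, σ.apply_symm_apply] at h1
  rw [OrthonormalBasis.reindex_apply, toLpLin_apply, h1]
  rfl

theorem exists_antitone_eigenvalues {A : Matrix (Fin M) (Fin M) ℂ} (hA : A.IsHermitian) :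
    ∃ (a : Fin M → ℝ) (σ : Equiv.Perm (Fin M)), Antitone a ∧ ∀ i, hA.eigenvalues i = a (σ i) := by
  let τ := Tuple.sort fun i => -hA.eigenvalues i
  refine ⟨hA.eigenvalues ∘ τ, τ.symm, fun i j hij => ?_, fun i => by simp⟩
  exact neg_le_neg_iff.1 (Tuple.monotone_sort (fun i => -hA.eigenvalues i) hij)

theorem trace_eq_sum_of_eigenvalues {A : Matrix (Fin M) (Fin M) ℂ} (hA : A.IsHermitian)
    (a : Fin M → ℝ) (σ : Equiv.Perm (Fin M)) (h : ∀ i, hA.eigenvalues i = a (σ i)) :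
    A.trace = ((∑ i, a i : ℝ) : ℂ) := by
  rw [hA.trace_eq_sum_eigenvalues, ← Equiv.sum_comp σ a, Complex.ofReal_sum]
  simp only [h]
  rfl

theorem re_inner_add_sum_vecMulVec {ι : Type*} (s : Finset ι) (A : Matrix (Fin M) (Fin M) ℂ)
    (φ : ι → Fin M → ℂ) (x : EuclideanSpace ℂ (Fin M)) :
    (inner ℂ x (toEuclideanLin (A + ∑ n ∈ s, vecMulVec (φ n) (star (φ n))) x)).re =
      (inner ℂ x (toEuclideanLin A x)).re + ∑ n ∈ s, ‖inner ℂ (WithLp.toLp 2 (φ n)) x‖ ^ 2 := by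
  rw [map_add, map_sum, LinearMap.add_apply, LinearMap.sum_apply, inner_add_right, inner_sum,
    Complex.add_re, Complex.re_sum]
  simp only [inner_toEuclideanLin_vecMulVec_star, Complex.ofReal_re]

theorem eigenvalue_le_of_add_sum_vecMulVec {ι : Type*} (s : Finset ι)
    {A B : Matrix (Fin M) (Fin M) ℂ} (hA : A.IsHermitian) (hB : B.IsHermitian)
    (φ : ι → Fin M → ℂ) (hAB : B = A + ∑ n ∈ s, vecMulVec (φ n) (star (φ n)))
    (a c : Fin M → ℝ) (ha : Antitone a) (hc : Antitone c) (σ τ : Equiv.Perm (Fin M))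
    (hσ : ∀ i, hA.eigenvalues i = a (σ i)) (hτ : ∀ i, hB.eigenvalues i = c (τ i)) :
    (∀ i, a i ≤ c i) ∧ ∀ i j : Fin M, (i : ℕ) + #s ≤ j → c j ≤ a i := by
  obtain ⟨e, he⟩ := exists_eigenbasis hA a σ hσ
  obtain ⟨f, hf⟩ := exists_eigenbasis hB c τ hτ
  constructor
  · intro i
    refine eigenvalue_le_of_re_inner_le _ _ f e c a hc ha hf he (κ := Empty) Empty.elim ?_ i i
      (by simp)
    intro x _
    rw [hAB, re_inner_add_sum_vecMulVec]
    exact le_add_of_nonneg_right (sum_nonneg fun n _ => by positivity)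
  · intro i j hij
    refine eigenvalue_le_of_re_inner_le _ _ e f a c ha hc he hf
      (fun n : s => WithLp.toLp 2 (φ n)) ?_ i j (by simpa using hij)
    intro x hx
    rw [hAB, re_inner_add_sum_vecMulVec, sum_eq_zero fun n hn => ?_, add_zero]
    rw [hx ⟨n, hn⟩, norm_zero, zero_pow two_ne_zero]

theorem trace_add_sum_vecMulVec {ι : Type*} (s : Finset ι) (A : Matrix (Fin M) (Fin M) ℂ)
    (φ : ι → Fin M → ℂ) :
    (A + ∑ n ∈ s, vecMulVec (φ n) (star (φ n))).trace =
      A.trace + ((∑ n ∈ s, ∑ i, ‖φ n i‖ ^ 2 : ℝ) : ℂ) := by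
  rw [trace_add, trace_sum, Complex.ofReal_sum]
  simp only [trace_vecMulVec_star]

theorem sum_max_le_of_add_sum_vecMulVec {N : ℕ} {A B : Matrix (Fin M) (Fin M) ℂ}
    (hA : A.IsHermitian) (hB : B.IsHermitian) (φ : Fin N → Fin M → ℂ)
    (hAB : B = A + ∑ n, vecMulVec (φ n) (star (φ n))) (a l : ℕ → ℝ) (ha : Antitone a)
    (ha0 : ∀ i, 0 ≤ a i) (hl : Antitone l) (hlM : ∀ i, M ≤ i → l i = 0)
    (σ τ : Equiv.Perm (Fin M)) (hσ : ∀ i, hA.eigenvalues i = a (σ i))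
    (hτ : ∀ i, hB.eigenvalues i = l (τ i)) (j : ℕ) :
    ∑ i ∈ range M, max (l (i + j) - a i) 0 ≤
      ∑ n ∈ univ.filter (fun n : Fin N => j ≤ (n : ℕ)), ∑ i, ‖φ n i‖ ^ 2 := by
  let s : Finset (Fin N) := {n | ¬ j ≤ (n : ℕ)}
  let t : Finset (Fin N) := {n | j ≤ (n : ℕ)}
  set A' := A + ∑ n ∈ s, vecMulVec (φ n) (star (φ n)) with hA'def
  have hBA' : B = A' + ∑ n ∈ t, vecMulVec (φ n) (star (φ n)) := by
    rw [hAB, hA'def, add_assoc, add_comm (∑ n ∈ s, _), sum_filter_add_sum_filter_not]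
  have hA' : A'.IsHermitian := hA.add (isHermitian_sum_vecMulVec_star _ _)
  have hs : #s ≤ j := by
    have : #(s.image Fin.val) ≤ #(range j) := card_le_card fun n hn => by
      obtain ⟨m, hm, rfl⟩ := mem_image.1 hn
      simpa [s] using hm
    rwa [card_image_of_injective _ Fin.val_injective, card_range] at this
  obtain ⟨p, ρ, hp, hρ⟩ := exists_antitone_eigenvalues hA'
  have haF : Antitone fun i : Fin M => a i := fun i k h => ha h
  have hlF : Antitone fun i : Fin M => l i := fun i k h => hl h
  have hpa := (eigenvalue_le_of_add_sum_vecMulVec s hA hA' φ hA'def _ p haF hp σ ρ hσ hρ).2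
  have hpl := (eigenvalue_le_of_add_sum_vecMulVec t hA' hB φ hBA' p _ hp hlF ρ τ hρ hτ).1
  let g : ℕ → ℝ := fun m => if h : m < M then l m - p ⟨m, h⟩ else 0
  have hg0 : ∀ m, 0 ≤ g m := fun m => by
    simp only [g]
    split_ifs with h
    · exact sub_nonneg.2 (hpl ⟨m, h⟩)
    · exact le_rfl
  have hterm : ∀ i, max (l (i + j) - a i) 0 ≤ g (i + j) := fun i => by
    refine max_le ?_ (hg0 _)
    simp only [g]
    split_ifs with h
    · exact sub_le_sub_left (hpa ⟨i, by omega⟩ ⟨i + j, h⟩ (by simpa using hs)) _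
    · rw [hlM _ (not_lt.1 h)]
      simpa using ha0 i
  have hgsum : ∑ m ∈ range M, g m = ∑ n ∈ t, ∑ i, ‖φ n i‖ ^ 2 := by
    have h1 := trace_eq_sum_of_eigenvalues hB (fun i => l i) τ hτ
    rw [hBA', trace_add_sum_vecMulVec, trace_eq_sum_of_eigenvalues hA' p ρ hρ,
      ← Complex.ofReal_add, Complex.ofReal_inj] at h1
    rw [← Fin.sum_univ_eq_sum_range]
    simp only [g, Fin.is_lt, dite_true, Fin.eta, sum_sub_distrib]
    linarith
  calc ∑ i ∈ range M, max (l (i + j) - a i) 0 ≤ ∑ i ∈ range M, g (i + j) :=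
        sum_le_sum fun i _ => hterm i
    _ = ∑ m ∈ Ico j (M + j), g m := by
        rw [range_eq_Ico, sum_Ico_add' g, zero_add]
    _ ≤ ∑ m ∈ range (M + j), g m :=
        sum_le_sum_of_subset_of_nonneg (fun m hm => mem_range.2 (mem_Ico.1 hm).2) fun m _ _ => hg0 m
    _ = ∑ m ∈ range M, g m := by
        rw [sum_range_add, add_eq_left]
        exact sum_eq_zero fun m _ => dif_neg (by omega)
    _ = ∑ n ∈ t, ∑ i, ‖φ n i‖ ^ 2 := hgsum

end Completion

section ZeroExtend

/-- The finite sequence `α 1, …, α M`, indexed from `0` and extended by zero. -/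
noncomputable def zeroExtend (M : ℕ) (α : ℕ → ℝ) (i : ℕ) : ℝ :=
  if i < M then α (i + 1) else 0

variable {M : ℕ} {α : ℕ → ℝ}

theorem zeroExtend_of_lt (α : ℕ → ℝ) {i : ℕ} (hi : i < M) : zeroExtend M α i = α (i + 1) :=
  if_pos hi

theorem zeroExtend_of_le (α : ℕ → ℝ) {i : ℕ} (hi : M ≤ i) : zeroExtend M α i = 0 :=
  if_neg hi.not_gt

theorem zeroExtend_nonneg (hα : NonnegNonincrOn M α) (i : ℕ) : 0 ≤ zeroExtend M α i := by
  rcases Nat.lt_or_ge i M with hi | hi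
  · rw [zeroExtend_of_lt α hi]
    exact hα.1 (i + 1) (by omega) hi
  · rw [zeroExtend_of_le α hi]

theorem zeroExtend_antitone (hα : NonnegNonincrOn M α) : Antitone (zeroExtend M α) := by
  refine antitone_nat_of_succ_le fun i => ?_
  rcases Nat.lt_or_ge (i + 1) M with hi | hi
  · rw [zeroExtend_of_lt α hi, zeroExtend_of_lt α (i.lt_succ_self.trans hi)]
    exact hα.2 (i + 1) (by omega) hi
  · rw [zeroExtend_of_le α hi]
    exact zeroExtend_nonneg hα i

theorem sum_Icc_succ_eq_sum_Ico (f : ℕ → ℝ) (j N : ℕ) :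
    ∑ n ∈ Icc (j + 1) N, f n = ∑ n ∈ Ico j N, f (n + 1) := by
  rw [sum_Ico_add' f]
  rfl

theorem sum_Icc_max_eq_sum_range (hα : NonnegNonincrOn M α) (lam : ℕ → ℝ) (j : ℕ) :
    ∑ m ∈ Icc (j + 1) M, max (lam m - α (m - (j + 1) + 1)) 0 =
      ∑ i ∈ range M, max (zeroExtend M lam (i + j) - zeroExtend M α i) 0 := by
  rw [sum_Icc_succ_eq_sum_Ico, sum_Ico_eq_sum_range]
  refine Eq.trans (sum_congr rfl fun i hi => ?_)
    (sum_subset (range_subset_range.2 (Nat.sub_le M j)) fun i _ hi => ?_)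
  · have hi' := mem_range.1 hi
    rw [zeroExtend_of_lt lam (by omega), zeroExtend_of_lt α (by omega), add_comm j i,
      Nat.add_sub_add_right, Nat.add_sub_cancel]
  · have hi' := mt mem_range.2 hi
    rw [zeroExtend_of_le lam (by omega)]
    simpa using zeroExtend_nonneg hα i

end ZeroExtend

/-- A generalized Schur-Horn theorem characterizing all `(α,μ)`-completions. -/
theorem completion_iff (M N : ℕ) (α μ lam : ℕ → ℝ)
    (hα : NonnegNonincrOn M α) (hμ : NonnegNonincrOn N μ)
    (hlam : NonnegNonincrOn M lam) :
    IsCompletion M N α μ lam ↔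
      ((∀ m, 1 ≤ m → m ≤ M → α m ≤ lam m) ∧
        (∑ m ∈ Icc 1 M, (lam m - α m) = ∑ n ∈ Icc 1 N, μ n) ∧
        ∀ j, 1 ≤ j → j ≤ M →
          ∑ m ∈ Icc j M, max (lam m - α (m - j + 1)) 0 ≤ ∑ n ∈ Icc j N, μ n) := by
  set a := zeroExtend M α with ha_def
  set l := zeroExtend M lam with hl_def
  have ha := zeroExtend_antitone hα
  have hl := zeroExtend_antitone hlam
  have ha0 := zeroExtend_nonneg hα
  have hlM : ∀ i, M ≤ i → l i = 0 := fun i hi => zeroExtend_of_le lam hi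
  have hmaj_iff : (∀ j, 1 ≤ j → j ≤ M →
      ∑ m ∈ Icc j M, max (lam m - α (m - j + 1)) 0 ≤ ∑ n ∈ Icc j N, μ n) ↔
      ∀ j, ∑ i ∈ range M, max (l (i + j) - a i) 0 ≤ ∑ n ∈ Ico j N, μ (n + 1) := by
    simp only [← sum_Icc_succ_eq_sum_Ico]
    constructor
    · intro h j
      rcases Nat.lt_or_ge j M with hj | hj
      · rw [← sum_Icc_max_eq_sum_range hα]
        exact h (j + 1) (by omega) hj
      · rw [sum_eq_zero fun i _ => ?_]
        · exact sum_nonneg fun n hn => hμ.1 n (by have := mem_Icc.1 hn; omega) (mem_Icc.1 hn).2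
        · rw [hlM _ (by omega)]
          simpa using ha0 i
    · intro h j hj _
      obtain ⟨j, rfl⟩ := Nat.exists_eq_add_of_le' hj
      rw [sum_Icc_max_eq_sum_range hα]
      exact h j
  have htot_iff : (∑ m ∈ Icc 1 M, (lam m - α m) = ∑ n ∈ Icc 1 N, μ n) ↔
      ∑ i ∈ range M, (l i - a i) = ∑ n ∈ range N, μ (n + 1) := by
    rw [← zero_add 1, sum_Icc_succ_eq_sum_Ico, sum_Icc_succ_eq_sum_Ico, ← range_eq_Ico,
      ← range_eq_Ico, sum_congr rfl fun i hi => ?_]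
    rw [ha_def, hl_def, zeroExtend_of_lt _ (mem_range.1 hi), zeroExtend_of_lt _ (mem_range.1 hi)]
  have hle_iff : (∀ m, 1 ≤ m → m ≤ M → α m ≤ lam m) ↔ ∀ i < M, a i ≤ l i := by
    constructor
    · intro h i hi
      rw [ha_def, hl_def, zeroExtend_of_lt _ hi, zeroExtend_of_lt _ hi]
      exact h (i + 1) (by omega) hi
    · intro h m hm hmM
      obtain ⟨m, rfl⟩ := Nat.exists_eq_add_of_le' hm
      have := h m hmM
      rwa [ha_def, hl_def, zeroExtend_of_lt _ hmM, zeroExtend_of_lt _ hmM] at this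
  rw [hmaj_iff, htot_iff, hle_iff]
  have hαa : ∀ i : Fin M, α ((i : ℕ) + 1) = a i := fun i => (zeroExtend_of_lt α i.2).symm
  have hlaml : ∀ i : Fin M, lam ((i : ℕ) + 1) = l i := fun i => (zeroExtend_of_lt lam i.2).symm
  simp only [IsCompletion, hαa, hlaml]
  constructor
  · rintro ⟨-, A, hA, φ, hB, σ, τ, hσ, hφ, hτ⟩
    have hle := (eigenvalue_le_of_add_sum_vecMulVec univ hA hB φ rfl (fun i => a i)
      (fun i => l i) (fun i k h => ha h) (fun i k h => hl h) σ τ hσ hτ).1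
    refine ⟨fun i hi => hle ⟨i, hi⟩, ?_, fun j => ?_⟩
    · have h1 := trace_eq_sum_of_eigenvalues hB (fun i => l i) τ hτ
      rw [trace_add_sum_vecMulVec, trace_eq_sum_of_eigenvalues hA (fun i => a i) σ hσ,
        ← Complex.ofReal_add, Complex.ofReal_inj] at h1
      simp only [hφ] at h1
      rw [sum_sub_distrib, ← Fin.sum_univ_eq_sum_range, ← Fin.sum_univ_eq_sum_range,
        ← Fin.sum_univ_eq_sum_range fun n => μ (n + 1)]
      linarith
    · refine (sum_max_le_of_add_sum_vecMulVec hA hB φ rfl a l ha ha0 hl hlM σ τ hσ hτ j).trans_eq ?_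
      simp only [hφ]
      rw [sum_filter, Fin.sum_univ_eq_sum_range (fun n => if j ≤ n then μ (n + 1) else 0),
        ← sum_filter]
      refine sum_congr ?_ fun _ _ => rfl
      ext n
      simp [and_comm]
  · rintro ⟨hle, htot, hmaj⟩
    obtain ⟨φ, hφ, hchar⟩ := exists_vectors_of_majorization ha N
      (fun n hn => hμ.2 (n + 1) (by omega) hn) (fun n hn => hμ.1 (n + 1) (by omega) hn)
      l hl hlM hle htot hmaj
    have hA : (Matrix.diagonal fun i : Fin M => (a i : ℂ)).IsHermitian := by
      rw [Matrix.isHermitian_diagonal_iff]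
      exact fun i => Complex.conj_ofReal _
    have hB := hA.add (isHermitian_sum_vecMulVec_star univ φ)
    obtain ⟨σ, hσ⟩ := exists_perm_of_prod_X_sub_C_eq hA.eigenvalues (fun i => a i)
      (hA.charpoly_eq.symm.trans (Matrix.charpoly_diagonal _))
    obtain ⟨τ, hτ⟩ := exists_perm_of_prod_X_sub_C_eq hB.eigenvalues (fun i => l i)
      (hB.charpoly_eq.symm.trans hchar)
    exact ⟨hlam, _, hA, φ, hB, σ, τ, hσ, hφ, hτ⟩
end

section
/- Let α = (α_1,…,α_M), λ = (λ_1,…,λ_M) and μ = (μ_1,…,μ_N) be nonnegative nonincreasing sequences of real numbers satisfying Σ_{m=1}^{M} (λ_m − α_m) = Σ_{n=1}^{N} μ_n and Σ_{m=j}^{M} (λ_m − α_{m−j+1})^+ ≤ Σ_{n=j}^{N} μ_n for all j = 1,…,M (empty sums are 0). Then λ_m ≥ α_m for all m = 1,…,M. -/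
open Finset

/-- If nonnegative nonincreasing sequences `α`, `lam`, `μ` satisfy the generalized
Schur-Horn conditions, then `lam m ≥ α m` for all `m = 1, …, M`. -/
theorem ge_of_schurHorn_conditions (M N : ℕ) (α lam μ : ℕ → ℝ)
    (hα : NonnegNonincrOn M α) (hlam : NonnegNonincrOn M lam)
    (hμ : NonnegNonincrOn N μ)
    (heq : ∑ m ∈ Icc 1 M, (lam m - α m) = ∑ n ∈ Icc 1 N, μ n)
    (hineq : ∀ j, 1 ≤ j → j ≤ M →
      ∑ m ∈ Icc j M, max (lam m - α (m - j + 1)) 0 ≤ ∑ n ∈ Icc j N, μ n) :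
    ∀ m, 1 ≤ m → m ≤ M → α m ≤ lam m := by
  intro m hm hmM
  have hsum : ∑ k ∈ Icc 1 M, max (lam k - α k) 0 ≤ ∑ k ∈ Icc 1 M, (lam k - α k) := by
    rw [heq]
    refine le_trans (le_of_eq (sum_congr rfl fun k hk => ?_)) (hineq 1 le_rfl (hm.trans hmM))
    rw [Nat.sub_add_cancel (mem_Icc.mp hk).1]
  by_contra! h
  exact hsum.not_gt <| sum_lt_sum (fun k _ => le_max_left _ _)
    ⟨m, mem_Icc.mpr ⟨hm, hmM⟩, lt_max_of_lt_right (sub_neg.mpr h)⟩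
end

section
/- Let M ≤ N be positive integers and let λ = (λ_1,…,λ_M) and μ = (μ_1,…,μ_N) be nonnegative nonincreasing sequences of real numbers. There exist vectors φ_1,…,φ_N ∈ ℂ^M with ‖φ_n‖² = μ_n for all n = 1,…,N such that the multiset of eigenvalues (with multiplicity) of the frame operator Σ_{n=1}^{N} φ_n φ_n* is {λ_1,…,λ_M} if and only if Σ_{n=1}^{N} μ_n = Σ_{m=1}^{M} λ_m and Σ_{n=1}^{j} μ_n ≤ Σ_{m=1}^{j} λ_m for all j = 1,…,M. -/
open Finset

/-- Partial sums after replacing the entries `a k, a (k + 1)` by the single entry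
`a k + a (k + 1) - x`. -/
lemma sum_range_merge (a : ℕ → ℝ) (x : ℝ) (k j : ℕ) :
    ∑ i ∈ range j, (if i < k then a i else if i = k then a k + a (k + 1) - x else a (i + 1)) =
      if j ≤ k then ∑ i ∈ range j, a i else ∑ i ∈ range (j + 1), a i - x := by
  induction j with
  | zero => simp
  | succ j ih =>
    rw [sum_range_succ, ih]
    rcases lt_trichotomy j k with h | h | h
    · rw [if_pos h.le, if_pos h, if_pos (by omega), sum_range_succ]
    · subst h
      simp [sum_range_succ]
      ring
    · rw [if_neg (by omega), if_neg (by omega), if_neg (by omega), if_neg (by omega),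
        sum_range_succ _ (j + 1)]
      ring

lemma exists_sq_add_sq_eq_one_and_combo {p q x : ℝ} (hp : x ≤ p) (hq : q ≤ x) :
    ∃ c s : ℝ, c ^ 2 + s ^ 2 = 1 ∧ c ^ 2 * p + s ^ 2 * q = x := by
  obtain ⟨t, r, ht, hr, hs, h⟩ : x ∈ segment ℝ p q := by
    rw [segment_symm, segment_eq_Icc (hq.trans hp)]; exact ⟨hq, hp⟩
  exact ⟨√t, √r, by rw [Real.sq_sqrt ht, Real.sq_sqrt hr, hs],
    by rw [Real.sq_sqrt ht, Real.sq_sqrt hr]; simpa using h⟩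

/-- If `f` is `B`-orthonormal and `C`-orthogonal with `C (f i) (f i) = a i`, and `a` majorizes the
nonincreasing sequence `d`, then there is a `B`-orthonormal family `g` in the span of `f` with
`C (g i) (g i) = d i`. -/
theorem exists_orthonormal_of_majorized {E : Type*} [AddCommGroup E] [Module ℝ E]
    (B C : LinearMap.BilinForm ℝ E) (hB : ∀ x y, B x y = B y x) (hC : ∀ x y, C x y = C y x)
    (n : ℕ) (a d : ℕ → ℝ) (f : ℕ → E)
    (hfB : ∀ i < n, ∀ j < n, B (f i) (f j) = if i = j then 1 else 0)
    (hfC : ∀ i < n, ∀ j < n, C (f i) (f j) = if i = j then a i else 0)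
    (hd : ∀ i j, i ≤ j → j < n → d j ≤ d i)
    (hle : ∀ j ≤ n, ∑ i ∈ range j, d i ≤ ∑ i ∈ range j, a i)
    (heq : ∑ i ∈ range n, d i = ∑ i ∈ range n, a i) :
    ∃ g : ℕ → E, (∀ i < n, ∀ j < n, B (g i) (g j) = if i = j then 1 else 0) ∧
      (∀ i < n, C (g i) (g i) = d i) ∧
      ∀ w, (∀ i < n, B w (f i) = 0) → ∀ i < n, B w (g i) = 0 := by
  induction n generalizing a d f with
  | zero => exact ⟨f, by simp⟩
  | succ n ih =>
    rcases Nat.eq_zero_or_pos n with rfl | hn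
    · refine ⟨f, hfB, fun i hi => ?_, fun w h => h⟩
      obtain rfl : i = 0 := by omega
      rw [hfC 0 hi 0 hi]
      simpa using heq.symm
    have h0 : d 0 ≤ a 0 := by simpa using hle 1 (by omega)
    have hex : ∃ k, k < n ∧ a (k + 1) ≤ d 0 := by
      by_contra! hcon
      refine heq.not_lt (sum_lt_sum (fun i hi => ?_) ⟨n, by simp, ?_⟩)
      · rcases i with _ | i
        · exact h0
        · have := mem_range.1 hi
          exact (hd 0 _ (by omega) this).trans (hcon i (by omega)).le
      · obtain ⟨m, rfl⟩ : ∃ m, n = m + 1 := ⟨n - 1, by omega⟩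
        exact (hd 0 _ (by omega) (by omega)).trans_lt (hcon m (by omega))
    classical
    obtain ⟨k, ⟨hkn, hk⟩, hmin⟩ : ∃ k, (k < n ∧ a (k + 1) ≤ d 0) ∧
        ∀ m < k, ¬ (m < n ∧ a (m + 1) ≤ d 0) :=
      ⟨Nat.find hex, Nat.find_spec hex, fun m hm => Nat.find_min hex hm⟩
    have hlow : ∀ i ≤ k, d 0 ≤ a i := by
      rintro (_ | i) hi
      · exact h0
      · have := hmin i (by omega)
        push Not at this
        exact (this (by omega)).le
    obtain ⟨c, s, hcs, hx⟩ := exists_sq_add_sq_eq_one_and_combo (hlow k le_rfl) hk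
    set b : ℕ → ℝ := fun i =>
      if i < k then a i else if i = k then a k + a (k + 1) - d 0 else a (i + 1) with hb
    set u : E := c • f k + s • f (k + 1) with hu
    set v : E := c • f (k + 1) - s • f k with hv
    set f' : ℕ → E := fun i => if i < k then f i else if i = k then v else f (i + 1) with hf'
    have hsplit : ∀ i < n, (i < k ∧ f' i = f i ∧ b i = a i) ∨
        (i = k ∧ f' i = v ∧ b i = a k + a (k + 1) - d 0) ∨
        (k < i ∧ f' i = f (i + 1) ∧ b i = a (i + 1)) := by
      intro i _
      rcases lt_trichotomy i k with h | h | h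
      · exact .inl ⟨h, by simp [hf', h], by simp [hb, h]⟩
      · exact .inr (.inl ⟨h, by simp [hf', h], by simp [hb, h]⟩)
      · exact .inr (.inr ⟨h, by simp [hf', h.not_gt, h.ne'], by simp [hb, h.not_gt, h.ne']⟩)
    have huB : ∀ i < n, B u (f' i) = 0 := by
      intro i hi
      rcases hsplit i hi with ⟨h, e, -⟩ | ⟨h, e, -⟩ | ⟨h, e, -⟩ <;> rw [e]
      · simp [hu, hfB, show i < n + 1 by omega, show k < n + 1 by omega, hkn, h.ne',
          show k + 1 ≠ i by omega]
      · simp [hu, hv, hfB, show k < n + 1 by omega, hkn]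
        ring
      · simp [hu, hfB, show k < n + 1 by omega, hkn, hi, h.ne, show k ≠ i + 1 by omega]
    have huu : B u u = 1 := by
      simp [hu, hfB, show k < n + 1 by omega, hkn]
      linarith
    have huC : C u u = d 0 := by
      simp [hu, hfC, show k < n + 1 by omega, hkn]
      linarith
    obtain ⟨g, hgB, hgC, hgw⟩ : ∃ g : ℕ → E,
        (∀ i < n, ∀ j < n, B (g i) (g j) = if i = j then 1 else 0) ∧
        (∀ i < n, C (g i) (g i) = d (i + 1)) ∧
        ∀ w, (∀ i < n, B w (f' i) = 0) → ∀ i < n, B w (g i) = 0 := by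
      refine ih b (fun i => d (i + 1)) f' ?_ ?_ ?_ ?_ ?_
      · intro i hi j hj
        wlog hij : i ≤ j generalizing i j
        · rw [hB, this j hj i hi (by omega)]; simp [eq_comm]
        rcases hsplit i hi with ⟨h, e, -⟩ | ⟨h, e, -⟩ | ⟨h, e, -⟩ <;>
        rcases hsplit j hj with ⟨h', e', -⟩ | ⟨h', e', -⟩ | ⟨h', e', -⟩ <;>
        rw [e, e']
        all_goals try omega
        · exact hfB i (by omega) j (by omega)
        · simp [hv, hfB, show i < n + 1 by omega, show k < n + 1 by omega, hkn, h',
            show i ≠ k + 1 by omega, show i ≠ k by omega]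
        · rw [hfB i (by omega) _ (by omega), if_neg (by omega), if_neg (by omega)]
        · simp [hv, hfB, show k < n + 1 by omega, hkn, h, h']
          linarith
        · simp [hv, hfB, show k < n + 1 by omega, hkn, hj, h,
            show k ≠ j + 1 by omega, show k ≠ j by omega]
        · rw [hfB _ (by omega) _ (by omega)]; simp
      · intro i hi j hj
        wlog hij : i ≤ j generalizing i j
        · rw [hC, this j hj i hi (by omega), if_neg (by omega), if_neg (by omega)]
        rcases hsplit i hi with ⟨h, e, o⟩ | ⟨h, e, o⟩ | ⟨h, e, o⟩ <;>
        rcases hsplit j hj with ⟨h', e', -⟩ | ⟨h', e', -⟩ | ⟨h', e', -⟩ <;>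
        rw [e, e', o]
        all_goals try omega
        · exact hfC i (by omega) j (by omega)
        · simp [hv, hfC, show i < n + 1 by omega, show k < n + 1 by omega, hkn, h',
            show i ≠ k + 1 by omega, show i ≠ k by omega]
        · rw [hfC i (by omega) _ (by omega), if_neg (by omega), if_neg (by omega)]
        · simp [hv, hfC, show k < n + 1 by omega, hkn, h, h']
          linear_combination (a k + a (k + 1)) * hcs - hx
        · simp [hv, hfC, show k < n + 1 by omega, hkn, hj, h,
            show k ≠ j + 1 by omega, show k ≠ j by omega]
        · rw [hfC _ (by omega) _ (by omega)]; simp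
      · exact fun i j hij hj => hd _ _ (by omega) (by omega)
      · intro j hj
        rw [hb, sum_range_merge]
        split_ifs with hjk
        · refine sum_le_sum fun i hi => ?_
          have := mem_range.1 hi
          exact (hd 0 _ (by omega) (by omega)).trans (hlow i (by omega))
        · have := hle (j + 1) (by omega)
          rw [sum_range_succ'] at this
          linarith
      · rw [hb, sum_range_merge, if_neg (by omega), ← heq, sum_range_succ' d]
        ring
    refine ⟨fun i => if i = 0 then u else g (i - 1), ?_, ?_, ?_⟩
    · rintro (_ | i) hi (_ | j) hj
      · simpa using huu
      · simpa using hgw u huB j (by omega)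
      · simpa [hB (g i) u] using hgw u huB i (by omega)
      · simpa using hgB i (by omega) j (by omega)
    · rintro (_ | i) hi
      · simpa using huC
      · simpa using hgC i (by omega)
    · rintro w hw (_ | i) hi
      · simp [hu, hw k (by omega), hw (k + 1) (by omega)]
      · refine hgw w (fun i hi => ?_) i (by omega)
        rcases hsplit i hi with ⟨h, e, -⟩ | ⟨h, e, -⟩ | ⟨h, e, -⟩ <;> rw [e]
        · exact hw i (by omega)
        · simp [hv, hw k (by omega), hw (k + 1) (by omega)]
        · exact hw _ (by omega)

section MatrixLemmas

open Matrix

lemma exists_perm_of_map_univ_eq {ι α : Type*} [Fintype ι] [DecidableEq α] {e l : ι → α}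
    (h : Multiset.map e univ.val = Multiset.map l univ.val) :
    ∃ τ : Equiv.Perm ι, ∀ i, e i = l (τ i) := by
  have hc : ∀ x, Nonempty ({i // e i = x} ≃ {i // l i = x}) := fun x => by
    rw [← Fintype.card_eq, Fintype.card_subtype, Fintype.card_subtype]
    have := congrArg (Multiset.count x) h
    simpa [Multiset.count_map, Finset.card, Finset.filter, eq_comm] using this
  exact ⟨Equiv.ofFiberEquiv fun x => (hc x).some, fun i => (Equiv.ofFiberEquiv_map _ i).symm⟩

lemma exists_perm_eigenvalues_eq {ι : Type*} [Fintype ι] [DecidableEq ι] {A : Matrix ι ι ℂ}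
    (hA : A.IsHermitian) (l : ι → ℝ) (h : A = diagonal fun i => (l i : ℂ)) :
    ∃ τ : Equiv.Perm ι, ∀ i, hA.eigenvalues i = l (τ i) := by
  have hr := hA.roots_charpoly_eq_eigenvalues
  have hl : A.charpoly.roots = Multiset.map (fun i => (l i : ℂ)) univ.val := by
    rw [h, charpoly_diagonal, Polynomial.roots_prod _ _ (by
      simp [Finset.prod_ne_zero_iff, Polynomial.X_sub_C_ne_zero])]
    simp
  obtain ⟨τ, hτ⟩ := exists_perm_of_map_univ_eq (hr.symm.trans hl)
  exact ⟨τ, fun i => by simpa using hτ i⟩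

lemma sum_row_norm_sq {m n : Type*} [Fintype m] [Fintype n] [DecidableEq m]
    {G : Matrix m n ℂ} {e : m → ℝ} (h : G * Gᴴ = diagonal fun i => (e i : ℂ)) (i : m) :
    ∑ k, ‖G i k‖ ^ 2 = e i := by
  have := congrFun (congrFun h i) i
  simp only [mul_apply, conjTranspose_apply, diagonal_apply_eq, RCLike.star_def,
    Complex.mul_conj'] at this
  exact_mod_cast this

/-- If the rows of `G` are orthogonal with squared norms `e`, then the squared moduli of its entries
are `e` times a doubly substochastic matrix. -/
lemma exists_weights {m n : Type*} [Fintype m] [Fintype n] [DecidableEq m]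
    (G : Matrix m n ℂ) (e : m → ℝ) (h : G * Gᴴ = diagonal fun i => (e i : ℂ)) :
    ∃ w : m → n → ℝ, (∀ i k, 0 ≤ w i k) ∧ (∀ i, ∑ k, w i k ≤ 1) ∧ (∀ k, ∑ i, w i k ≤ 1) ∧
      ∀ i k, ‖G i k‖ ^ 2 = e i * w i k := by
  have hrow := sum_row_norm_sq h
  have he : ∀ i, 0 ≤ e i := fun i => hrow i ▸ by positivity
  set H : Matrix n n ℂ := Gᴴ * (diagonal fun i => ((e i : ℂ))⁻¹) * G with hH
  have hHH : H * H = H := by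
    calc H * H = Gᴴ * ((diagonal fun i => ((e i : ℂ))⁻¹) * (G * Gᴴ) *
          (diagonal fun i => ((e i : ℂ))⁻¹)) * G := by simp only [hH, Matrix.mul_assoc]
      _ = H := by
        have hi : ∀ i, (e i : ℂ)⁻¹ * e i * (e i : ℂ)⁻¹ = (e i : ℂ)⁻¹ := fun i => by
          by_cases h0 : (e i : ℂ) = 0 <;> simp [h0]
        simp only [h, diagonal_mul_diagonal, hH, hi]
  have hHs : Hᴴ = H := by
    simp [hH, conjTranspose_mul, Matrix.mul_assoc, diagonal_conjTranspose, Pi.star_def]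
  have hdiag : ∀ k, H k k = ((∑ i, ‖G i k‖ ^ 2 / e i : ℝ) : ℂ) := fun k => by
    push_cast
    rw [hH, mul_apply]
    refine sum_congr rfl fun i _ => ?_
    rw [mul_diagonal, conjTranspose_apply, RCLike.star_def, ← Complex.conj_mul']
    ring
  refine ⟨fun i k => ‖G i k‖ ^ 2 / e i, fun i k => div_nonneg (by positivity) (he i), fun i => ?_,
    fun k => ?_, fun i k => ?_⟩
  · rw [← sum_div, hrow]
    exact div_self_le_one _
  · have h1 := congrFun (congrFun hHH k) k
    have h2 : ∑ l, ‖H k l‖ ^ 2 = ∑ i, ‖G i k‖ ^ 2 / e i := by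
      rw [hdiag, mul_apply] at h1
      nth_rewrite 2 [← hHs] at h1
      simp only [conjTranspose_apply, RCLike.star_def, Complex.mul_conj'] at h1
      exact_mod_cast h1
    have h3 : ‖H k k‖ ^ 2 ≤ ∑ l, ‖H k l‖ ^ 2 :=
      single_le_sum (f := fun l => ‖H k l‖ ^ 2) (fun _ _ => by positivity) (mem_univ k)
    rw [h2, hdiag, Complex.norm_real, Real.norm_eq_abs, sq_abs] at h3
    nlinarith
  · by_cases h0 : e i = 0
    · have := (hrow i).trans h0
      rw [sum_eq_zero_iff_of_nonneg (fun _ _ => by positivity)] at this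
      simp [h0, this k (mem_univ k)]
    · field_simp

lemma sum_mul_le_sum_pos_part {m : Type*} [Fintype m] (e c : m → ℝ) (t s : ℝ) (ht : 0 ≤ t)
    (hc0 : ∀ i, 0 ≤ c i) (hc1 : ∀ i, c i ≤ 1) (hcs : ∑ i, c i ≤ s) :
    ∑ i, e i * c i ≤ ∑ i, max (e i - t) 0 + t * s := by
  calc ∑ i, e i * c i ≤ ∑ i, (max (e i - t) 0 + t * c i) := by
        refine sum_le_sum fun i _ => ?_
        nlinarith [le_max_left (e i - t) 0, le_max_right (e i - t) 0, hc0 i, hc1 i,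
          mul_le_mul_of_nonneg_right (le_max_left (e i - t) 0) (hc0 i),
          mul_le_of_le_one_right (le_max_right (e i - t) 0) (hc1 i)]
    _ ≤ _ := by
        rw [sum_add_distrib, ← mul_sum]
        gcongr

lemma sum_col_norm_sq {m n : Type*} [Fintype m] (F : Matrix m n ℂ) (k : n) :
    ((∑ i, ‖F i k‖ ^ 2 : ℝ) : ℂ) = (Fᴴ * F) k k := by
  simp [mul_apply, Complex.conj_mul']

lemma sum_vecMulVec_star {m n : Type*} [Fintype n] (φ : n → m → ℂ) :
    ∑ k, vecMulVec (φ k) (star (φ k)) = (of φ)ᵀ * ((of φ)ᵀ)ᴴ := by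
  ext i j
  simp [mul_apply, Matrix.sum_apply, vecMulVec_apply]

lemma exists_diagonal_gram {m n : Type*} [Fintype m] [Fintype n] [DecidableEq m]
    (F : Matrix m n ℂ) (hA : (F * Fᴴ).IsHermitian) :
    ∃ G : Matrix m n ℂ, G * Gᴴ = (diagonal fun i => (hA.eigenvalues i : ℂ)) ∧
      ∀ k, ∑ i, ‖G i k‖ ^ 2 = ∑ i, ‖F i k‖ ^ 2 := by
  set U := hA.eigenvectorUnitary
  refine ⟨(U : Matrix m m ℂ)ᴴ * F, ?_, fun k => ?_⟩
  · have := hA.conjStarAlgAut_star_eigenvectorUnitary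
    rw [Unitary.conjStarAlgAut_star_apply] at this
    rw [conjTranspose_mul, conjTranspose_conjTranspose, ← Matrix.mul_assoc,
      Matrix.mul_assoc _ F]
    exact this
  · have hU : (U : Matrix m m ℂ) * (U : Matrix m m ℂ)ᴴ = 1 := Unitary.mul_star_self_of_mem U.2
    refine Complex.ofReal_injective ?_
    rw [sum_col_norm_sq, sum_col_norm_sq, conjTranspose_mul, conjTranspose_conjTranspose,
      ← Matrix.mul_assoc, Matrix.mul_assoc _ (U : Matrix m m ℂ), hU, Matrix.mul_one]

lemma sum_Icc_one_eq_sum_range (a : ℕ → ℝ) (j : ℕ) :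
    ∑ n ∈ Icc 1 j, a n = ∑ i ∈ range j, a (i + 1) := by
  induction j with
  | zero => simp
  | succ j ih => rw [sum_Icc_succ_top (by omega), sum_range_succ, ih]

lemma NonnegNonincrOn.le_of_le {M : ℕ} {a : ℕ → ℝ} (h : NonnegNonincrOn M a) {i j : ℕ}
    (hi : 1 ≤ i) (hij : i ≤ j) (hj : j ≤ M) : a j ≤ a i := by
  induction j, hij using Nat.le_induction with
  | base => exact le_rfl
  | succ j hij ih => exact (h.2 j (by omega) (by omega)).trans (ih (by omega))

lemma NonnegNonincrOn.sum_pos_part_eq {M : ℕ} {a : ℕ → ℝ} (h : NonnegNonincrOn M a) {j : ℕ}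
    (hj : 1 ≤ j) (hjM : j ≤ M) :
    ∑ i : Fin M, max (a ((i : ℕ) + 1) - a j) 0 + a j * j = ∑ i ∈ range j, a (i + 1) := by
  rw [Fin.sum_univ_eq_sum_range (fun i => max (a (i + 1) - a j) 0),
    ← sum_range_add_sum_Ico _ hjM, sum_eq_zero (s := Ico j M), add_zero,
    sum_congr rfl (g := fun i => a (i + 1) - a j)]
  · simp [mul_comm]
  · intro i hi
    have := mem_range.1 hi
    exact max_eq_left (sub_nonneg.2 (h.le_of_le (by omega) (by omega) hjM))
  · intro i hi
    have := mem_Ico.1 hi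
    exact max_eq_right (sub_nonpos.2 (h.le_of_le hj (by omega) (by omega)))

theorem majorized_of_frame {M N : ℕ} (hMN : M ≤ N) {lam μ : ℕ → ℝ} (hlam : NonnegNonincrOn M lam)
    (φ : Fin N → Fin M → ℂ) (hB : (∑ n, vecMulVec (φ n) (star (φ n))).IsHermitian)
    (τ : Equiv.Perm (Fin M)) (hφ : ∀ n, ∑ i, ‖φ n i‖ ^ 2 = μ ((n : ℕ) + 1))
    (hτ : ∀ i, hB.eigenvalues i = lam ((τ i : ℕ) + 1)) :
    (∑ i ∈ range N, μ (i + 1) = ∑ i ∈ range M, lam (i + 1)) ∧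
      ∀ j, 1 ≤ j → j ≤ M → ∑ i ∈ range j, μ (i + 1) ≤ ∑ i ∈ range j, lam (i + 1) := by
  have hF := sum_vecMulVec_star φ
  generalize ∑ n, vecMulVec (φ n) (star (φ n)) = A at hB hF
  subst hF
  obtain ⟨G, hG, hGn⟩ := exists_diagonal_gram _ hB
  have hcol : ∀ k : Fin N, ∑ i, ‖G i k‖ ^ 2 = μ ((k : ℕ) + 1) := fun k =>
    (hGn k).trans (hφ k)
  have hrow : ∀ i, ∑ k, ‖G i k‖ ^ 2 = hB.eigenvalues i := sum_row_norm_sq hG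
  constructor
  · rw [← Fin.sum_univ_eq_sum_range (fun i => μ (i + 1)),
      ← Fin.sum_univ_eq_sum_range (fun i => lam (i + 1)),
      ← Equiv.sum_comp τ]
    simp only [← hcol, ← hτ, ← hrow]
    exact sum_comm
  · intro j hj hjM
    obtain ⟨w, hw0, hwr, hwc, hw⟩ := exists_weights G _ hG
    let S : Finset (Fin N) := univ.filter fun k => (k : ℕ) < j
    have hS : ∀ a : ℕ → ℝ, ∑ k ∈ S, a k = ∑ i ∈ range j, a i := fun a => by
      rw [sum_filter, Fin.sum_univ_eq_sum_range (fun i => if i < j then a i else 0), ← sum_filter]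
      congr 1
      ext i
      simp
      omega
    have hSc : (#S : ℝ) = j := by simpa using hS fun _ => 1
    rw [← hS fun i => μ (i + 1), ← hlam.sum_pos_part_eq hj hjM,
      ← Equiv.sum_comp τ]
    simp only [← hcol, ← hτ, hw]
    rw [sum_comm]
    simp only [← mul_sum]
    refine sum_mul_le_sum_pos_part _ _ _ _ (hlam.1 j hj hjM)
      (fun i => sum_nonneg fun k _ => hw0 i k)
      (fun i => (sum_le_sum_of_subset_of_nonneg (subset_univ S) fun k _ _ => hw0 i k).trans
        (hwr i)) ?_
    rw [sum_comm, ← hSc]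
    simpa using sum_le_card_nsmul S _ 1 fun k _ => hwc k

/-- Horn's theorem: a spectrum majorizing a nonincreasing diagonal is realized by an orthogonal
matrix. -/
theorem exists_orthogonal_of_majorized {n : ℕ} {a d : ℕ → ℝ}
    (hd : ∀ i j, i ≤ j → j < n → d j ≤ d i)
    (hle : ∀ j ≤ n, ∑ i ∈ range j, d i ≤ ∑ i ∈ range j, a i)
    (heq : ∑ i ∈ range n, d i = ∑ i ∈ range n, a i) :
    ∃ Q : Matrix (Fin n) (Fin n) ℝ,
      Q * Qᵀ = 1 ∧ ∀ k : Fin n, ∑ i : Fin n, a i * Q i k ^ 2 = d k := by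
  let D : Matrix (Fin n) (Fin n) ℝ := diagonal fun i => a i
  let f : ℕ → Fin n → ℝ := fun i k => if (k : ℕ) = i then 1 else 0
  have hf : ∀ (i : Fin n), f i = Pi.single i 1 := fun i => by
    ext k; simp [f, Pi.single_apply, Fin.ext_iff]
  obtain ⟨g, hgB, hgC, -⟩ := exists_orthonormal_of_majorized
    (toBilin' (1 : Matrix (Fin n) (Fin n) ℝ)) (toBilin' D)
    (fun x y => by simp [toBilin'_apply', dotProduct_comm])
    (fun x y => by
      simp only [toBilin'_apply', D, mulVec_diagonal, dotProduct]
      exact sum_congr rfl fun i _ => by ring)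
    n a d f
    (fun i hi j hj => by
      rw [hf ⟨i, hi⟩, hf ⟨j, hj⟩, toBilin'_single]; simp [one_apply])
    (fun i hi j hj => by
      rw [hf ⟨i, hi⟩, hf ⟨j, hj⟩, toBilin'_single]; simp [D, diagonal_apply])
    hd hle heq
  refine ⟨of fun i k => g k i, mul_eq_one_comm.1 ?_, fun k => ?_⟩
  · ext k l
    simpa [mul_apply, toBilin'_apply', dotProduct, one_apply, Fin.ext_iff] using
      hgB k k.2 l l.2
  · rw [← hgC k k.2]
    simp only [toBilin'_apply', D, mulVec_diagonal, dotProduct, of_apply]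
    exact sum_congr rfl fun i _ => by ring

theorem frame_of_majorized {M N : ℕ} (hMN : M ≤ N) {lam μ : ℕ → ℝ} (hlam : NonnegNonincrOn M lam)
    (hμ : NonnegNonincrOn N μ)
    (heq : ∑ i ∈ range N, μ (i + 1) = ∑ i ∈ range M, lam (i + 1))
    (hle : ∀ j, 1 ≤ j → j ≤ M → ∑ i ∈ range j, μ (i + 1) ≤ ∑ i ∈ range j, lam (i + 1)) :
    ∃ φ : Fin N → Fin M → ℂ, (∀ n, ∑ i, ‖φ n i‖ ^ 2 = μ ((n : ℕ) + 1)) ∧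
      ∑ n, vecMulVec (φ n) (star (φ n)) = diagonal fun i : Fin M => (lam ((i : ℕ) + 1) : ℂ) := by
  set a : ℕ → ℝ := fun i => if i < M then lam (i + 1) else 0 with ha
  have hsum_le : ∀ j ≤ M, ∑ i ∈ range j, a i = ∑ i ∈ range j, lam (i + 1) := fun j hj =>
    sum_congr rfl fun i hi => if_pos ((mem_range.1 hi).trans_le hj)
  have hsum_ge : ∀ j, M ≤ j → ∑ i ∈ range j, a i = ∑ i ∈ range M, lam (i + 1) := fun j hj => by
    rw [← sum_range_add_sum_Ico _ hj, hsum_le M le_rfl, sum_eq_zero (s := Ico M j), add_zero]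
    exact fun i hi => if_neg (mem_Ico.1 hi).1.not_gt
  obtain ⟨Q, hQ, hQd⟩ := exists_orthogonal_of_majorized (n := N) (a := a) (d := fun i => μ (i + 1))
    (fun i j hij hj => hμ.le_of_le (by omega) (by omega) (by omega))
    (fun j hj => by
      rcases le_total j M with h | h
      · rw [hsum_le j h]
        rcases Nat.eq_zero_or_pos j with rfl | h0
        · simp
        · exact hle j h0 h
      · rw [hsum_ge j h, ← heq]
        refine sum_le_sum_of_subset_of_nonneg (range_mono hj) fun i hi _ => ?_
        have := mem_range.1 hi
        exact hμ.1 _ (by omega) (by omega))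
    (heq.trans (hsum_ge N hMN).symm)
  have hl : ∀ i : Fin M, 0 ≤ lam ((i : ℕ) + 1) := fun i => hlam.1 _ (by omega) (by omega)
  refine ⟨fun n i => ((√(lam ((i : ℕ) + 1)) * Q (Fin.castLE hMN i) n : ℝ) : ℂ), fun n => ?_, ?_⟩
  · obtain ⟨K, rfl⟩ := Nat.exists_eq_add_of_le hMN
    rw [← hQd n, Fin.sum_univ_add]
    simp only [ha, Fin.val_castAdd, Fin.is_lt, if_true, Fin.val_natAdd,
      (Nat.le_add_right M _).not_gt, if_false, zero_mul, sum_const_zero, add_zero]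
    refine sum_congr rfl fun i _ => ?_
    rw [Complex.norm_real, Real.norm_eq_abs, sq_abs, mul_pow, Real.sq_sqrt (hl i)]
    rfl
  · ext i j
    have := congrFun (congrFun hQ (Fin.castLE hMN i)) (Fin.castLE hMN j)
    rw [mul_apply] at this
    simp only [transpose_apply, one_apply, Fin.castLE_inj] at this
    have h2 : ∑ n, √(lam ((i : ℕ) + 1)) * Q (Fin.castLE hMN i) n *
        (√(lam ((j : ℕ) + 1)) * Q (Fin.castLE hMN j) n) =
        if i = j then lam ((i : ℕ) + 1) else 0 := by
      calc _ = √(lam ((i : ℕ) + 1)) * √(lam ((j : ℕ) + 1)) *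
            ∑ n, Q (Fin.castLE hMN i) n * Q (Fin.castLE hMN j) n := by
            rw [mul_sum]
            exact sum_congr rfl fun n _ => by ring
        _ = _ := by
            rw [this]
            split_ifs with hij
            · rw [← hij, mul_one, Real.mul_self_sqrt (hl i)]
            · rw [mul_zero]
    rw [Matrix.sum_apply, diagonal_apply]
    simp only [vecMulVec_apply, Pi.star_apply, RCLike.star_def, Complex.conj_ofReal]
    rw [← Complex.ofReal_zero, ← apply_ite Complex.ofReal, ← h2]
    push_cast
    rfl

end MatrixLemmas

/-- The Schur-Horn theorem for finite frames: for `M ≤ N` and nonnegative nonincreasing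
`lam`, `μ`, there exist vectors `φ₁, …, φ_N ∈ ℂ^M` with `‖φₙ‖² = μₙ` whose frame operator
`∑ₙ φₙ φₙ*` has spectrum (with multiplicity) `{lam 1, …, lam M}` if and only if
`∑ μₙ = ∑ lam m` and `∑_{n=1}^j μ_n ≤ ∑_{m=1}^j lam_m` for all `j = 1, …, M`. -/
theorem frame_schurHorn (M N : ℕ) (hM : 0 < M) (hMN : M ≤ N) (lam μ : ℕ → ℝ)
    (hlam : NonnegNonincrOn M lam) (hμ : NonnegNonincrOn N μ) :
    (∃ (φ : Fin N → Fin M → ℂ)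
        (hB : (∑ n : Fin N, Matrix.vecMulVec (φ n) (star (φ n))).IsHermitian)
        (τ : Equiv.Perm (Fin M)),
        (∀ n : Fin N, ∑ i, ‖φ n i‖ ^ 2 = μ ((n : ℕ) + 1)) ∧
        (∀ i : Fin M, hB.eigenvalues i = lam ((τ i : ℕ) + 1))) ↔
      ((∑ n ∈ Icc 1 N, μ n = ∑ m ∈ Icc 1 M, lam m) ∧
        ∀ j, 1 ≤ j → j ≤ M → ∑ n ∈ Icc 1 j, μ n ≤ ∑ m ∈ Icc 1 j, lam m) := by
  simp only [sum_Icc_one_eq_sum_range]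
  constructor
  · rintro ⟨φ, hB, τ, hφ, hτ⟩
    exact majorized_of_frame hMN hlam φ hB τ hφ hτ
  · rintro ⟨heq, hle⟩
    obtain ⟨φ, hφ, hD⟩ := frame_of_majorized hMN hlam hμ heq hle
    have hB : (∑ n, Matrix.vecMulVec (φ n) (star (φ n))).IsHermitian := by
      rw [sum_vecMulVec_star]
      exact Matrix.isHermitian_mul_conjTranspose_self _
    obtain ⟨τ, hτ⟩ := exists_perm_eigenvalues_eq hB (fun i => lam ((i : ℕ) + 1)) hD
    exact ⟨φ, hB, τ, hφ, hτ⟩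
end

section
/- Let α = (α_1,…,α_M), λ = (λ_1,…,λ_M) and μ = (μ_1,…,μ_N) be nonnegative nonincreasing sequences of real numbers. Then λ is an (α,μ)-completion if and only if there exists a sequence of eigensteps from α to λ with lengths μ. -/
open Finset

/-- A sequence of eigensteps from `α` to `lam` with lengths `μ`:
`L P m` (for `P = 0, …, N`, `m = 1, …, M`) is nonincreasing in `m` for each `P`,
`L 0 = α`, `L N = lam`, the traces satisfy
`∑_m L P m = ∑_m α m + ∑_{n=1}^P μ n`, and consecutive rows interlace:
`L P (m+1) ≤ L (P-1) m ≤ L P m` for `m = 1, …, M`, with the convention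
`L P (M+1) := 0`. -/
def IsEigensteps (M N : ℕ) (α lam μ : ℕ → ℝ) (L : ℕ → ℕ → ℝ) : Prop :=
  (∀ P m, P ≤ N → 1 ≤ m → m < M → L P (m + 1) ≤ L P m) ∧
  (∀ m, 1 ≤ m → m ≤ M → L 0 m = α m) ∧
  (∀ m, 1 ≤ m → m ≤ M → L N m = lam m) ∧
  (∀ P, P ≤ N → ∑ m ∈ Finset.Icc 1 M, L P m
      = ∑ m ∈ Finset.Icc 1 M, α m + ∑ n ∈ Finset.Icc 1 P, μ n) ∧
  (∀ P m, 1 ≤ P → P ≤ N → 1 ≤ m → m < M → L P (m + 1) ≤ L (P - 1) m) ∧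
  (∀ P, 1 ≤ P → P ≤ N → 0 ≤ L (P - 1) M) ∧
  (∀ P m, 1 ≤ P → P ≤ N → 1 ≤ m → m ≤ M → L (P - 1) m ≤ L P m)

open Polynomial in
/-- If `α i ≤ β i` for all `i`, and `β k ≤ α j` whenever `j` precedes `k`, then
`∏ (X - β i)` is `∏ (X - α i)` minus a nonnegative combination of the polynomials
`∏_{j ≠ i} (X - α j)`. -/
theorem exists_nonneg_prod_sub_eq {ι : Type*} [LinearOrder ι] (s : Finset ι) (α β : ι → ℝ)
    (hle : ∀ i ∈ s, α i ≤ β i) (hlt : ∀ j ∈ s, ∀ k ∈ s, j < k → β k ≤ α j) :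
    ∃ c : ι → ℝ, (∀ i, 0 ≤ c i) ∧
      ∏ i ∈ s, (X - C (β i)) =
        ∏ i ∈ s, (X - C (α i)) - ∑ i ∈ s, C (c i) * ∏ j ∈ s.erase i, (X - C (α j)) := by
  induction hn : #s generalizing s with
  | zero =>
    obtain rfl := Finset.card_eq_zero.mp hn
    exact ⟨fun _ => 0, by simp⟩
  | succ n ih =>
    by_cases hinj : Set.InjOn α s
    · set c : ι → ℝ := fun k => (β k - α k) *
        ∏ j ∈ s.erase k, (α k - β j) / (α k - α j) with hc
      have hc0 : ∀ k ∈ s, 0 ≤ c k := by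
        intro k hk
        refine mul_nonneg (sub_nonneg.2 (hle k hk)) (Finset.prod_nonneg fun j hj => ?_)
        obtain ⟨hjk, hj⟩ := Finset.mem_erase.mp hj
        rcases lt_or_gt_of_ne hjk with h | h
        · have h1 := hlt j hj k hk h
          have h2 := hle k hk
          have h3 := hle j hj
          exact div_nonneg_of_nonpos (by linarith) (by linarith)
        · have h1 := hlt k hk j hj h
          have h2 := hle j hj
          exact div_nonneg (by linarith) (by linarith)
      refine ⟨fun k => if k ∈ s then c k else 0, fun i => ?_, ?_⟩
      · dsimp only
        split_ifs with h
        exacts [hc0 i h, le_rfl]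
      have hsum : ∑ i ∈ s, C (if i ∈ s then c i else 0) * ∏ j ∈ s.erase i, (X - C (α j)) =
          ∑ i ∈ s, C (c i) * ∏ j ∈ s.erase i, (X - C (α j)) :=
        Finset.sum_congr rfl fun i hi => by rw [if_pos hi]
      rw [hsum, eq_sub_iff_add_eq, ← eq_sub_iff_add_eq']
      refine eq_of_degrees_lt_of_eval_index_eq s hinj ?_ ?_ ?_
      · rw [← mem_degreeLT]
        refine Submodule.sum_mem _ fun i hi => ?_
        rw [← smul_eq_C_mul]
        refine Submodule.smul_mem _ _ ?_
        rw [mem_degreeLT, degree_prod]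
        simp only [degree_X_sub_C, Finset.sum_const, nsmul_eq_mul, mul_one]
        exact_mod_cast Finset.card_erase_lt_of_mem hi
      · have hd : ∀ f : ι → ℝ, (∏ i ∈ s, (X - C (f i))).degree = (#s : WithBot ℕ) := fun f => by
          rw [degree_prod]; simp
        have hm : ∀ f : ι → ℝ, (∏ i ∈ s, (X - C (f i))).Monic := fun f =>
          monic_prod_of_monic _ _ fun i _ => monic_X_sub_C _
        refine (degree_sub_lt_left (by rw [hd, hd]) (hm _).ne_zero ?_).trans_eq (hd _)
        rw [(hm _).leadingCoeff, (hm _).leadingCoeff]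
      · intro k hk
        have hne : ∀ j ∈ s.erase k, α k - α j ≠ 0 := fun j hj => by
          obtain ⟨hjk, hj⟩ := Finset.mem_erase.mp hj
          exact sub_ne_zero.2 fun h => hjk (hinj hj hk h.symm)
        rw [eval_finsetSum, Finset.sum_eq_single_of_mem k hk]
        · simp only [eval_sub, eval_mul, eval_prod, eval_X, eval_C]
          rw [Finset.prod_eq_zero (f := fun j => α k - α j) hk (sub_self _), zero_sub,
            ← Finset.mul_prod_erase s _ hk, hc]
          dsimp only
          rw [Finset.prod_div_distrib, mul_assoc,
            div_mul_cancel₀ _ (Finset.prod_ne_zero_iff.mpr hne)]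
          ring
        · intro i hi hik
          rw [eval_mul, eval_prod, Finset.prod_eq_zero (Finset.mem_erase.mpr ⟨hik.symm, hk⟩),
            mul_zero]
          simp
    · have : ∃ j ∈ s, ∃ k ∈ s, j < k ∧ α j = α k := by
        simp only [Set.InjOn, not_forall] at hinj
        obtain ⟨j, hj, k, hk, h, hjk⟩ := hinj
        rcases lt_or_gt_of_ne hjk with h' | h'
        exacts [⟨j, hj, k, hk, h', h⟩, ⟨k, hk, j, hj, h', h.symm⟩]
      obtain ⟨j, hj, k, hk, hjk, hα⟩ := this
      have hβ : β k = α k := le_antisymm (hα ▸ hlt j hj k hk hjk) (hle k hk)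
      obtain ⟨c, hc, h⟩ := ih (s.erase k) (fun i hi => hle i (Finset.mem_of_mem_erase hi))
        (fun a ha b hb => hlt a (Finset.mem_of_mem_erase ha) b (Finset.mem_of_mem_erase hb))
        (by rw [Finset.card_erase_of_mem hk, hn]; rfl)
      refine ⟨Function.update c k 0, fun i => ?_, ?_⟩
      · rcases eq_or_ne i k with rfl | hik
        · simp
        · simpa [hik] using hc i
      · rw [← Finset.mul_prod_erase s _ hk, h, ← Finset.mul_prod_erase s _ hk,
          ← Finset.add_sum_erase s _ hk, hβ, mul_sub, Finset.mul_sum]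
        simp only [Function.update_self, map_zero, zero_mul, zero_add]
        congr 1
        refine Finset.sum_congr rfl fun i hi => ?_
        obtain ⟨hik, hi⟩ := Finset.mem_erase.mp hi
        rw [Function.update_of_ne hik, ← Finset.mul_prod_erase (s.erase i) _
          (Finset.mem_erase.mpr ⟨hik.symm, hk⟩), Finset.erase_right_comm]
        ring

open Polynomial in
/-- The characteristic polynomial of a rank-one perturbation of a diagonal matrix. -/
theorem charpoly_diagonal_add_vecMulVec {ι : Type*} [Fintype ι] [DecidableEq ι]
    (d u v : ι → ℂ) :
    (Matrix.diagonal d + Matrix.vecMulVec u v).charpoly =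
      ∏ i, (X - C (d i)) - ∑ i, C (u i * v i) * ∏ j ∈ univ.erase i, (X - C (d j)) := by
  refine eq_of_infinite_eval_eq _ _ (Set.Infinite.mono (s := (Set.range d)ᶜ) ?_
    (Set.finite_range d).infinite_compl)
  intro x hx
  have hx' : ∀ i, x - d i ≠ 0 := fun i h => hx ⟨i, (sub_eq_zero.mp h).symm⟩
  have hinv : (Matrix.diagonal fun i => x - d i)⁻¹ = Matrix.diagonal fun i => (x - d i)⁻¹ := by
    refine Matrix.inv_eq_left_inv ?_
    rw [Matrix.diagonal_mul_diagonal]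
    simp [hx']
  have hM : Matrix.scalar ι x - (Matrix.diagonal d + Matrix.vecMulVec u v) =
      Matrix.diagonal (fun i => x - d i) +
        Matrix.replicateCol Unit (-u) * Matrix.replicateRow Unit v := by
    rw [← Matrix.vecMulVec_eq, Matrix.neg_vecMulVec, ← sub_sub, ← sub_eq_add_neg,
      Matrix.scalar_apply, Matrix.diagonal_sub]
  have hdet : IsUnit (Matrix.diagonal fun i => x - d i).det := by
    rw [Matrix.det_diagonal]
    exact (Finset.prod_ne_zero_iff.mpr fun i _ => hx' i).isUnit
  simp only [Set.mem_ofPred_eq]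
  rw [Matrix.eval_charpoly, hM, Matrix.det_add_replicateCol_mul_replicateRow hdet, hinv,
    Matrix.det_diagonal, Matrix.det_unique]
  simp only [eval_sub, eval_prod, eval_finsetSum, eval_mul, eval_X, eval_C]
  rw [Matrix.add_apply, Matrix.one_apply_eq, mul_add, mul_one, sub_eq_add_neg,
    Matrix.mul_apply, Finset.mul_sum, ← Finset.sum_neg_distrib]
  congr 1
  refine Finset.sum_congr rfl fun i _ => ?_
  rw [← Finset.mul_prod_erase univ _ (mem_univ i)]
  simp only [Matrix.mul_diagonal, Matrix.replicateRow_apply, Matrix.replicateCol_apply,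
    Pi.neg_apply]
  field_simp [hx' i]

open Polynomial in
/-- `a` lists the eigenvalues of `A` with multiplicity. -/
def HasSpectrum {M : ℕ} (A : Matrix (Fin M) (Fin M) ℂ) (a : Fin M → ℝ) : Prop :=
  A.charpoly = ∏ i, (X - C (a i : ℂ))

theorem Antitone.eq_of_comp_perm {M : ℕ} {f g : Fin M → ℝ} (hf : Antitone f) (hg : Antitone g)
    (σ : Equiv.Perm (Fin M)) (h : ∀ i, f i = g (σ i)) : f = g := by
  have hfg : f = g ∘ σ := funext h
  have := Tuple.unique_antitone (f := g) (σ := σ) (τ := 1) (hfg ▸ hf) hg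
  rw [hfg, this]
  rfl

namespace HasSpectrum

variable {M : ℕ} {A : Matrix (Fin M) (Fin M) ℂ} {a b : Fin M → ℝ}

theorem comp_perm (h : HasSpectrum A a) (σ : Equiv.Perm (Fin M)) : HasSpectrum A (a ∘ σ) := by
  rw [HasSpectrum, h, ← Equiv.prod_comp σ]
  rfl

theorem eigenvalues (hA : A.IsHermitian) : HasSpectrum A hA.eigenvalues := hA.charpoly_eq

theorem roots_charpoly (h : HasSpectrum A a) :
    A.charpoly.roots = univ.val.map fun i => (a i : ℂ) := by
  rw [h, Polynomial.roots_prod _ _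
    (Finset.prod_ne_zero_iff.mpr fun i _ => Polynomial.X_sub_C_ne_zero _)]
  simp

theorem trace_eq (h : HasSpectrum A a) : A.trace = ((∑ i, a i : ℝ) : ℂ) := by
  rw [Matrix.trace_eq_sum_roots_charpoly, h.roots_charpoly, Complex.ofReal_sum]
  rfl

theorem exists_perm (ha : HasSpectrum A a) (hb : HasSpectrum A b) :
    ∃ σ : Equiv.Perm (Fin M), ∀ i, a i = b (σ i) := by
  have h : univ.val.map a = univ.val.map b := by
    have := ha.roots_charpoly.symm.trans hb.roots_charpoly
    refine Multiset.map_injective Complex.ofReal_injective ?_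
    simpa [Multiset.map_map, Function.comp_def] using this
  have hs : ∀ (f : Fin M → ℝ) (σ : Equiv.Perm (Fin M)),
      (List.ofFn (f ∘ σ) : Multiset ℝ) = univ.val.map f := fun f σ => by
    rw [← Fin.univ_val_map, ← Multiset.map_map, Multiset.map_univ_val_equiv]
  have hl : List.ofFn (a ∘ Tuple.sort a) = List.ofFn (b ∘ Tuple.sort b) := by
    refine List.Perm.eq_of_sortedLE ?_ ?_ ?_
    · exact List.sortedLE_ofFn_iff.mpr (Tuple.monotone_sort a)
    · exact List.sortedLE_ofFn_iff.mpr (Tuple.monotone_sort b)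
    · rw [← Multiset.coe_eq_coe, hs, hs, h]
  refine ⟨(Tuple.sort a).symm.trans (Tuple.sort b), fun i => ?_⟩
  have := congrFun (List.ofFn_injective hl) ((Tuple.sort a).symm i)
  simpa using this

theorem exists_antitone (hA : A.IsHermitian) : ∃ a : Fin M → ℝ, Antitone a ∧ HasSpectrum A a := by
  refine ⟨hA.eigenvalues ∘ Tuple.sort (fun i => - hA.eigenvalues i), fun i j hij => ?_,
    (eigenvalues hA).comp_perm _⟩
  exact neg_le_neg_iff.mp (Tuple.monotone_sort (fun i => - hA.eigenvalues i) hij)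

end HasSpectrum

open scoped Matrix

theorem isHermitian_vecMulVec_self_star {ι : Type*} (φ : ι → ℂ) :
    (Matrix.vecMulVec φ (star φ)).IsHermitian := by
  ext i j
  simp [Matrix.vecMulVec_apply, mul_comm]

theorem isHermitian_sum_vecMulVec {ι κ : Type*} (s : Finset κ) (φ : κ → ι → ℂ) :
    (∑ n ∈ s, Matrix.vecMulVec (φ n) (star (φ n))).IsHermitian :=
  isSelfAdjoint_sum s fun n _ => isHermitian_vecMulVec_self_star (φ n)

theorem dotProduct_star_self_eq_sum_norm_sq {ι : Type*} [Fintype ι] (φ : ι → ℂ) :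
    φ ⬝ᵥ star φ = ((∑ i, ‖φ i‖ ^ 2 : ℝ) : ℂ) := by
  simp only [dotProduct, Pi.star_apply, Complex.ofReal_sum, Complex.ofReal_pow]
  exact Finset.sum_congr rfl fun i _ => Complex.mul_conj' (φ i)

theorem sum_mul_prod_erase_comp_perm {ι R : Type*} [Fintype ι] [DecidableEq ι] [CommRing R]
    (σ : Equiv.Perm ι) (f g : ι → R) :
    ∑ i, f (σ i) * ∏ j ∈ univ.erase i, g (σ j) = ∑ i, f i * ∏ j ∈ univ.erase i, g j := by
  rw [← Equiv.sum_comp σ fun i => f i * ∏ j ∈ univ.erase i, g j]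
  refine Finset.sum_congr rfl fun i _ => ?_
  rw [Finset.prod_equiv σ (t := univ.erase (σ i)) (g := g) (by simp) (by simp)]

namespace HasSpectrum

variable {M : ℕ} {A B : Matrix (Fin M) (Fin M) ℂ} {a b : Fin M → ℝ}

theorem sum_add_vecMulVec {φ : Fin M → ℂ} (ha : HasSpectrum A a)
    (hb : HasSpectrum (A + Matrix.vecMulVec φ (star φ)) b) :
    ∑ i, b i = ∑ i, a i + ∑ i, ‖φ i‖ ^ 2 := by
  have h := hb.trace_eq
  rw [Matrix.trace_add, ha.trace_eq, Matrix.trace_vecMulVec,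
    dotProduct_star_self_eq_sum_norm_sq] at h
  exact_mod_cast h.symm

theorem diagonal (a : Fin M → ℝ) : HasSpectrum (Matrix.diagonal fun i => (a i : ℂ)) a :=
  Matrix.charpoly_diagonal _

theorem exists_unitary_diagonalization (hA : A.IsHermitian) (ha : HasSpectrum A a) :
    ∃ (U : Matrix (Fin M) (Fin M) ℂ) (σ : Equiv.Perm (Fin M)), star U * U = 1 ∧ U * star U = 1 ∧
      A = U * Matrix.diagonal (fun i => (a (σ i) : ℂ)) * star U := by
  obtain ⟨σ, hσ⟩ := (eigenvalues hA).exists_perm ha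
  refine ⟨hA.eigenvectorUnitary, σ, Unitary.coe_star_mul_self _, Unitary.coe_mul_star_self _, ?_⟩
  conv_lhs => rw [hA.spectral_theorem, Unitary.conjStarAlgAut_apply]
  simp only [Function.comp_def, hσ]
  rfl

/-- Interlacing sequences are realized by a rank-one perturbation. -/
theorem exists_add_vecMulVec (hA : A.IsHermitian) (ha : HasSpectrum A a)
    (hle : ∀ i, a i ≤ b i) (hlt : ∀ j k, j < k → b k ≤ a j) :
    ∃ φ : Fin M → ℂ, HasSpectrum (A + Matrix.vecMulVec φ (star φ)) b := by
  obtain ⟨c, hc, h⟩ := exists_nonneg_prod_sub_eq univ a b (fun i _ => hle i)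
    (fun j _ k _ => hlt j k)
  obtain ⟨U, σ, hUU, -, hA'⟩ := ha.exists_unitary_diagonalization hA
  set ψ : Fin M → ℂ := fun i => (√(c (σ i)) : ℝ) with hψ
  have hψ2 : ∀ i, ψ i * star ψ i = (c (σ i) : ℂ) := fun i => by
    simp only [hψ, Pi.star_apply, RCLike.star_def, Complex.conj_ofReal]
    rw [← Complex.ofReal_mul, Real.mul_self_sqrt (hc _)]
  refine ⟨U *ᵥ ψ, ?_⟩
  have hsum : A + Matrix.vecMulVec (U *ᵥ ψ) (star (U *ᵥ ψ)) =
      U * (Matrix.diagonal (fun i => (a (σ i) : ℂ)) + Matrix.vecMulVec ψ (star ψ)) * star U := by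
    rw [mul_add, add_mul, ← hA', Matrix.mul_vecMulVec, Matrix.vecMulVec_mul, Matrix.star_mulVec,
      Matrix.star_eq_conjTranspose]
  rw [HasSpectrum, hsum, Matrix.charpoly_mul_comm, ← mul_assoc, hUU, one_mul,
    charpoly_diagonal_add_vecMulVec]
  have h' := congrArg (Polynomial.map Complex.ofRealHom) h
  simp only [Polynomial.map_sub, Polynomial.map_prod, Polynomial.map_sum, Polynomial.map_mul,
    Polynomial.map_X, Polynomial.map_C, Complex.ofRealHom_eq_coe] at h'
  simp only [hψ2]
  rw [h', Equiv.prod_comp σ fun i => Polynomial.X - Polynomial.C (a i : ℂ),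
    sum_mul_prod_erase_comp_perm σ (fun i => Polynomial.C (c i : ℂ))
      (fun i => Polynomial.X - Polynomial.C (a i : ℂ))]

/-- In suitable orthonormal coordinates a Hermitian form is diagonal. -/
theorem exists_quadForm_eq (hA : A.IsHermitian) (ha : HasSpectrum A a) :
    ∃ U : Matrix (Fin M) (Fin M) ℂ, ∀ x : Fin M → ℂ,
      (∑ i, ‖(U *ᵥ x) i‖ ^ 2 = ∑ i, ‖x i‖ ^ 2) ∧
      (star x ⬝ᵥ (A *ᵥ x)).re = ∑ i, a i * ‖(U *ᵥ x) i‖ ^ 2 := by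
  obtain ⟨U, σ, -, hUU, hA'⟩ := ha.exists_unitary_diagonalization hA
  refine ⟨(star U).submatrix σ.symm id, fun x => ?_⟩
  set y := star U *ᵥ x with hy
  have hxy : ∀ i, ((star U).submatrix σ.symm id *ᵥ x) i = y (σ.symm i) := fun i => rfl
  have hstar : star y = star x ᵥ* U := by
    rw [hy, Matrix.star_mulVec, ← Matrix.star_eq_conjTranspose, star_star]
  simp only [hxy]
  rw [← Equiv.sum_comp σ, ← Equiv.sum_comp σ (fun i => a i * _)]
  simp only [Equiv.symm_apply_apply]
  constructor
  · have : y ⬝ᵥ star y = x ⬝ᵥ star x := by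
      rw [dotProduct_comm, hstar, ← Matrix.dotProduct_mulVec, hy, Matrix.mulVec_mulVec, hUU,
        Matrix.one_mulVec, dotProduct_comm]
    rw [dotProduct_star_self_eq_sum_norm_sq, dotProduct_star_self_eq_sum_norm_sq] at this
    exact_mod_cast this
  · have : star x ⬝ᵥ (A *ᵥ x) = ((∑ i, a (σ i) * ‖y i‖ ^ 2 : ℝ) : ℂ) := by
      rw [hA', ← Matrix.mulVec_mulVec, ← Matrix.mulVec_mulVec, Matrix.dotProduct_mulVec, ← hstar,
        ← hy, Complex.ofReal_sum]
      refine Finset.sum_congr rfl fun i _ => ?_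
      rw [Matrix.mulVec_diagonal, Complex.ofReal_mul, Complex.ofReal_pow, ← Complex.mul_conj',
        Pi.star_apply, RCLike.star_def]
      ring
    rw [this, Complex.ofReal_re]

/-- Comparison of eigenvalues for Hermitian forms that are comparable on a subspace of
codimension at most `r`. -/
theorem le_of_quadForm_le (hA : A.IsHermitian) (hB : B.IsHermitian) (ha : HasSpectrum A a)
    (hb : HasSpectrum B b) (ha' : Antitone a) (hb' : Antitone b) {r : ℕ}
    (W : Matrix (Fin r) (Fin M) ℂ)
    (hW : ∀ x, W *ᵥ x = 0 → (star x ⬝ᵥ (A *ᵥ x)).re ≤ (star x ⬝ᵥ (B *ᵥ x)).re)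
    (p q : Fin M) (hpq : (q : ℕ) + r ≤ p) : a p ≤ b q := by
  obtain ⟨U, hU⟩ := ha.exists_quadForm_eq hA
  obtain ⟨V, hV⟩ := hb.exists_quadForm_eq hB
  let T : Matrix ({i // p < i} ⊕ {i // i < q} ⊕ Fin r) (Fin M) ℂ :=
    Sum.elim (fun i => U i) (Sum.elim (fun i => V i) W)
  have hker : LinearMap.ker T.mulVecLin ≠ ⊥ := by
    refine LinearMap.ker_ne_bot_of_finrank_lt ?_
    simp only [Module.finrank_fintype_fun_eq_card, Fintype.card_sum, Fintype.card_subtype,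
      Fintype.card_fin]
    rw [Finset.filter_lt_eq_Ioi, Finset.filter_gt_eq_Iio, Fin.card_Ioi, Fin.card_Iio]
    omega
  obtain ⟨x, hx, hx0⟩ := Submodule.exists_mem_ne_zero_of_ne_bot hker
  have hTx : ∀ k, (T *ᵥ x) k = 0 := congrFun hx
  have hUx : ∀ i, p < i → (U *ᵥ x) i = 0 := fun i hi => hTx (Sum.inl ⟨i, hi⟩)
  have hVx : ∀ i, i < q → (V *ᵥ x) i = 0 := fun i hi => hTx (Sum.inr (Sum.inl ⟨i, hi⟩))
  have hWx : W *ᵥ x = 0 := funext fun k => hTx (Sum.inr (Sum.inr k))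
  have hpos : 0 < ∑ i, ‖x i‖ ^ 2 := by
    obtain ⟨i, hi⟩ := Function.ne_iff.mp hx0
    exact Finset.sum_pos' (fun i _ => by positivity) ⟨i, mem_univ i, by
      have : 0 < ‖x i‖ := norm_pos_iff.mpr hi
      positivity⟩
  refine le_of_mul_le_mul_right ?_ hpos
  calc a p * ∑ i, ‖x i‖ ^ 2 = ∑ i, a p * ‖(U *ᵥ x) i‖ ^ 2 := by
        rw [← (hU x).1, Finset.mul_sum]
    _ ≤ ∑ i, a i * ‖(U *ᵥ x) i‖ ^ 2 := by
        refine Finset.sum_le_sum fun i _ => ?_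
        rcases lt_or_ge p i with hi | hi
        · simp [hUx i hi]
        · exact mul_le_mul_of_nonneg_right (ha' hi) (by positivity)
    _ = (star x ⬝ᵥ (A *ᵥ x)).re := (hU x).2.symm
    _ ≤ (star x ⬝ᵥ (B *ᵥ x)).re := hW x hWx
    _ = ∑ i, b i * ‖(V *ᵥ x) i‖ ^ 2 := (hV x).2
    _ ≤ ∑ i, b q * ‖(V *ᵥ x) i‖ ^ 2 := by
        refine Finset.sum_le_sum fun i _ => ?_
        rcases lt_or_ge i q with hi | hi
        · simp [hVx i hi]
        · exact mul_le_mul_of_nonneg_right (hb' hi) (by positivity)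
    _ = b q * ∑ i, ‖x i‖ ^ 2 := by rw [← (hV x).1, Finset.mul_sum]

theorem quadForm_add_vecMulVec (A : Matrix (Fin M) (Fin M) ℂ) (φ x : Fin M → ℂ) :
    (star x ⬝ᵥ ((A + Matrix.vecMulVec φ (star φ)) *ᵥ x)).re =
      (star x ⬝ᵥ (A *ᵥ x)).re + ‖star φ ⬝ᵥ x‖ ^ 2 := by
  have h : star x ⬝ᵥ φ = star (star φ ⬝ᵥ x) := by
    rw [Matrix.star_dotProduct, dotProduct_comm]
  rw [Matrix.add_mulVec, dotProduct_add, Complex.add_re, Matrix.vecMulVec_mulVec]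
  congr 1
  rw [dotProduct_smul, h, op_smul_eq_mul, RCLike.star_def, Complex.conj_mul', ← Complex.ofReal_pow, Complex.ofReal_re]

theorem le_add_vecMulVec {φ : Fin M → ℂ} (hA : A.IsHermitian) (ha : HasSpectrum A a)
    (hb : HasSpectrum (A + Matrix.vecMulVec φ (star φ)) b) (ha' : Antitone a)
    (hb' : Antitone b) (i : Fin M) : a i ≤ b i := by
  refine le_of_quadForm_le hA (hA.add (isHermitian_vecMulVec_self_star φ)) ha hb ha' hb'
    (r := 0) (Matrix.of Fin.elim0) (fun x _ => ?_) i i le_rfl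
  rw [quadForm_add_vecMulVec]
  exact le_add_of_nonneg_right (by positivity)

theorem add_vecMulVec_le {φ : Fin M → ℂ} (hA : A.IsHermitian) (ha : HasSpectrum A a)
    (hb : HasSpectrum (A + Matrix.vecMulVec φ (star φ)) b) (ha' : Antitone a)
    (hb' : Antitone b) {j k : Fin M} (hjk : j < k) : b k ≤ a j := by
  refine le_of_quadForm_le (hA.add (isHermitian_vecMulVec_self_star φ)) hA hb ha hb' ha'
    (r := 1) (Matrix.of fun _ => star φ) (fun x hx => ?_) k j hjk
  have h0 : star φ ⬝ᵥ x = 0 := congrFun hx 0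
  rw [quadForm_add_vecMulVec, h0]
  simp

end HasSpectrum

theorem sum_Icc_one_eq_sum_fin (M : ℕ) (f : ℕ → ℝ) :
    ∑ m ∈ Finset.Icc 1 M, f m = ∑ i : Fin M, f ((i : ℕ) + 1) := by
  rw [Fin.sum_univ_eq_sum_range (fun i => f (i + 1)) M, Finset.range_eq_Ico,
    Finset.sum_Ico_add' f 0 M 1]
  rfl

theorem antitone_fin_of_succ_le {M : ℕ} {f : ℕ → ℝ}
    (h : ∀ m, 1 ≤ m → m < M → f (m + 1) ≤ f m) :
    Antitone fun i : Fin M => f ((i : ℕ) + 1) := by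
  rintro ⟨i, hi⟩ ⟨j, hj⟩ hij
  have hij' : i ≤ j := hij
  clear hij
  induction j, hij' using Nat.le_induction with
  | base => exact le_rfl
  | succ j hij ih => exact (h (j + 1) (by omega) hj).trans (ih (by omega))

open HasSpectrum in
theorem IsEigensteps.isCompletion {M N : ℕ} {α lam μ : ℕ → ℝ} {L : ℕ → ℕ → ℝ}
    (hlam : NonnegNonincrOn M lam) (hL : IsEigensteps M N α lam μ L) :
    IsCompletion M N α μ lam := by
  obtain ⟨hmono, hzero, hlast, htrace, hlt, -, hle⟩ := hL
  set D : Matrix (Fin M) (Fin M) ℂ := Matrix.diagonal fun i => (α ((i : ℕ) + 1) : ℂ) with hD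
  have hDs : HasSpectrum D fun i => α ((i : ℕ) + 1) := HasSpectrum.diagonal _
  have hDh : D.IsHermitian := by
    rw [hD, Matrix.isHermitian_diagonal_iff]
    exact fun i => Complex.conj_ofReal _
  have herm : ∀ {P : ℕ} (φ : Fin P → Fin M → ℂ),
      (D + ∑ n, Matrix.vecMulVec (φ n) (star (φ n))).IsHermitian := fun φ =>
    hDh.add (isHermitian_sum_vecMulVec univ φ)
  have key : ∀ P, P ≤ N → ∃ φ : Fin P → Fin M → ℂ,
      HasSpectrum (D + ∑ n, Matrix.vecMulVec (φ n) (star (φ n))) (fun i => L P ((i : ℕ) + 1)) ∧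
      ∀ n : Fin P, ∑ i, ‖φ n i‖ ^ 2 = μ ((n : ℕ) + 1) := by
    intro P
    induction P with
    | zero =>
      refine fun _ => ⟨Fin.elim0, ?_, fun n => n.elim0⟩
      have : (fun i : Fin M => L 0 ((i : ℕ) + 1)) = fun i : Fin M => α ((i : ℕ) + 1) :=
        funext fun i => hzero _ (by omega) (by omega)
      simpa [this] using hDs
    | succ P ih =>
      intro hP
      obtain ⟨φ, hφ, hμ⟩ := ih (by omega)
      obtain ⟨ψ, hψ⟩ := hφ.exists_add_vecMulVec (b := fun i => L (P + 1) ((i : ℕ) + 1)) (herm φ)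
        (fun i => hle (P + 1) _ (by omega) hP (by omega) (by omega))
        (fun j k hjk => by
          have h1 := antitone_fin_of_succ_le (fun m => hmono (P + 1) m hP)
            (a := (⟨j + 1, by omega⟩ : Fin M)) (b := k) hjk
          exact h1.trans (hlt (P + 1) (j + 1) (by omega) hP (by omega) (by omega)))
      have hnorm := hφ.sum_add_vecMulVec hψ
      rw [← sum_Icc_one_eq_sum_fin, ← sum_Icc_one_eq_sum_fin, htrace _ hP, htrace _ (by omega),
        Finset.sum_Icc_succ_top (by omega)] at hnorm
      refine ⟨Fin.snoc φ ψ, ?_, fun n => ?_⟩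
      · simpa [Fin.sum_univ_castSucc, add_assoc] using hψ
      · induction n using Fin.lastCases with
        | last => simp only [Fin.snoc_last, Fin.val_last]; linarith
        | cast n => simpa using hμ n
  obtain ⟨φ, hφ, hμ⟩ := key N le_rfl
  have hfin : (fun i : Fin M => L N ((i : ℕ) + 1)) = fun i : Fin M => lam ((i : ℕ) + 1) :=
    funext fun i => hlast _ (by omega) (by omega)
  rw [hfin] at hφ
  obtain ⟨σ, hσ⟩ := (eigenvalues hDh).exists_perm hDs
  obtain ⟨τ, hτ⟩ := (eigenvalues (herm φ)).exists_perm hφ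
  exact ⟨hlam, D, hDh, φ, herm φ, σ, τ, hσ, hμ, hτ⟩

open HasSpectrum in
theorem IsCompletion.exists_isEigensteps {M N : ℕ} {α lam μ : ℕ → ℝ}
    (hα : NonnegNonincrOn M α) (h : IsCompletion M N α μ lam) :
    ∃ L : ℕ → ℕ → ℝ, IsEigensteps M N α lam μ L := by
  obtain ⟨hlam, A, hA, φ, hB, σ, τ, hσ, hμ, hτ⟩ := h
  let ψ : ℕ → Fin M → ℂ := fun n => if h : n < N then φ ⟨n, h⟩ else 0
  let S : ℕ → Matrix (Fin M) (Fin M) ℂ := fun P =>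
    A + ∑ n ∈ Finset.range P, Matrix.vecMulVec (ψ n) (star (ψ n))
  have hS : ∀ P, (S P).IsHermitian := fun P =>
    hA.add (isHermitian_sum_vecMulVec _ ψ)
  have hsucc : ∀ P, S (P + 1) = S P + Matrix.vecMulVec (ψ P) (star (ψ P)) := fun P => by
    simp only [S, Finset.sum_range_succ, add_assoc]
  choose l hanti hspec using fun P => exists_antitone (hS P)
  have hspec' : ∀ P, HasSpectrum (S P + Matrix.vecMulVec (ψ P) (star (ψ P))) (l (P + 1)) :=
    fun P => hsucc P ▸ hspec (P + 1)
  have hle : ∀ P i, l P i ≤ l (P + 1) i := fun P i =>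
    (hspec P).le_add_vecMulVec (hS P) (hspec' P) (hanti P) (hanti (P + 1)) i
  have hlt : ∀ P (j k : Fin M), j < k → l (P + 1) k ≤ l P j := fun P j k =>
    (hspec P).add_vecMulVec_le (hS P) (hspec' P) (hanti P) (hanti (P + 1))
  have hSN : S N = A + ∑ n : Fin N, Matrix.vecMulVec (φ n) (star (φ n)) := by
    simp only [S, Finset.sum_range, ψ, Fin.is_lt, dite_true]
  have h0 : l 0 = fun i : Fin M => α ((i : ℕ) + 1) := by
    obtain ⟨ρ, hρ⟩ := (hspec 0).exists_perm (b := hA.eigenvalues)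
      (by simpa [S] using eigenvalues hA)
    exact (hanti 0).eq_of_comp_perm (antitone_fin_of_succ_le hα.2) (ρ.trans σ)
      fun i => by rw [hρ, hσ]; rfl
  have hN : l N = fun i : Fin M => lam ((i : ℕ) + 1) := by
    obtain ⟨ρ, hρ⟩ := (hspec N).exists_perm (b := hB.eigenvalues) (by rw [hSN]; exact eigenvalues hB)
    exact (hanti N).eq_of_comp_perm (antitone_fin_of_succ_le hlam.2) (ρ.trans τ)
      fun i => by rw [hρ, hτ]; rfl
  have hnonneg : ∀ P i, 0 ≤ l P i := fun P => by
    induction P with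
    | zero => exact fun i => (hα.1 _ (by omega) (by omega)).trans_eq (congrFun h0 i).symm
    | succ P ih => exact fun i => (ih i).trans (hle P i)
  have htrace : ∀ P, P ≤ N → ∑ i, l P i =
      ∑ m ∈ Finset.Icc 1 M, α m + ∑ n ∈ Finset.Icc 1 P, μ n := fun P => by
    induction P with
    | zero => intro _; simp [h0, sum_Icc_one_eq_sum_fin]
    | succ P ih =>
      intro hP
      have hPN : P < N := hP
      rw [(hspec P).sum_add_vecMulVec (hspec' P), ih (by omega),
        Finset.sum_Icc_succ_top (by omega), add_assoc]
      simp only [ψ, hPN, dite_true, hμ]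
  let L : ℕ → ℕ → ℝ := fun P m => if h : m - 1 < M then l P ⟨m - 1, h⟩ else 0
  have hL : ∀ P (i : Fin M), L P ((i : ℕ) + 1) = l P i := fun P i => by simp [L]
  have hL' : ∀ P m (h1 : 1 ≤ m) (h2 : m ≤ M), L P m = l P ⟨m - 1, by omega⟩ := fun P m h1 h2 =>
    dif_pos (by omega)
  refine ⟨L, ?_, ?_, ?_, ?_, ?_, ?_, ?_⟩
  · intro P m _ h1 h2
    rw [hL' P m h1 h2.le, hL' P (m + 1) (by omega) h2]
    exact hanti P (Fin.mk_le_mk.mpr (by omega))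
  · intro m h1 h2
    rw [hL' 0 m h1 h2, h0]
    simp [h1]
  · intro m h1 h2
    rw [hL' N m h1 h2, hN]
    simp [h1]
  · intro P hP
    simp only [sum_Icc_one_eq_sum_fin M (L P), hL, htrace P hP]
  · intro P m hP1 _ h1 h2
    obtain ⟨P, rfl⟩ := Nat.exists_eq_add_of_le' hP1
    rw [hL' _ m h1 h2.le, hL' _ (m + 1) (by omega) h2]
    exact hlt P _ _ (Fin.mk_lt_mk.mpr (by omega))
  · intro P _ _
    dsimp only [L]
    split_ifs
    exacts [hnonneg _ _, le_rfl]
  · intro P m hP1 _ h1 h2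
    obtain ⟨P, rfl⟩ := Nat.exists_eq_add_of_le' hP1
    rw [hL' _ m h1 h2, hL' _ m h1 h2]
    exact hle P _

/-- `lam` is an `(α,μ)`-completion if and only if there exists a sequence of eigensteps
from `α` to `lam` with lengths `μ`. -/
theorem completion_iff_eigensteps (M N : ℕ) (α lam μ : ℕ → ℝ)
    (hα : NonnegNonincrOn M α) (hlam : NonnegNonincrOn M lam)
    (hμ : NonnegNonincrOn N μ) :
    IsCompletion M N α μ lam ↔ ∃ L : ℕ → ℕ → ℝ, IsEigensteps M N α lam μ L := by
  exact ⟨fun h => h.exists_isEigensteps hα, fun ⟨_, hL⟩ => hL.isCompletion hlam⟩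
end

section
/- Let α = (α_1,…,α_M), λ = (λ_1,…,λ_M) and μ = (μ_1,…,μ_N) be nonnegative nonincreasing real sequences and let (λ_{P;m}) be a sequence of eigensteps from α to λ with lengths μ. Fix any β ≥ max{0, μ_1 − α_M} and define, for P = 0,…,M+N and m = 1,…,M: κ_{P;m} := 0 if P < m, κ_{P;m} := α_m + β if m ≤ P ≤ M, and κ_{P;m} := λ_{P−M;m} + β if P > M; also define ν_n := α_n + β for n = 1,…,M and ν_n := μ_{n−M} for n = M+1,…,M+N. Then (ν_n)_{n=1}^{M+N} is nonnegative and nonincreasing, and (κ_{P;m}) is a sequence of eigensteps from the zero sequence (0,…,0) (of length M) to (λ_1+β,…,λ_M+β) with lengths (ν_1,…,ν_{M+N}). -/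
open Finset

/-- Lifting a sequence of eigensteps from `α` to `lam` with lengths `μ` to a sequence of
eigensteps from the zero sequence to `lam + β` with lengths `ν`, where
`ν n = α n + β` for `n = 1, …, M` and `ν n = μ (n - M)` for `n = M+1, …, M+N`, and
`κ P m = 0` for `P < m`, `κ P m = α m + β` for `m ≤ P ≤ M`, and
`κ P m = L (P - M) m + β` for `P > M`. -/
theorem eigensteps_lift (M N : ℕ) (hM : 0 < M) (hN : 0 < N) (α lam μ : ℕ → ℝ)
    (hα : NonnegNonincrOn M α) (hlam : NonnegNonincrOn M lam)
    (hμ : NonnegNonincrOn N μ)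
    (L : ℕ → ℕ → ℝ) (hL : IsEigensteps M N α lam μ L)
    (β : ℝ) (hβ : max 0 (μ 1 - α M) ≤ β)
    (ν : ℕ → ℝ) (hν : ∀ n, ν n = if n ≤ M then α n + β else μ (n - M))
    (κ : ℕ → ℕ → ℝ)
    (hκ : ∀ P m, κ P m =
      if P < m then 0 else if P ≤ M then α m + β else L (P - M) m + β) :
    NonnegNonincrOn (M + N) ν ∧
      IsEigensteps M (M + N) (fun _ => 0) (fun m => lam m + β) ν κ := by
  obtain ⟨hα0, hα1⟩ := hα
  obtain ⟨hμ0, hμ1⟩ := hμ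
  obtain ⟨hdec, hzero, hlast, htr, hint, hnn, hmono⟩ := hL
  have hβ0 : 0 ≤ β := (le_max_left _ _).trans hβ
  have hβ1 : μ 1 - α M ≤ β := (le_max_right _ _).trans hβ
  have hν_le : ∀ n, n ≤ M → ν n = α n + β := fun n hn => by rw [hν, if_pos hn]
  have hν_gt : ∀ n, 1 ≤ n → ν (M + n) = μ n := fun n hn => by
    rw [hν, if_neg (by omega), Nat.add_sub_cancel_left]
  have hκ_lt : ∀ P m, P < m → κ P m = 0 := fun P m h => by rw [hκ, if_pos h]
  have hκ_le : ∀ P m, m ≤ P → P ≤ M → κ P m = α m + β := fun P m h h' => by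
    rw [hκ, if_neg (by omega), if_pos h']
  have hκ_add : ∀ Q m, 1 ≤ m → m ≤ M → κ (M + Q) m = L Q m + β := by
    intro Q m h1 hm
    rcases Nat.eq_zero_or_pos Q with rfl | hQ
    · rw [hκ_le _ _ (by omega) (by omega), hzero m h1 hm]
    · rw [hκ, if_neg (by omega), if_neg (by omega), Nat.add_sub_cancel_left]
  have hκ_nonneg : ∀ P m, P ≤ M → 1 ≤ m → m ≤ M → 0 ≤ κ P m := by
    intro P m hP h1 hm
    rcases lt_or_ge P m with h | h
    · rw [hκ_lt P m h]
    · rw [hκ_le P m h hP]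
      linarith [hα0 m h1 hm]
  have htrace_le : ∀ P, P ≤ M →
      ∑ m ∈ Finset.Icc 1 M, κ P m = ∑ n ∈ Finset.Icc 1 P, ν n := by
    intro P hP
    rw [← Finset.sum_subset (Finset.Icc_subset_Icc_right hP)]
    · refine Finset.sum_congr rfl fun m hm => ?_
      rw [Finset.mem_Icc] at hm
      rw [hκ_le P m hm.2 hP, hν_le m (hm.2.trans hP)]
    · intro m hm hm'
      rw [Finset.mem_Icc] at hm hm'
      exact hκ_lt P m (by omega)
  have htrace_add : ∀ Q, Q ≤ N →
      ∑ m ∈ Finset.Icc 1 M, κ (M + Q) m = ∑ n ∈ Finset.Icc 1 (M + Q), ν n := by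
    have hsum : ∀ Q, ∑ m ∈ Finset.Icc 1 M, κ (M + Q) m
        = ∑ m ∈ Finset.Icc 1 M, L Q m + ∑ m ∈ Finset.Icc 1 M, β := fun Q => by
      rw [← Finset.sum_add_distrib]
      refine Finset.sum_congr rfl fun m hm => ?_
      rw [Finset.mem_Icc] at hm
      exact hκ_add Q m hm.1 hm.2
    intro Q
    induction Q with
    | zero => exact fun _ => htrace_le M le_rfl
    | succ Q ih =>
      intro hQ
      have ih' := ih (by omega)
      rw [hsum, htr Q (by omega)] at ih'
      rw [hsum, htr (Q + 1) hQ, Finset.sum_Icc_succ_top (by omega), ← add_assoc M Q 1,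
        Finset.sum_Icc_succ_top (by omega), ← ih', add_assoc M Q 1, hν_gt (Q + 1) (by omega)]
      ring
  refine ⟨⟨?_, ?_⟩, ?_, ?_, ?_, ?_, ?_, ?_, ?_⟩
  · intro n h1 hn
    rcases le_or_gt n M with h | h
    · rw [hν_le n h]
      linarith [hα0 n h1 h]
    · obtain ⟨k, rfl⟩ := Nat.exists_eq_add_of_lt h
      rw [add_assoc, hν_gt _ (by omega)]
      exact hμ0 _ (by omega) (by omega)
  · intro n h1 hn
    rcases lt_trichotomy n M with h | rfl | h
    · rw [hν_le n h.le, hν_le (n + 1) h]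
      linarith [hα1 n h1 h]
    · rw [hν_le n le_rfl, hν_gt 1 le_rfl]
      linarith
    · obtain ⟨k, rfl⟩ := Nat.exists_eq_add_of_lt h
      rw [add_assoc M k 1, add_assoc M, hν_gt _ (by omega), hν_gt _ (by omega)]
      exact hμ1 _ (by omega) (by omega)
  · intro P m hP h1 hm
    rcases le_total P M with h | h
    · rcases lt_or_ge P (m + 1) with h' | h'
      · rw [hκ_lt P _ h']
        exact hκ_nonneg P m h h1 hm.le
      · rw [hκ_le P _ h' h, hκ_le P m (by omega) h]
        linarith [hα1 m h1 hm]
    · obtain ⟨Q, rfl⟩ := Nat.exists_eq_add_of_le h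
      rw [hκ_add Q _ (by omega) hm, hκ_add Q m h1 hm.le]
      linarith [hdec Q m (by omega) h1 hm]
  · exact fun m h1 _ => hκ_lt 0 m h1
  · intro m h1 hm
    rw [hκ_add N m h1 hm, hlast m h1 hm]
  · intro P hP
    rw [Finset.sum_const_zero, zero_add]
    rcases le_total P M with h | h
    · exact htrace_le P h
    · obtain ⟨Q, rfl⟩ := Nat.exists_eq_add_of_le h
      exact htrace_add Q (by omega)
  · intro P m hP1 hP h1 hm
    rcases le_or_gt P M with h | h
    · rcases lt_or_ge P (m + 1) with h' | h'
      · rw [hκ_lt P _ h']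
        exact hκ_nonneg _ m (by omega) h1 hm.le
      · rw [hκ_le P _ h' h, hκ_le (P - 1) m (by omega) (by omega)]
        linarith [hα1 m h1 hm]
    · obtain ⟨Q, rfl⟩ := Nat.exists_eq_add_of_le h.le
      rw [Nat.add_sub_assoc (by omega), hκ_add Q _ (by omega) hm, hκ_add _ m h1 hm.le]
      linarith [hint Q m (by omega) (by omega) h1 hm]
  · intro P hP1 hP
    rcases le_or_gt P M with h | h
    · exact hκ_nonneg _ M (by omega) hM le_rfl
    · obtain ⟨Q, rfl⟩ := Nat.exists_eq_add_of_le h.le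
      rw [Nat.add_sub_assoc (by omega), hκ_add _ M hM le_rfl]
      linarith [hnn Q (by omega) (by omega)]
  · intro P m hP1 hP h1 hm
    rcases le_or_gt P M with h | h
    · rcases lt_or_ge (P - 1) m with h' | h'
      · rw [hκ_lt _ m h']
        exact hκ_nonneg P m h h1 hm
      · rw [hκ_le _ m h' (by omega), hκ_le P m (by omega) h]
    · obtain ⟨Q, rfl⟩ := Nat.exists_eq_add_of_le h.le
      rw [Nat.add_sub_assoc (by omega), hκ_add _ m h1 hm, hκ_add Q m h1 hm]
      linarith [hmono Q m (by omega) (by omega) h1 hm]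
end

section
/- Let α = (α_1,…,α_M), λ = (λ_1,…,λ_M) and μ = (μ_1,…,μ_N) be nonnegative nonincreasing real sequences. If there exists a sequence of eigensteps from α to λ with lengths μ, then λ_m ≥ α_m for all m = 1,…,M, Σ_{m=1}^{M} (λ_m − α_m) = Σ_{n=1}^{N} μ_n, and Σ_{m=j}^{M} (λ_m − α_{m−j+1})^+ ≤ Σ_{n=j}^{N} μ_n for all j = 1,…,M (empty sums are 0). -/
open Finset

theorem NonnegNonincrOn.le_of_le_s6 {M : ℕ} {a : ℕ → ℝ} (ha : NonnegNonincrOn M a) {i k : ℕ}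
    (hi : 1 ≤ i) (hik : i ≤ k) (hk : k ≤ M) : a k ≤ a i := by
  induction k, hik using Nat.le_induction with
  | base => exact le_rfl
  | succ k hik ih => exact (ha.2 k (by omega) (by omega)).trans (ih (by omega))

theorem IsEigensteps.le_of_le_s6 {M N : ℕ} {α lam μ : ℕ → ℝ} {L : ℕ → ℕ → ℝ}
    (hL : IsEigensteps M N α lam μ L) {P Q m : ℕ} (hPQ : P ≤ Q) (hQ : Q ≤ N)
    (hm : 1 ≤ m) (hmM : m ≤ M) : L P m ≤ L Q m := by
  obtain ⟨-, -, -, -, -, -, hup⟩ := hL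
  induction Q, hPQ using Nat.le_induction with
  | base => exact le_rfl
  | succ Q hPQ ih => exact (ih (by omega)).trans (hup (Q + 1) m (by omega) hQ hm hmM)

/-- Iterating the interlacing inequality `P` times bounds the shifted `P`-th row by the
initial one. -/
theorem IsEigensteps.add_le {M N : ℕ} {α lam μ : ℕ → ℝ} {L : ℕ → ℕ → ℝ}
    (hL : IsEigensteps M N α lam μ L) {P m : ℕ} (hP : P ≤ N)
    (hm : 1 ≤ m) (hmM : m + P ≤ M) : L P (m + P) ≤ α m := by
  obtain ⟨-, h0, -, -, hdown, -, -⟩ := hL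
  induction P with
  | zero => exact (h0 m hm hmM).le
  | succ P ih =>
    exact (hdown (P + 1) (m + P) (by omega) hP (by omega) (by omega)).trans
      (ih (by omega) (by omega))

/-- If a sequence of eigensteps from `α` to `lam` with lengths `μ` exists, then `lam`
dominates `α` and the generalized Schur-Horn conditions hold. -/
theorem eigensteps_necessary (M N : ℕ) (α lam μ : ℕ → ℝ)
    (hα : NonnegNonincrOn M α) (hlam : NonnegNonincrOn M lam)
    (hμ : NonnegNonincrOn N μ)
    (L : ℕ → ℕ → ℝ) (hL : IsEigensteps M N α lam μ L) :
    (∀ m, 1 ≤ m → m ≤ M → α m ≤ lam m) ∧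
      (∑ m ∈ Icc 1 M, (lam m - α m) = ∑ n ∈ Icc 1 N, μ n) ∧
      ∀ j, 1 ≤ j → j ≤ M →
        ∑ m ∈ Icc j M, max (lam m - α (m - j + 1)) 0 ≤ ∑ n ∈ Icc j N, μ n := by
  have h0 := hL.2.1
  have hN := hL.2.2.1
  have htr := hL.2.2.2.1
  have hlamsum : ∑ m ∈ Icc 1 M, lam m = ∑ m ∈ Icc 1 M, α m + ∑ n ∈ Icc 1 N, μ n := by
    rw [← htr N le_rfl]
    refine sum_congr rfl fun m hm => ?_
    rw [mem_Icc] at hm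
    exact (hN m hm.1 hm.2).symm
  refine ⟨fun m hm hmM => ?_, ?_, fun j hj hjM => ?_⟩
  · rw [← h0 m hm hmM, ← hN m hm hmM]
    exact hL.le_of_le_s6 (Nat.zero_le N) le_rfl hm hmM
  · rw [sum_sub_distrib, hlamsum, add_sub_cancel_left]
  · rcases le_or_gt j N with hjN | hjN
    · obtain ⟨k, rfl⟩ : ∃ k, j = k + 1 := ⟨j - 1, by omega⟩
      have hmono : ∀ m, 1 ≤ m → m ≤ M → L k m ≤ lam m := fun m hm hmM => by
        rw [← hN m hm hmM]
        exact hL.le_of_le_s6 (by omega) le_rfl hm hmM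
      have hsplit : ∑ n ∈ Icc 1 N, μ n = ∑ n ∈ Icc 1 k, μ n + ∑ n ∈ Icc (k + 1) N, μ n := by
        rw [← sum_union (disjoint_left.2 fun x hx hx' => by
          rw [mem_Icc] at hx hx'; omega)]
        congr 1
        ext x
        simp only [mem_union, mem_Icc]
        omega
      calc ∑ m ∈ Icc (k + 1) M, max (lam m - α (m - (k + 1) + 1)) 0
          ≤ ∑ m ∈ Icc (k + 1) M, (lam m - L k m) := by
            refine sum_le_sum fun m hm => ?_
            rw [mem_Icc] at hm
            have h := hL.add_le (P := k) (m := m - (k + 1) + 1) (by omega) (by omega) (by omega)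
            rw [show m - (k + 1) + 1 + k = m by omega] at h
            exact max_le (by linarith) (sub_nonneg.2 (hmono m (by omega) hm.2))
        _ ≤ ∑ m ∈ Icc 1 M, (lam m - L k m) := by
            refine sum_le_sum_of_subset_of_nonneg (Icc_subset_Icc_left hj) fun m hm _ => ?_
            rw [mem_Icc] at hm
            exact sub_nonneg.2 (hmono m hm.1 hm.2)
        _ = ∑ n ∈ Icc (k + 1) N, μ n := by
            rw [sum_sub_distrib, hlamsum, htr k (by omega), hsplit]
            ring
    · rw [Icc_eq_empty_of_lt hjN, sum_empty]
      refine sum_nonpos fun m hm => max_le ?_ le_rfl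
      rw [mem_Icc] at hm
      have h := hL.add_le (P := N) (m := m - N) le_rfl (by omega) (by omega)
      rw [Nat.sub_add_cancel (by omega), hN m (by omega) hm.2] at h
      have h' := hα.le_of_le_s6 (i := m - j + 1) (k := m - N) (by omega) (by omega) (by omega)
      linarith
end

section
/- Let α = (α_1,…,α_M), λ = (λ_1,…,λ_M) and μ = (μ_1,…,μ_N) be nonnegative nonincreasing real sequences with λ_m ≥ α_m for all m, satisfying Σ_{m=1}^{M} (λ_m − α_m) = Σ_{n=1}^{N} μ_n and Σ_{m=j}^{M} (λ_m − α_{m−j+1})^+ ≤ Σ_{n=j}^{N} μ_n for all j = 1,…,M (empty sums are 0). Then there exists a sequence of eigensteps from α to λ with lengths μ. -/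
open Finset

/-- The part of the diagram between `a` and `l` lying at depth at least `j` in its column. The index
`m + 1 - j` is truncated at `0`, so `a 0` acts as an upper bound for `l`. -/
noncomputable def depthArea (M : ℕ) (a l : ℕ → ℝ) (j : ℕ) : ℝ :=
  ∑ m ∈ Icc 1 M, max (l m - a (m + 1 - j)) 0

/-- The sequence obtained from `l` by removing the lowest cell of every column of length greater
than `k` of the diagram between `a` and `l`. -/
noncomputable def removeStrip (a l : ℕ → ℝ) (k m : ℕ) : ℝ :=
  max (l (m + 1)) (min (l m) (a (m - k)))

lemma sum_Icc_succ_eq_of_eq_zero {M : ℕ} {g : ℕ → ℝ} (h1 : g 1 = 0) (hM : g (M + 1) = 0) :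
    ∑ m ∈ Icc 1 M, g (m + 1) = ∑ m ∈ Icc 1 M, g m := by
  have key : ∀ n : ℕ, ∑ m ∈ Icc 1 n, g (m + 1) = ∑ m ∈ Icc 1 n, g m + g (n + 1) - g 1 := by
    intro n
    induction n with
    | zero => simp
    | succ n ih =>
      rw [sum_Icc_succ_top (by omega), sum_Icc_succ_top (by omega), ih]
      ring
  rw [key, h1, hM]
  ring

lemma depthArea_eq_zero {M : ℕ} {a l : ℕ → ℝ} (hl : Antitone l) (h0 : l 0 = a 0) {j : ℕ}
    (hj : M < j) : depthArea M a l j = 0 := by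
  refine sum_eq_zero fun m hm => max_eq_right ?_
  rw [mem_Icc] at hm
  rw [show m + 1 - j = 0 by omega, ← h0]
  linarith [hl (Nat.zero_le m)]

lemma depthArea_one {M : ℕ} {a l : ℕ → ℝ} (hal : a ≤ l) :
    depthArea M a l 1 = ∑ m ∈ Icc 1 M, (l m - a m) :=
  sum_congr rfl fun m _ => max_eq_left (sub_nonneg.2 (hal m))

lemma depthArea_convexCombination_le {M : ℕ} {a x y : ℕ → ℝ} {s t : ℝ} (hs : 0 ≤ s) (ht : 0 ≤ t)
    (hst : s + t = 1) (j : ℕ) :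
    depthArea M a (fun m => s * x m + t * y m) j
      ≤ s * depthArea M a x j + t * depthArea M a y j := by
  unfold depthArea
  rw [mul_sum, mul_sum, ← sum_add_distrib]
  refine sum_le_sum fun m _ => max_le ?_ ?_
  · have hx := mul_le_mul_of_nonneg_left (le_max_left (x m - a (m + 1 - j)) 0) hs
    have hy := mul_le_mul_of_nonneg_left (le_max_left (y m - a (m + 1 - j)) 0) ht
    have : a (m + 1 - j) = s * a (m + 1 - j) + t * a (m + 1 - j) := by rw [← add_mul, hst, one_mul]
    linarith
  · positivity

section RemoveStrip

variable {M : ℕ} {a l : ℕ → ℝ}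

lemma succ_le_removeStrip (k m : ℕ) : l (m + 1) ≤ removeStrip a l k m := le_max_left _ _

lemma removeStrip_le (hl : Antitone l) (k m : ℕ) : removeStrip a l k m ≤ l m :=
  max_le (hl (Nat.le_succ m)) (min_le_left _ _)

lemma le_removeStrip (ha : Antitone a) (hal : a ≤ l) (k : ℕ) : a ≤ removeStrip a l k :=
  fun m => le_max_of_le_right (le_min (hal m) (ha (Nat.sub_le m k)))

lemma removeStrip_zero (hl : Antitone l) (h0 : l 0 = a 0) (k : ℕ) :
    removeStrip a l k 0 = a 0 := by
  have := hl (Nat.le_succ 0)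
  simp only [Nat.succ_eq_add_one] at this
  rw [removeStrip, Nat.zero_sub, h0, min_self, max_eq_right (by linarith)]

lemma sum_max_succ_sub_eq_depthArea (ha0 : 0 ≤ a) (hl : Antitone l) (h0 : l 0 = a 0)
    (hlM : ∀ m, M < m → l m = 0) {j : ℕ} (hj : 1 ≤ j) :
    ∑ m ∈ Icc 1 M, max (l (m + 1) - a (m + 1 - j)) 0 = depthArea M a l (j + 1) := by
  rw [depthArea, ← sum_Icc_succ_eq_of_eq_zero (g := fun m => max (l m - a (m + 1 - (j + 1))) 0)]
  · simp only [Nat.add_sub_add_right]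
  · refine max_eq_right ?_
    rw [show 1 + 1 - (j + 1) = 0 by omega, ← h0]
    linarith [hl (Nat.zero_le 1)]
  · refine max_eq_right ?_
    rw [hlM _ (Nat.lt_succ_self M)]
    simpa using ha0 _

lemma depthArea_removeStrip_of_lt (ha : Antitone a) (ha0 : 0 ≤ a) (hl : Antitone l)
    (h0 : l 0 = a 0) (hlM : ∀ m, M < m → l m = 0) {j k : ℕ} (hkj : k < j) :
    depthArea M a (removeStrip a l k) j = depthArea M a l (j + 1) := by
  rw [← sum_max_succ_sub_eq_depthArea ha0 hl h0 hlM (by omega : 1 ≤ j)]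
  refine sum_congr rfl fun m _ => ?_
  have hle : a (m - k) ≤ a (m + 1 - j) := ha (by omega)
  unfold removeStrip
  grind

lemma depthArea_removeStrip_of_le (ha : Antitone a) (ha0 : 0 ≤ a) (hl : Antitone l)
    (h0 : l 0 = a 0) (hlM : ∀ m, M < m → l m = 0) {j k : ℕ} (hjk : j ≤ k + 1) :
    depthArea M a (removeStrip a l k) j
      = depthArea M a l j - (depthArea M a l (k + 1) - depthArea M a l (k + 2)) := by
  rw [← sum_max_succ_sub_eq_depthArea ha0 hl h0 hlM (by omega : 1 ≤ k + 1)]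
  unfold depthArea
  rw [← sum_sub_distrib, ← sum_sub_distrib]
  refine sum_congr rfl fun m _ => ?_
  have hle : a (m + 1 - j) ≤ a (m + 1 - (k + 1)) := ha (by omega)
  have hlm : l (m + 1) ≤ l m := hl (Nat.le_succ m)
  unfold removeStrip
  rw [show m - k = m + 1 - (k + 1) by omega]
  generalize a (m + 1 - j) = p at *
  generalize a (m + 1 - (k + 1)) = q at *
  grind

end RemoveStrip

lemma exists_convexCombination_of_le_of_le {x y z : ℝ} (hyz : y ≤ z) (hzx : z ≤ x) :
    ∃ s t : ℝ, 0 ≤ s ∧ 0 ≤ t ∧ s + t = 1 ∧ s * x + t * y = z := by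
  have hz : z ∈ segment ℝ x y := by
    rw [segment_symm, segment_eq_Icc (hyz.trans hzx)]
    exact ⟨hyz, hzx⟩
  obtain ⟨s, t, hs, ht, hst, h⟩ := hz
  exact ⟨s, t, hs, ht, hst, h⟩

lemma exists_succ_le_and_le {v : ℕ → ℝ} {z : ℝ} (h0 : z ≤ v 0) (h : ∃ k, v (k + 1) ≤ z) :
    ∃ k, v (k + 1) ≤ z ∧ z ≤ v k := by
  by_contra! hc
  obtain ⟨k, hk⟩ := h
  have hall : ∀ k, z ≤ v k := by
    intro k
    induction k with
    | zero => exact h0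
    | succ k ih => exact le_of_not_gt fun hlt => absurd (hc k hlt.le) (not_lt.2 ih)
  exact absurd (hc k hk) (not_lt.2 (hall k))

/-- One step backwards: the last row `l` can be replaced by an interlacing row `x` whose area is
smaller by `μ (N + 1)`, preserving the hypotheses. -/
lemma exists_previous_row {M N : ℕ} {a l μ : ℕ → ℝ} (ha : Antitone a) (ha0 : 0 ≤ a)
    (hl : Antitone l) (h0 : l 0 = a 0) (hlM : ∀ m, M < m → l m = 0) (hal : a ≤ l)
    (hμ : NonnegNonincrOn (N + 1) μ)
    (heq : ∑ m ∈ Icc 1 M, (l m - a m) = ∑ n ∈ Icc 1 (N + 1), μ n)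
    (hineq : ∀ j, 1 ≤ j → depthArea M a l j ≤ ∑ n ∈ Icc j (N + 1), μ n) :
    ∃ x : ℕ → ℝ, (∀ m, l (m + 1) ≤ x m) ∧ x ≤ l ∧ a ≤ x ∧ x 0 = a 0 ∧
      ∑ m ∈ Icc 1 M, (x m - a m) = ∑ n ∈ Icc 1 N, μ n ∧
      ∀ j, 1 ≤ j → depthArea M a x j ≤ ∑ n ∈ Icc j N, μ n := by
  have hμ1 : μ (N + 1) ≤ μ 1 := by
    have : ∀ n, n ≤ N → μ (n + 1) ≤ μ 1 := by
      intro n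
      induction n with
      | zero => intro _; exact le_rfl
      | succ n ih => intro hn; exact (hμ.2 (n + 1) (by omega) (by omega)).trans (ih (by omega))
    exact this N le_rfl
  have hμ0 : 0 ≤ μ (N + 1) := hμ.1 _ (by omega) le_rfl
  have htop : μ (N + 1) ≤ depthArea M a l 1 - depthArea M a l 2 := by
    have h2 := hineq 2 (by omega)
    have hsplit : ∑ n ∈ Icc 1 (N + 1), μ n = μ 1 + ∑ n ∈ Icc 2 (N + 1), μ n := by
      rw [← add_sum_Ioc_eq_sum_Icc (by omega : 1 ≤ N + 1)]
      rfl
    rw [depthArea_one hal, heq, hsplit]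
    linarith
  obtain ⟨k, hk₂, hk₁⟩ := exists_succ_le_and_le
    (v := fun k => depthArea M a l (k + 1) - depthArea M a l (k + 2)) htop
    ⟨M, by
      rw [depthArea_eq_zero hl h0 (by omega : M < M + 1 + 1),
        depthArea_eq_zero hl h0 (by omega : M < M + 1 + 2)]
      simpa using hμ0⟩
  obtain ⟨s, t, hs, ht, hst, hsum⟩ := exists_convexCombination_of_le_of_le hk₂ hk₁
  have hcomb : ∀ c : ℝ, c = s * c + t * c := fun c => by rw [← add_mul, hst, one_mul]
  set u := removeStrip a l k with hu
  set w := removeStrip a l (k + 1) with hw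
  have hau : a ≤ u := le_removeStrip ha hal k
  have haw : a ≤ w := le_removeStrip ha hal (k + 1)
  have hax : a ≤ fun m => s * u m + t * w m := fun m => by
    have h1 := mul_le_mul_of_nonneg_left (hau m) hs
    have h2 := mul_le_mul_of_nonneg_left (haw m) ht
    have := hcomb (a m)
    simp only
    linarith
  have hsmall : ∀ j, j ≤ k + 1 →
      s * depthArea M a u j + t * depthArea M a w j = depthArea M a l j - μ (N + 1) := by
    intro j hj
    rw [hu, hw, depthArea_removeStrip_of_le ha ha0 hl h0 hlM hj,
      depthArea_removeStrip_of_le ha ha0 hl h0 hlM (by omega : j ≤ k + 1 + 1), ← hsum]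
    linear_combination (depthArea M a l j) * hst
  refine ⟨fun m => s * u m + t * w m, fun m => ?_, fun m => ?_, hax, ?_, ?_, fun j hj => ?_⟩
  · have h1 := mul_le_mul_of_nonneg_left (succ_le_removeStrip (a := a) (l := l) k m) hs
    have h2 := mul_le_mul_of_nonneg_left (succ_le_removeStrip (a := a) (l := l) (k + 1) m) ht
    have := hcomb (l (m + 1))
    linarith
  · have h1 := mul_le_mul_of_nonneg_left (removeStrip_le (a := a) hl k m) hs
    have h2 := mul_le_mul_of_nonneg_left (removeStrip_le (a := a) hl (k + 1) m) ht
    have := hcomb (l m)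
    simp only
    linarith
  · simp only [hu, hw, removeStrip_zero hl h0]
    exact (hcomb _).symm
  · have h1 := hsmall 1 (by omega)
    rw [depthArea_one hau, depthArea_one haw, depthArea_one hal, heq,
      sum_Icc_succ_top (by omega : 1 ≤ N + 1), mul_sum, mul_sum, ← sum_add_distrib] at h1
    rw [add_sub_cancel_right] at h1
    rw [← h1]
    refine sum_congr rfl fun m _ => ?_
    linear_combination (a m) * hst
  · refine (depthArea_convexCombination_le hs ht hst j).trans ?_
    rcases Nat.lt_or_ge (k + 1) j with hkj | hkj
    · rw [hu, hw, depthArea_removeStrip_of_lt ha ha0 hl h0 hlM (by omega : k < j),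
        depthArea_removeStrip_of_lt ha ha0 hl h0 hlM hkj, ← hcomb]
      refine (hineq (j + 1) (by omega)).trans ?_
      rw [← map_add_right_Icc j N 1, sum_map]
      refine sum_le_sum fun n hn => ?_
      rw [mem_Icc] at hn
      exact hμ.2 n (by omega) (by omega)
    · rw [hsmall j hkj]
      have hj' := hineq j hj
      rcases Nat.lt_or_ge (N + 1) j with hN | hN
      · rw [Icc_eq_empty_of_lt hN] at hj'
        rw [Icc_eq_empty_of_lt (by omega : N < j)]
        simp only [sum_empty] at *
        linarith
      · rw [sum_Icc_succ_top hN] at hj'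
        linarith

/-- Existence of the rows of eigensteps for sequences extended to antitone sequences on `ℕ`. -/
lemma exists_interlacing_rows {M : ℕ} {a μ : ℕ → ℝ} (ha : Antitone a) (ha0 : 0 ≤ a) (N : ℕ)
    (hμ : NonnegNonincrOn N μ) {l : ℕ → ℝ} (hl : Antitone l) (h0 : l 0 = a 0)
    (hlM : ∀ m, M < m → l m = 0) (hal : a ≤ l)
    (heq : ∑ m ∈ Icc 1 M, (l m - a m) = ∑ n ∈ Icc 1 N, μ n)
    (hineq : ∀ j, 1 ≤ j → depthArea M a l j ≤ ∑ n ∈ Icc j N, μ n) :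
    ∃ L : ℕ → ℕ → ℝ, (∀ m, 1 ≤ m → m ≤ M → L 0 m = a m) ∧ L N = l ∧
      (∀ P, P ≤ N → Antitone (L P) ∧ a ≤ L P ∧
        ∑ m ∈ Icc 1 M, L P m = ∑ m ∈ Icc 1 M, a m + ∑ n ∈ Icc 1 P, μ n) ∧
      ∀ P, P < N → L P ≤ L (P + 1) ∧ ∀ m, L (P + 1) (m + 1) ≤ L P m := by
  induction N generalizing l with
  | zero =>
    have hzero : ∑ m ∈ Icc 1 M, (l m - a m) = 0 := by simpa using heq
    refine ⟨fun _ => l, fun m h1 hm => ?_, rfl, fun P hP => ⟨hl, hal, ?_⟩, fun P hP => by omega⟩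
    · have := (sum_eq_zero_iff_of_nonneg fun m _ => sub_nonneg.2 (hal m)).1 hzero m
        (mem_Icc.2 ⟨h1, hm⟩)
      exact sub_eq_zero.1 this
    · obtain rfl : P = 0 := by omega
      rw [sum_sub_distrib] at hzero
      simp only [zero_lt_one, Icc_eq_empty_of_lt, sum_empty]
      linarith
  | succ N ih =>
    obtain ⟨x, hlx, hxl, hax, hx0, hxeq, hxineq⟩ :=
      exists_previous_row ha ha0 hl h0 hlM hal hμ heq hineq
    have hx : Antitone x := antitone_nat_of_succ_le fun m => (hxl (m + 1)).trans (hlx m)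
    have hxM : ∀ m, M < m → x m = 0 := fun m hm =>
      le_antisymm ((hxl m).trans_eq (hlM m hm)) ((ha0 m).trans (hax m))
    obtain ⟨L, hL0, hLN, hrow, hstep⟩ := ih
      ⟨fun m h1 hm => hμ.1 m h1 (by omega), fun m h1 hm => hμ.2 m h1 (by omega)⟩
      hx hx0 hxM hax hxeq hxineq
    refine ⟨fun P => if P ≤ N then L P else l, fun m h1 hm => ?_, ?_, fun P hP => ?_,
      fun P hP => ?_⟩
    · simpa using hL0 m h1 hm
    · simp
    · rcases Nat.lt_or_ge N P with h | h
      · obtain rfl : P = N + 1 := by omega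
        simp only [if_neg (by omega : ¬ N + 1 ≤ N)]
        refine ⟨hl, hal, ?_⟩
        rw [← heq, sum_sub_distrib]
        ring
      · simp only [if_pos h]
        exact hrow P h
    · rcases Nat.lt_or_ge P N with h | h
      · simp only [if_pos h.le, if_pos (by omega : P + 1 ≤ N)]
        exact hstep P h
      · obtain rfl : P = N := by omega
        simp only [le_refl, if_true, if_neg (by omega : ¬ P + 1 ≤ P), hLN]
        exact ⟨hxl, hlx⟩

/-- The extension of `a 1, …, a M` by `b` at `0` and by zeros beyond `M`. -/
noncomputable def extendSeq (M : ℕ) (b : ℝ) (a : ℕ → ℝ) (m : ℕ) : ℝ :=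
  if m = 0 then b else if m ≤ M then a m else 0

lemma extendSeq_of_mem {M m : ℕ} {b : ℝ} {a : ℕ → ℝ} (h1 : 1 ≤ m) (hm : m ≤ M) :
    extendSeq M b a m = a m := by
  rw [extendSeq, if_neg (by omega), if_pos hm]

lemma extendSeq_of_lt {M m : ℕ} {b : ℝ} {a : ℕ → ℝ} (hm : M < m) : extendSeq M b a m = 0 := by
  rw [extendSeq, if_neg (by omega), if_neg (by omega)]

lemma antitone_extendSeq {M : ℕ} {b : ℝ} {a : ℕ → ℝ} (ha : NonnegNonincrOn M a) (hb0 : 0 ≤ b)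
    (hb : 1 ≤ M → a 1 ≤ b) : Antitone (extendSeq M b a) := by
  refine antitone_nat_of_succ_le fun m => ?_
  rcases Nat.lt_or_ge M (m + 1) with h | h
  · rw [extendSeq_of_lt h]
    unfold extendSeq
    split_ifs with h1 h2
    · exact hb0
    · exact ha.1 m (by omega) h2
    · exact le_rfl
  · rw [extendSeq_of_mem (by omega) h]
    rcases Nat.eq_zero_or_pos m with rfl | hm
    · exact hb h
    · rw [extendSeq_of_mem hm (by omega)]
      exact ha.2 m hm (by omega)

/-- If `α`, `lam`, `μ` are nonnegative nonincreasing with `α m ≤ lam m` for all `m` and the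
generalized Schur-Horn conditions hold, then a sequence of eigensteps from `α` to `lam`
with lengths `μ` exists. -/
theorem eigensteps_sufficient (M N : ℕ) (α lam μ : ℕ → ℝ)
    (hα : NonnegNonincrOn M α) (hlam : NonnegNonincrOn M lam)
    (hμ : NonnegNonincrOn N μ)
    (hle : ∀ m, 1 ≤ m → m ≤ M → α m ≤ lam m)
    (heq : ∑ m ∈ Icc 1 M, (lam m - α m) = ∑ n ∈ Icc 1 N, μ n)
    (hineq : ∀ j, 1 ≤ j → j ≤ M →
      ∑ m ∈ Icc j M, max (lam m - α (m - j + 1)) 0 ≤ ∑ n ∈ Icc j N, μ n) :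
    ∃ L : ℕ → ℕ → ℝ, IsEigensteps M N α lam μ L := by
  set b := max (lam 1) 0 with hb
  have hb0 : 0 ≤ b := le_max_right _ _
  have hbl : lam 1 ≤ b := le_max_left _ _
  set a := extendSeq M b α with ha_def
  set l := extendSeq M b lam with hl_def
  have ha : Antitone a := antitone_extendSeq hα hb0 fun h => (hle 1 le_rfl h).trans hbl
  have hl : Antitone l := antitone_extendSeq hlam hb0 fun _ => hbl
  have h0 : l 0 = a 0 := rfl
  have ha0 : 0 ≤ a := fun m => by
    simp only [ha_def, extendSeq, Pi.zero_apply]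
    split_ifs with h1 h2
    · exact hb0
    · exact hα.1 m (by omega) h2
    · exact le_rfl
  have hal : a ≤ l := fun m => by
    simp only [ha_def, hl_def, extendSeq]
    split_ifs with h1 h2
    · exact le_rfl
    · exact hle m (by omega) h2
    · exact le_rfl
  have heq' : ∑ m ∈ Icc 1 M, (l m - a m) = ∑ n ∈ Icc 1 N, μ n := by
    rw [← heq]
    refine sum_congr rfl fun m hm => ?_
    rw [mem_Icc] at hm
    rw [ha_def, hl_def, extendSeq_of_mem hm.1 hm.2, extendSeq_of_mem hm.1 hm.2]
  have hineq' : ∀ j, 1 ≤ j → depthArea M a l j ≤ ∑ n ∈ Icc j N, μ n := by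
    intro j hj
    rcases Nat.lt_or_ge M j with h | h
    · rw [depthArea_eq_zero hl h0 h]
      refine sum_nonneg fun n hn => ?_
      rw [mem_Icc] at hn
      exact hμ.1 n (by omega) hn.2
    · refine le_trans (le_of_eq ?_) (hineq j hj h)
      rw [depthArea, ← sum_subset (Icc_subset_Icc_left hj)]
      · refine sum_congr rfl fun m hm => ?_
        rw [mem_Icc] at hm
        rw [ha_def, hl_def, extendSeq_of_mem (by omega) hm.2,
          extendSeq_of_mem (by omega) (by omega), show m + 1 - j = m - j + 1 by omega]
      · intro m hm hmj
        rw [mem_Icc] at hm hmj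
        refine max_eq_right ?_
        rw [show m + 1 - j = 0 by omega, ← h0]
        linarith [hl (Nat.zero_le m)]
  obtain ⟨L, hL0, hLN, hrow, hstep⟩ := exists_interlacing_rows ha ha0 N hμ hl h0
    (fun m hm => extendSeq_of_lt hm) hal heq' hineq'
  refine ⟨L, fun P m hP _ _ => (hrow P hP).1 (Nat.le_succ m), fun m h1 hm => ?_,
    fun m h1 hm => ?_, fun P hP => ?_, fun P m h1 hP _ _ => ?_, fun P h1 hP => ?_,
    fun P m h1 hP _ _ => ?_⟩
  · rw [hL0 m h1 hm, ha_def, extendSeq_of_mem h1 hm]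
  · rw [hLN, hl_def, extendSeq_of_mem h1 hm]
  · rw [(hrow P hP).2.2]
    congr 1
    refine sum_congr rfl fun m hm => ?_
    rw [mem_Icc] at hm
    rw [ha_def, extendSeq_of_mem hm.1 hm.2]
  · obtain ⟨Q, rfl⟩ := Nat.exists_eq_add_of_le' h1
    exact (hstep Q (by omega)).2 m
  · exact (ha0 M).trans ((hrow (P - 1) (by omega)).2.1 M)
  · obtain ⟨Q, rfl⟩ := Nat.exists_eq_add_of_le' h1
    exact (hstep Q (by omega)).1 m
end

section
/- Let M and N be positive integers and let α = (α_1,…,α_M), λ = (λ_1,…,λ_M) and μ = (μ_1,…,μ_N) be nonnegative nonincreasing real sequences with α_m ≤ λ_m for all m, satisfying Σ_{m=1}^{M} (λ_m − α_m) = Σ_{n=1}^{N} μ_n and Σ_{m=j}^{M} (λ_m − α_{m−j+1})^+ ≤ Σ_{n=j}^{N} μ_n for all j = 1,…,M (empty sums are 0). For p = 1,…,M+1 define the p-th chopped spectrum η_{p;m} := max{λ_{m+1}, min{λ_m, α_{m−p+1}}} for m = 1,…,M, under the conventions λ_{M+1} := 0 and α_i := +∞ for i ≤ 0 (so that η_{p;m}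 = λ_m whenever m ≤ p−1). Then: (1) for each m, the sequence p ↦ η_{p;m} is nondecreasing in p; (2) η_{1;m} = max{λ_{m+1}, α_m} for all m; (3) η_{M+1;m} = λ_m for all m; and (4) there exist an index p ∈ {1,…,M} and a real sequence κ = (κ_1,…,κ_M) such that Σ_{m=1}^{M} κ_m = Σ_{m=1}^{M} α_m + Σ_{n=1}^{N−1} μ_n and η_{p;m} ≤ κ_m ≤ η_{p+1;m} for all m = 1,…,M. -/
open Finset

/-- A real number between two values of a sequence lies between two consecutive values. -/
theorem exists_consecutive_le_le (f : ℕ → ℝ) (T : ℝ) (M : ℕ) (hM : 0 < M) (h1 : f 1 ≤ T)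
    (h2 : T ≤ f (M + 1)) : ∃ p, 1 ≤ p ∧ p ≤ M ∧ f p ≤ T ∧ T ≤ f (p + 1) := by
  induction M, hM using Nat.le_induction with
  | base => exact ⟨1, le_rfl, le_rfl, h1, h2⟩
  | succ k hk ih =>
    rcases le_total T (f (k + 1)) with h | h
    · obtain ⟨p, hp1, hpk, hp⟩ := ih h
      exact ⟨p, hp1, by omega, hp⟩
    · exact ⟨k + 1, by omega, le_rfl, h, h2⟩

/-- If `a ≤ b` on a finset, every number between `∑ a` and `∑ b` is the sum of a function
between `a` and `b`. -/
theorem exists_sum_eq_of_sum_le_of_le_sum {ι : Type*} (s : Finset ι) (a b : ι → ℝ) (T : ℝ)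
    (hab : ∀ i ∈ s, a i ≤ b i) (ha : ∑ i ∈ s, a i ≤ T) (hb : T ≤ ∑ i ∈ s, b i) :
    ∃ κ : ι → ℝ, ∑ i ∈ s, κ i = T ∧ ∀ i ∈ s, a i ≤ κ i ∧ κ i ≤ b i := by
  rcases (ha.trans hb).eq_or_lt with h | h
  · exact ⟨a, by linarith, fun i hi => ⟨le_rfl, hab i hi⟩⟩
  · have hpos : 0 < ∑ i ∈ s, b i - ∑ i ∈ s, a i := sub_pos.2 h
    obtain ⟨t, ht⟩ : ∃ t, t = (T - ∑ i ∈ s, a i) / (∑ i ∈ s, b i - ∑ i ∈ s, a i) := ⟨_, rfl⟩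
    have ht0 : 0 ≤ t := ht ▸ div_nonneg (by linarith) hpos.le
    have ht1 : t ≤ 1 := ht ▸ (div_le_one hpos).2 (by linarith)
    refine ⟨fun i => a i + t * (b i - a i), ?_, fun i hi => ?_⟩
    · rw [sum_add_distrib, ← mul_sum, sum_sub_distrib, ht, div_mul_cancel₀ _ hpos.ne']
      ring
    · have := hab i hi
      constructor <;> nlinarith

/-- Shift of the summation index in a sum starting at `2`. -/
theorem sum_Icc_two_succ {β : Type*} [AddCommMonoid β] (f : ℕ → β) (K : ℕ) :
    ∑ n ∈ Icc 2 (K + 1), f n = ∑ n ∈ Icc 1 K, f (n + 1) := by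
  rw [show Icc 2 (K + 1) = (Icc 1 K).map (addRightEmbedding 1) from
    (map_add_right_Icc 1 K 1).symm, sum_map]
  rfl

/-- For a nonincreasing sequence, dropping the first term gives at most what dropping the last
term gives. -/
theorem NonnegNonincrOn.sum_Icc_two_le {N : ℕ} {μ : ℕ → ℝ} (hμ : NonnegNonincrOn N μ) :
    ∑ n ∈ Icc 2 N, μ n ≤ ∑ n ∈ Icc 1 (N - 1), μ n := by
  rcases N with _ | N
  · simp
  · rw [Nat.add_sub_cancel, sum_Icc_two_succ]
    exact sum_le_sum fun n hn => hμ.2 n (mem_Icc.1 hn).1 (by have := (mem_Icc.1 hn).2; omega)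

/-- Properties of the chopped spectra `η p m = max (lam (m+1)) (min (lam m) (α (m-p+1)))`
(with the conventions `lam (M+1) := 0`, encoded via `lam'`, and `α i := +∞` for `i ≤ 0`,
encoded by letting `η p m = lam' m` when `m < p`), and existence of a sequence `κ`
sandwiched between two consecutive chopped spectra with the correct trace. -/
theorem chopped_spectra (M N : ℕ) (hM : 0 < M) (hN : 0 < N) (α lam μ : ℕ → ℝ)
    (hα : NonnegNonincrOn M α) (hlam : NonnegNonincrOn M lam)
    (hμ : NonnegNonincrOn N μ)
    (hle : ∀ m, 1 ≤ m → m ≤ M → α m ≤ lam m)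
    (heq : ∑ m ∈ Icc 1 M, (lam m - α m) = ∑ n ∈ Icc 1 N, μ n)
    (hineq : ∀ j, 1 ≤ j → j ≤ M →
      ∑ m ∈ Icc j M, max (lam m - α (m - j + 1)) 0 ≤ ∑ n ∈ Icc j N, μ n)
    (lam' : ℕ → ℝ) (hlam' : ∀ m, lam' m = if m ≤ M then lam m else 0)
    (η : ℕ → ℕ → ℝ)
    (hη : ∀ p m, η p m =
      if m < p then lam' m
      else max (lam' (m + 1)) (min (lam' m) (α (m - p + 1)))) :
    (∀ p m, 1 ≤ p → p ≤ M → 1 ≤ m → m ≤ M → η p m ≤ η (p + 1) m) ∧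
    (∀ m, 1 ≤ m → m ≤ M → η 1 m = max (lam' (m + 1)) (α m)) ∧
    (∀ m, 1 ≤ m → m ≤ M → η (M + 1) m = lam m) ∧
    (∃ p, 1 ≤ p ∧ p ≤ M ∧ ∃ κ : ℕ → ℝ,
      (∑ m ∈ Icc 1 M, κ m = ∑ m ∈ Icc 1 M, α m + ∑ n ∈ Icc 1 (N - 1), μ n) ∧
      ∀ m, 1 ≤ m → m ≤ M → η p m ≤ κ m ∧ κ m ≤ η (p + 1) m) := by
  have hstep : ∀ m, 1 ≤ m → m ≤ M → lam' (m + 1) ≤ lam' m := by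
    intro m h1 h2
    rw [hlam', hlam', if_pos h2]
    split_ifs with h
    · exact hlam.2 m h1 (by omega)
    · exact hlam.1 m h1 h2
  have hmono : ∀ p m, 1 ≤ p → p ≤ M → 1 ≤ m → m ≤ M → η p m ≤ η (p + 1) m := by
    intro p m hp1 _ hm1 hmM
    rw [hη, hη]
    rcases lt_trichotomy m p with h | rfl | h
    · rw [if_pos h, if_pos (by omega)]
    · rw [if_neg (lt_irrefl _), if_pos (by omega)]
      exact max_le (hstep m hm1 hmM) (min_le_left _ _)
    · rw [if_neg (by omega), if_neg (by omega), show m - (p + 1) + 1 = m - p by omega]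
      exact max_le_max le_rfl (min_le_min le_rfl (hα.2 (m - p) (by omega) (by omega)))
  have hfirst : ∀ m, 1 ≤ m → m ≤ M → η 1 m = max (lam' (m + 1)) (α m) := by
    intro m h1 h2
    rw [hη, if_neg (by omega), show m - 1 + 1 = m by omega, hlam' m, if_pos h2,
      min_eq_right (hle m h1 h2)]
  have hlast : ∀ m, 1 ≤ m → m ≤ M → η (M + 1) m = lam m := by
    intro m _ h2
    rw [hη, if_pos (by omega), hlam', if_pos h2]
  refine ⟨hmono, hfirst, hlast, ?_⟩
  have hlower : ∑ m ∈ Icc 1 M, η 1 m ≤ ∑ m ∈ Icc 1 M, α m + ∑ n ∈ Icc 1 (N - 1), μ n := by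
    have hsplit : ∑ m ∈ Icc 1 M, η 1 m
        = ∑ m ∈ Icc 1 M, α m + ∑ m ∈ Icc 1 M, max (lam' (m + 1) - α m) 0 := by
      rw [← sum_add_distrib]
      refine sum_congr rfl fun m hm => ?_
      rw [hfirst m (mem_Icc.1 hm).1 (mem_Icc.1 hm).2, ← max_add_add_left]
      simp
    rw [hsplit]
    gcongr
    obtain ⟨K, rfl⟩ : ∃ K, M = K + 1 := ⟨M - 1, by omega⟩
    have hend : max (lam' (K + 1 + 1) - α (K + 1)) 0 = 0 := by
      rw [hlam', if_neg (by omega)]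
      exact max_eq_right (by linarith [hα.1 (K + 1) (by omega) le_rfl])
    rw [sum_Icc_succ_top (by omega), hend, add_zero]
    rcases Nat.eq_zero_or_pos K with rfl | hK
    · simpa using sum_nonneg fun n hn => hμ.1 n (mem_Icc.1 hn).1 (by grind)
    · calc ∑ m ∈ Icc 1 K, max (lam' (m + 1) - α m) 0
          = ∑ m ∈ Icc 2 (K + 1), max (lam m - α (m - 2 + 1)) 0 := by
            rw [sum_Icc_two_succ]
            refine sum_congr rfl fun m hm => ?_
            have := mem_Icc.1 hm
            rw [hlam', if_pos (by omega), show m + 1 - 2 + 1 = m by omega]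
        _ ≤ ∑ n ∈ Icc 2 N, μ n := hineq 2 (by omega) (by omega)
        _ ≤ ∑ n ∈ Icc 1 (N - 1), μ n := hμ.sum_Icc_two_le
  have hupper : ∑ m ∈ Icc 1 M, α m + ∑ n ∈ Icc 1 (N - 1), μ n ≤ ∑ m ∈ Icc 1 M, η (M + 1) m := by
    rw [sum_congr rfl fun m hm => hlast m (mem_Icc.1 hm).1 (mem_Icc.1 hm).2]
    rw [sum_sub_distrib] at heq
    have : ∑ n ∈ Icc 1 (N - 1), μ n ≤ ∑ n ∈ Icc 1 N, μ n :=
      sum_le_sum_of_subset_of_nonneg (Icc_subset_Icc le_rfl (by omega))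
        fun n hn _ => hμ.1 n (mem_Icc.1 hn).1 (mem_Icc.1 hn).2
    linarith
  obtain ⟨p, hp1, hpM, hpl, hpu⟩ :=
    exists_consecutive_le_le (fun p => ∑ m ∈ Icc 1 M, η p m) _ M hM hlower hupper
  obtain ⟨κ, hκ, hbd⟩ := exists_sum_eq_of_sum_le_of_le_sum (Icc 1 M) (η p) (η (p + 1)) _
    (fun m hm => hmono p m hp1 hpM (mem_Icc.1 hm).1 (mem_Icc.1 hm).2) hpl hpu
  exact ⟨p, hp1, hpM, κ, hκ, fun m h1 h2 => hbd m (mem_Icc.2 ⟨h1, h2⟩)⟩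
end

section
/- Let M and N be positive integers and let α = (α_1,…,α_M), λ = (λ_1,…,λ_M) and μ = (μ_1,…,μ_N) be nonnegative nonincreasing real sequences with α_m ≤ λ_m for all m, satisfying Σ_{m=1}^{M} (λ_m − α_m) = Σ_{n=1}^{N} μ_n and Σ_{m=j}^{M} (λ_m − α_{m−j+1})^+ ≤ Σ_{n=j}^{N} μ_n for all j = 1,…,M (empty sums are 0). Then Σ_{m=1}^{M} max{λ_{m+1}, α_m} ≤ Σ_{m=1}^{M} α_m + Σ_{n=1}^{N−1} μ_n, under the convention λ_{M+1} := 0. -/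
open Finset

/-- Under the generalized Schur-Horn conditions, the trace of the first chopped spectrum
is at most `∑ α m + ∑_{n=1}^{N-1} μ n`; here `lam (M+1) := 0` is encoded via `lam'`. -/
theorem trace_first_chop_le (M N : ℕ) (hM : 0 < M) (hN : 0 < N) (α lam μ : ℕ → ℝ)
    (hα : NonnegNonincrOn M α) (hlam : NonnegNonincrOn M lam)
    (hμ : NonnegNonincrOn N μ)
    (hle : ∀ m, 1 ≤ m → m ≤ M → α m ≤ lam m)
    (heq : ∑ m ∈ Icc 1 M, (lam m - α m) = ∑ n ∈ Icc 1 N, μ n)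
    (hineq : ∀ j, 1 ≤ j → j ≤ M →
      ∑ m ∈ Icc j M, max (lam m - α (m - j + 1)) 0 ≤ ∑ n ∈ Icc j N, μ n)
    (lam' : ℕ → ℝ) (hlam' : ∀ m, lam' m = if m ≤ M then lam m else 0) :
    ∑ m ∈ Icc 1 M, max (lam' (m + 1)) (α m)
      ≤ ∑ m ∈ Icc 1 M, α m + ∑ n ∈ Icc 1 (N - 1), μ n := by
  have shift (f : ℕ → ℝ) (n : ℕ) : ∑ k ∈ Icc 2 (n + 1), f k = ∑ k ∈ Icc 1 n, f (k + 1) := by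
    rw [← map_add_right_Icc 1 n 1, sum_map]
    rfl
  obtain ⟨N, rfl⟩ := Nat.exists_eq_succ_of_ne_zero hN.ne'
  obtain ⟨M, rfl⟩ := Nat.exists_eq_succ_of_ne_zero hM.ne'
  simp only [Nat.succ_eq_add_one, Nat.add_sub_cancel] at *
  have tail_le : ∑ n ∈ Icc 2 (N + 1), μ n ≤ ∑ n ∈ Icc 1 N, μ n := by
    rw [shift]
    refine sum_le_sum fun n hn => hμ.2 n ?_ ?_ <;> grind
  have chop_le : ∑ m ∈ Icc 1 M, max (lam (m + 1) - α m) 0 ≤ ∑ n ∈ Icc 1 N, μ n := by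
    rcases Nat.eq_zero_or_pos M with rfl | hM'
    · simpa using sum_nonneg fun n hn => hμ.1 n (by grind) (by grind)
    · refine le_trans (le_of_eq ?_) ((hineq 2 (by omega) (by omega)).trans tail_le)
      rw [shift]
      refine sum_congr rfl fun m hm => ?_
      rw [show m + 1 - 2 + 1 = m by grind]
  have last_eq : max (lam' (M + 1 + 1)) (α (M + 1)) = α (M + 1) := by
    rw [hlam', if_neg (by omega), max_eq_right (hα.1 _ (by omega) le_rfl)]
  have split_eq : ∑ m ∈ Icc 1 M, max (lam' (m + 1)) (α m)
      = ∑ m ∈ Icc 1 M, α m + ∑ m ∈ Icc 1 M, max (lam (m + 1) - α m) 0 := by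
    rw [← sum_add_distrib]
    refine sum_congr rfl fun m hm => ?_
    rw [hlam', if_pos (by grind), ← max_add_add_left]
    simp
  rw [sum_Icc_succ_top (by omega), sum_Icc_succ_top (by omega), last_eq, split_eq]
  linarith
end

section
/- Let M and N be positive integers and let α = (α_1,…,α_M), λ = (λ_1,…,λ_M) and μ = (μ_1,…,μ_N) be nonnegative nonincreasing real sequences with α_m ≤ λ_m for all m, satisfying Σ_{m=1}^{M} (λ_m − α_m) = Σ_{n=1}^{N} μ_n and Σ_{m=j}^{M} (λ_m − α_{m−j+1})^+ ≤ Σ_{n=j}^{N} μ_n for all j = 1,…,M (empty sums are 0). Suppose p ∈ {1,…,M} and κ = (κ_1,…,κ_M) satisfy Σ_{m=1}^{M} κ_m = Σ_{m=1}^{M} α_m + Σ_{n=1}^{N−1} μ_n and η_{p;m} ≤ κ_m ≤ η_{p+1;m} for all m = 1,…,M. Then κ is nonincreasing with κ_m ≥ α_m for all m; λ interlaces over κ, i.e. λ_{m+1} ≤ κ_m ≤ λ_m for all m = 1,…,M with λ_{M+1} := 0; and Σ_{m=1}^{M} (κ_m − α_m) = Σ_{n=1}^{N−1} μ_n and Σ_{m=j}^{M}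 (κ_m − α_{m−j+1})^+ ≤ Σ_{n=j}^{N−1} μ_n for all j = 1,…,M. Moreover, if N = 1 then κ_m = α_m for all m = 1,…,M. -/
open Finset

/-- A nonincreasing sequence is antitone on `{1, …, M}`. -/
lemma NonnegNonincrOn.antitone {M : ℕ} {a : ℕ → ℝ} (ha : NonnegNonincrOn M a) {i j : ℕ}
    (hi : 1 ≤ i) (hij : i ≤ j) (hj : j ≤ M) : a j ≤ a i := by
  induction j, hij using Nat.le_induction with
  | base => exact le_rfl
  | succ k hk ih => exact (ha.2 k (by omega) (by omega)).trans (ih (by omega))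

lemma sum_Icc_add_one_eq (f : ℕ → ℝ) (a b : ℕ) :
    ∑ n ∈ Icc (a + 1) (b + 1), f n = ∑ n ∈ Icc a b, f (n + 1) := by
  rw [← Finset.map_add_right_Icc, Finset.sum_map]
  rfl

/-- Shifting a window of a nonincreasing sequence to the left does not decrease its sum. -/
lemma NonnegNonincrOn.sum_Icc_succ_le {N : ℕ} {μ : ℕ → ℝ} (hμ : NonnegNonincrOn (N + 1) μ)
    {j : ℕ} (hj : 1 ≤ j) : ∑ n ∈ Icc (j + 1) (N + 1), μ n ≤ ∑ n ∈ Icc j N, μ n := by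
  rw [sum_Icc_add_one_eq]
  refine Finset.sum_le_sum fun n hn => ?_
  rw [Finset.mem_Icc] at hn
  exact hμ.2 n (by omega) (by omega)

/-- If `k` lies between `min l a` and `l`, then passing from `l` to `k` lowers the excess over `a`
by exactly `l - k`. -/
lemma max_sub_zero_eq_of_min_le {k l a : ℝ} (hkl : k ≤ l) (h : min l a ≤ k) :
    max (k - a) 0 = max (l - a) 0 - (l - k) := by
  grind

lemma max_sub_zero_le_of_le_max {k l a : ℝ} (h : k ≤ max l a) :
    max (k - a) 0 ≤ max (l - a) 0 := by
  grind

/-- One backwards eigenstep: if `κ` lies between the `p`-th and `(p+1)`-th chopped spectra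
of `lam` with respect to `α` and has trace `∑ α m + ∑_{n=1}^{N-1} μ n`, then `κ` is
nonincreasing, dominates `α`, is interlaced over by `lam`, and satisfies the generalized
Schur-Horn conditions for `μ 1, …, μ (N-1)`; if `N = 1` then `κ = α`.
Here `lam (M+1) := 0` is encoded via `lam'`, and the convention `α i := +∞` for `i ≤ 0`
is encoded by letting `η p m = lam' m` when `m < p`. -/
theorem backwards_eigenstep (M N : ℕ) (hM : 0 < M) (hN : 0 < N) (α lam μ : ℕ → ℝ)
    (hα : NonnegNonincrOn M α) (hlam : NonnegNonincrOn M lam)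
    (hμ : NonnegNonincrOn N μ)
    (hle : ∀ m, 1 ≤ m → m ≤ M → α m ≤ lam m)
    (heq : ∑ m ∈ Icc 1 M, (lam m - α m) = ∑ n ∈ Icc 1 N, μ n)
    (hineq : ∀ j, 1 ≤ j → j ≤ M →
      ∑ m ∈ Icc j M, max (lam m - α (m - j + 1)) 0 ≤ ∑ n ∈ Icc j N, μ n)
    (lam' : ℕ → ℝ) (hlam' : ∀ m, lam' m = if m ≤ M then lam m else 0)
    (η : ℕ → ℕ → ℝ)
    (hη : ∀ p m, η p m =
      if m < p then lam' m
      else max (lam' (m + 1)) (min (lam' m) (α (m - p + 1))))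
    (p : ℕ) (hp1 : 1 ≤ p) (hpM : p ≤ M) (κ : ℕ → ℝ)
    (hκtr : ∑ m ∈ Icc 1 M, κ m = ∑ m ∈ Icc 1 M, α m + ∑ n ∈ Icc 1 (N - 1), μ n)
    (hκ : ∀ m, 1 ≤ m → m ≤ M → η p m ≤ κ m ∧ κ m ≤ η (p + 1) m) :
    (∀ m, 1 ≤ m → m < M → κ (m + 1) ≤ κ m) ∧
    (∀ m, 1 ≤ m → m ≤ M → α m ≤ κ m) ∧
    (∀ m, 1 ≤ m → m ≤ M → lam' (m + 1) ≤ κ m ∧ κ m ≤ lam m) ∧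
    (∑ m ∈ Icc 1 M, (κ m - α m) = ∑ n ∈ Icc 1 (N - 1), μ n) ∧
    (∀ j, 1 ≤ j → j ≤ M →
      ∑ m ∈ Icc j M, max (κ m - α (m - j + 1)) 0 ≤ ∑ n ∈ Icc j (N - 1), μ n) ∧
    (N = 1 → ∀ m, 1 ≤ m → m ≤ M → κ m = α m) := by
  obtain ⟨N, rfl⟩ : ∃ K, N = K + 1 := ⟨N - 1, by omega⟩
  rw [Nat.add_sub_cancel] at hκtr ⊢
  have hlamM : ∀ m, m ≤ M → lam' m = lam m := fun m hm => by rw [hlam', if_pos hm]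
  have hlamtop : lam' (M + 1) = 0 := by rw [hlam', if_neg (by omega)]
  have hstep : ∀ m, 1 ≤ m → m ≤ M → lam' (m + 1) ≤ lam m := by
    intro m h1 hm
    rcases hm.lt_or_eq with h | rfl
    · rw [hlamM _ (by omega)]
      exact hlam.2 m h1 h
    · rw [hlamtop]
      exact hlam.1 m h1 le_rfl
  have hinter : ∀ m, 1 ≤ m → m ≤ M → lam' (m + 1) ≤ κ m ∧ κ m ≤ lam m := by
    intro m h1 hm
    have hs := hstep m h1 hm
    obtain ⟨hlo, hhi⟩ := hκ m h1 hm
    rw [hη, hlamM m hm] at hlo hhi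
    constructor
    · refine le_trans ?_ hlo
      split_ifs
      · exact hs
      · exact le_max_left _ _
    · refine hhi.trans ?_
      split_ifs
      · exact le_rfl
      · exact max_le hs (min_le_left _ _)
  -- the `p`-th chopped spectrum dominates the `j`-th one for `j ≤ p`
  have hmin : ∀ j, 1 ≤ j → j ≤ p → ∀ m, j ≤ m → m ≤ M →
      min (lam m) (α (m - j + 1)) ≤ κ m := by
    intro j hj hjp m hjm hm
    have hlo := (hκ m (by omega) hm).1
    rw [hη, hlamM m hm] at hlo
    refine le_trans ?_ hlo
    split_ifs with h
    · exact min_le_left _ _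
    · exact (min_le_min_left _ (hα.antitone (by omega) (by omega) (by omega))).trans
        (le_max_right _ _)
  have hακ : ∀ m, 1 ≤ m → m ≤ M → α m ≤ κ m := by
    intro m h1 hm
    have h := hmin 1 le_rfl hp1 m h1 hm
    rwa [Nat.sub_add_cancel h1, min_eq_right (hle m h1 hm)] at h
  have htr : ∑ m ∈ Icc 1 M, (κ m - α m) = ∑ n ∈ Icc 1 N, μ n := by
    rw [Finset.sum_sub_distrib, hκtr]
    ring
  refine ⟨fun m h1 hm => ?_, hακ, hinter, htr, fun j hj hjM => ?_, fun hN1 m h1 hm => ?_⟩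
  · have h := (hinter m h1 hm.le).1
    rw [hlamM _ (by omega)] at h
    exact (hinter (m + 1) (by omega) hm).2.trans h
  · rcases le_or_gt j p with hjp | hpj
    · -- the whole trace drop `μ (N + 1)` takes place at indices `≥ j`
      have hdrop : ∑ m ∈ Icc j M, (lam m - κ m) = μ (N + 1) := by
        have hsub : ∑ m ∈ Icc j M, (lam m - κ m) = ∑ m ∈ Icc 1 M, (lam m - κ m) := by
          refine Finset.sum_subset (Finset.Icc_subset_Icc_left hj) fun m hm hmj => ?_
          rw [Finset.mem_Icc] at hm hmj
          have hlo := (hκ m hm.1 hm.2).1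
          rw [hη, if_pos (by omega), hlamM m hm.2] at hlo
          linarith [(hinter m hm.1 hm.2).2]
        rw [Finset.sum_Icc_succ_top (by omega), Finset.sum_sub_distrib] at heq
        rw [hsub, Finset.sum_sub_distrib]
        linarith
      have hsum : ∑ m ∈ Icc j M, max (κ m - α (m - j + 1)) 0 =
          ∑ m ∈ Icc j M, max (lam m - α (m - j + 1)) 0 - μ (N + 1) := by
        rw [← hdrop, ← Finset.sum_sub_distrib]
        refine Finset.sum_congr rfl fun m hm => ?_
        rw [Finset.mem_Icc] at hm
        exact max_sub_zero_eq_of_min_le (hinter m (by omega) hm.2).2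
          (hmin j hj hjp m hm.1 hm.2)
      have hbound := hineq j hj hjM
      rcases le_or_gt j (N + 1) with hjN | hjN
      · rw [Finset.sum_Icc_succ_top hjN] at hbound
        linarith
      · rw [Finset.Icc_eq_empty_of_lt hjN, Finset.sum_empty] at hbound
        rw [Finset.Icc_eq_empty_of_lt (by omega : N < j), Finset.sum_empty]
        linarith [hμ.1 (N + 1) (by omega) le_rfl]
    · refine le_trans ?_ (hμ.sum_Icc_succ_le hj)
      have hterm : ∑ m ∈ Icc j M, max (κ m - α (m - j + 1)) 0 ≤
          ∑ m ∈ Icc j M, max (lam' (m + 1) - α (m + 1 - (j + 1) + 1)) 0 := by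
        refine Finset.sum_le_sum fun m hm => ?_
        rw [Finset.mem_Icc] at hm
        have hhi := (hκ m (by omega) hm.2).2
        rw [hη, if_neg (by omega)] at hhi
        have hmono : α (m - (p + 1) + 1) ≤ α (m - j + 1) :=
          hα.antitone (by omega) (by omega) (by omega)
        rw [Nat.add_sub_add_right]
        exact max_sub_zero_le_of_le_max
          (hhi.trans (max_le_max_left _ ((min_le_right _ _).trans hmono)))
      refine hterm.trans ?_
      rw [← sum_Icc_add_one_eq (fun m => max (lam' m - α (m - (j + 1) + 1)) 0),
        Finset.sum_Icc_succ_top (by omega), hlamtop, max_eq_right (by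
          linarith [hα.1 (M + 1 - (j + 1) + 1) (by omega) (by omega)]), add_zero]
      rcases hjM.lt_or_eq with h | rfl
      · refine le_trans (Finset.sum_le_sum fun m hm => ?_) (hineq (j + 1) (by omega) h)
        rw [hlamM m (Finset.mem_Icc.mp hm).2]
      · rw [Finset.Icc_eq_empty (by omega), Finset.sum_empty]
        refine Finset.sum_nonneg fun n hn => ?_
        rw [Finset.mem_Icc] at hn
        exact hμ.1 n (by omega) hn.2
  · obtain rfl : N = 0 := by omega
    rw [Finset.Icc_eq_empty (by omega : ¬ 1 ≤ 0), Finset.sum_empty,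
      Finset.sum_eq_zero_iff_of_nonneg fun m hm => sub_nonneg.mpr
        (hακ m (Finset.mem_Icc.mp hm).1 (Finset.mem_Icc.mp hm).2)] at htr
    exact sub_eq_zero.mp (htr m (Finset.mem_Icc.mpr ⟨h1, hm⟩))
end
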